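/- (7/144)·S^⧢(Gr_4) + 2·Alt_8 S^⧢ Ĩ_{3,1}( CR(34|2567), CR(67|1345) ) = Alt_8 S^⧢[ −V( ρ_4/ρ_1 ; (ρ_{4,2}/ρ_{4,1}, ρ_{4,1}/ρ_{4,3}) − (CR(43|2685), CR(48|7653)) + (1/4)(CR(43|1256), CR(43|1268)) − (1/12)(CR(43|1256), CR(42|1365)) ) + V( ρ_2/ρ_1 ; −(CR(43|2685), CR(48|7653)) + (CR(48|7235), CR(48|7263)) + (1/2)(CR(46|5238), CR(43|2568)) ) + S36( (ρ_{1,2}ρ_{3,4})/(ρ_{1,4}ρ_{3,2}), ρ_1/ρ_{1,4} ) + 2·S36( ρ_{1,2}/ρ_1, ρ_{3,2}/ρ_{3,4} ) + 6·Li_4( (ρ_1 ρ_{3,2})/(ρ_{1,2}ρ_{3,4}) ) ] in V_F^{⊗4}, where S36(a, b) := I_{3,1}(a, b) − Ĩ_{3,1}(a, b). -/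

import Mathlib

open scoped TensorProduct
open PiTensorProduct

attribute [local instance] Classical.propDecidable

set_option maxHeartbeats 1000000
set_option synthInstance.maxHeartbeats 400000

noncomputable section

namespace GrassPoly

variable (F : Type) [Field F]

/-- `V_F = F^× ⊗_ℤ ℚ` as a `ℚ`-vector space. -/
abbrev VF : Type := ℚ ⊗[ℤ] (Additive Fˣ)

variable {F}

/-- The class `[a]` of a nonzero field element in `V_F` (defined to be `0` for `a = 0`). -/
def cls (a : F) : VF F :=
  if h : a = 0 then 0 else (1 : ℚ) ⊗ₜ[ℤ] (Additive.ofMul (Units.mk0 a h))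

variable (F) in
/-- Tensor powers of V_F over ℚ. -/
abbrev TP (n : ℕ) : Type := ⨂[ℚ]^n (VF F)

instance instTPAddCommGroup (n : ℕ) : AddCommGroup (TP F n) :=
  Module.addCommMonoidToAddCommGroup ℚ

/-- Appending one extra tensor factor on the right. -/
def snoc {n : ℕ} : TP F n →ₗ[ℚ] VF F →ₗ[ℚ] TP F (n + 1) :=
  PiTensorProduct.lift
    ((PiTensorProduct.tprod ℚ (s := fun _ : Fin (n + 1) => VF F)).curryRight)

/-- The factor `t_i` appearing in the recursive definition of the symbol,
as a function of `(a_{i-1}, a_i, a_{i+1})`. -/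
def tCoef (p a q : F) : VF F :=
  if p = a then (if a = q then 0 else cls (q - a))
  else if a = q then - cls (p - a)
  else cls ((q - a) / (p - a))

/-- The symbol `S I(a₀; a₁, …, a_m; a_{m+1})`, with the middle entries given as a list
(of length `n`). -/
def SIaux : (n : ℕ) → (a0 : F) → (as : List F) → (b : F) → as.length = n → TP F n
  | 0, _, _, _, _ => tprod ℚ (fun i : Fin 0 => i.elim0)
  | n + 1, a0, as, b, h =>
      ∑ i : Fin (n + 1),
        snoc (SIaux n a0 (as.eraseIdx i.val) b
            (by
              have hi' := i.isLt
              have hi : i.val < as.length := by omega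
              have h2 := List.length_eraseIdx_of_lt hi
              omega))
          (tCoef ((a0 :: as).getD i.val 0) (as.getD i.val 0) ((as ++ [b]).getD (i.val + 1) 0))

/-- Cyclic rotation `b₁ ⊗ … ⊗ b_N ↦ b₂ ⊗ … ⊗ b_N ⊗ b₁` on tensor powers. -/
def rotN (n : ℕ) : TP F n ≃ₗ[ℚ] TP F n :=
  PiTensorProduct.reindex ℚ (fun _ : Fin n => VF F) (finRotate n).symm

/-- Splitting off the last tensor factor. -/
def splitLast (n : ℕ) : TP F (n + 1) ≃ₗ[ℚ] (TP F n) ⊗[ℚ] (VF F) :=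
  ((PiTensorProduct.reindex ℚ (fun _ : Fin (n + 1) => VF F)
      (finSumFinEquiv (m := n) (n := 1)).symm).trans
    (PiTensorProduct.tmulEquiv ℚ (VF F)).symm).trans
    (TensorProduct.congr (LinearEquiv.refl ℚ _)
      (PiTensorProduct.subsingletonEquiv (0 : Fin 1)))

/-- The projector `Π̃_N` annihilating symbols of products. -/
def Pit : (n : ℕ) → TP F n →ₗ[ℚ] TP F n
  | 0 => LinearMap.id
  | 1 => LinearMap.id
  | (n + 2) =>
      ((splitLast (n + 1)).symm.toLinearMap
        ∘ₗ TensorProduct.map (Pit (n + 1)) LinearMap.id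
        ∘ₗ (splitLast (n + 1)).toLinearMap)
      ∘ₗ ((LinearMap.id : TP F (n + 2) →ₗ[ℚ] TP F (n + 2)) - (rotN (F := F) (n + 2)).toLinearMap)

/-- The map on `V_F` induced by a field automorphism. -/
def vmap (φ : F ≃+* F) : VF F →ₗ[ℚ] VF F :=
  TensorProduct.AlgebraTensorModule.map (LinearMap.id : ℚ →ₗ[ℚ] ℚ)
    (AddMonoidHom.toIntLinearMap
      { toFun := fun a => Additive.ofMul ((Units.map (φ : F →* F)) a.toMul)
        map_zero' := by simp
        map_add' := by intro a b; simp [_root_.map_mul] })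

/-- The induced map on tensor powers. -/
def tpMap {n : ℕ} (φ : F ≃+* F) : TP F n →ₗ[ℚ] TP F n :=
  PiTensorProduct.map (fun _ => vmap φ)


/-! ### Symbols of (multiple) polylogarithms -/

/-- Symbol of `Li₂`. -/
def SLi2 (x : F) : TP F 2 := - SIaux 2 0 [x⁻¹, 0] 1 rfl

/-- Symbol of `Li₃`. -/
def SLi3 (x : F) : TP F 3 := - SIaux 3 0 [x⁻¹, 0, 0] 1 rfl

/-- Symbol of `Li₄`. -/
def SLi4 (x : F) : TP F 4 := - SIaux 4 0 [x⁻¹, 0, 0, 0] 1 rfl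

/-- Symbol of `Li₅`. -/
def SLi5 (x : F) : TP F 5 := - SIaux 5 0 [x⁻¹, 0, 0, 0, 0] 1 rfl

/-- Symbol of `I_{3,1}(x,y) = I(0; x,0,0,y; 1)`. -/
def SI31 (x y : F) : TP F 4 := SIaux 4 0 [x, 0, 0, y] 1 rfl

/-- Symbol of `I_{4,1}(x,y) = I(0; x,0,0,0,y; 1)`. -/
def SI41 (x y : F) : TP F 5 := SIaux 5 0 [x, 0, 0, 0, y] 1 rfl

/-- Symbol of `I⁺_{4,1}(x,y) = ½ (I_{4,1}(x,y) + I_{4,1}(x,y⁻¹))`. -/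
def I41p (x y : F) : TP F 5 := (2 : ℚ)⁻¹ • (SI41 x y + SI41 x y⁻¹)

/-- The anharmonic orbit of `x`, together with the signs of the
corresponding permutations in `S₃`. -/
def anhList (x : F) : List (ℚ × F) :=
  [(1, x), (1, (1 - x)⁻¹), (1, 1 - x⁻¹), (-1, x⁻¹), (-1, 1 - x), (-1, x / (x - 1))]

/-- Symbol of `Ĩ_{3,1}(x,y) = (1/36) Σ_{σ,π ∈ S₃} sgn(σ) sgn(π) I_{3,1}(x^σ, y^π)`. -/
def tI31 (x y : F) : TP F 4 :=
  (36 : ℚ)⁻¹ •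
    ((anhList x).map (fun p =>
      ((anhList y).map (fun q => (p.1 * q.1) • SI31 p.2 q.2)).sum)).sum

/-- Symbol of `Ĩ⁺_{4,1}(x,y) = (1/6) Σ_{σ ∈ S₃} sgn(σ) I⁺_{4,1}(x^σ, y)`. -/
def tI41p (x y : F) : TP F 5 :=
  (6 : ℚ)⁻¹ • ((anhList x).map (fun p => p.1 • I41p p.2 y)).sum

/-- Symbol of `V(z; x, y) = Ĩ_{3,1}(z, [x]+[y]+[(1-x)/(1-xy)]+[1-xy]+[(1-y)/(1-xy)])`. -/
def Vc (z x y : F) : TP F 4 :=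
  tI31 z x + tI31 z y + tI31 z ((1 - x) / (1 - x * y)) + tI31 z (1 - x * y)
    + tI31 z ((1 - y) / (1 - x * y))

/-- `Sym₃₆(a,b) := I_{3,1}(a,b) - Ĩ_{3,1}(a,b)` (on the level of symbols). -/
def S36 (a b : F) : TP F 4 := SI31 a b - tI31 a b

/-! ### Generic vectors -/

variable (N m : ℕ)

/-- Polynomial ring on the entries of `N` generic vectors in `m`-space. -/
abbrev Pol : Type := MvPolynomial (Fin N × Fin m) ℚ

/-- The field of rational functions in the entries of `N` generic vectors in `m`-space. -/
abbrev FF : Type := FractionRing (Pol N m)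

/-- The `j`-th coordinate of the `i`-th generic vector. -/
def gen (i : Fin N) (j : Fin m) : FF N m :=
  algebraMap (Pol N m) (FF N m) (MvPolynomial.X (i, j))

/-- `⟨i₁ … i_m⟩`: the determinant of the matrix whose columns are
the generic vectors selected by `cols`. -/
def dets (cols : Fin m → Fin N) : FF N m :=
  (Matrix.of fun r c => gen N m (cols c) r).det

/-- The field automorphism of `FF N m` induced by a permutation of the `N` vectors. -/
def permAut (σ : Equiv.Perm (Fin N)) : FF N m ≃+* FF N m :=
  IsFractionRing.ringEquivOfRingEquiv
    ((MvPolynomial.renameEquiv ℚ (σ.prodCongr (Equiv.refl (Fin m)))).toRingEquiv)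

variable {N m}

/-- Skew-symmetrization over all permutations of the `N` generic vectors. -/
def Alt {n : ℕ} (x : TP (FF N m) n) : TP (FF N m) n :=
  ∑ σ : Equiv.Perm (Fin N), (((Equiv.Perm.sign σ : ℤˣ) : ℤ) : ℚ) • tpMap (permAut N m σ) x

end GrassPoly

end

namespace GrassPoly

noncomputable section W4

/-- The field of rational functions in the entries of 8 generic vectors in 4-space. -/
abbrev K4 : Type := FF 8 4

/-- The vector label `k ∈ {1, …, 8}` as an index. -/
def L8 (k : ℕ) : Fin 8 := ⟨(k - 1) % 8, Nat.mod_lt _ (by norm_num)⟩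

/-- `⟨abcd⟩` for vector labels in `{1, …, 8}`. -/
def d4 (a b c d : ℕ) : K4 := dets 8 4 ![L8 a, L8 b, L8 c, L8 d]

/-- Vector labels taken mod 6 in `{1, …, 6}`. -/
def M6 (j : ℕ) : ℕ := (j - 1) % 6 + 1

/-- `ρ_i = ρ_{i,i+1,i+2} = ⟨i,i+1,i+2,7⟩ / ⟨i,i+1,i+2,8⟩`, indices mod 6. -/
def rho (i : ℕ) : K4 :=
  d4 (M6 i) (M6 (i + 1)) (M6 (i + 2)) 7 / d4 (M6 i) (M6 (i + 1)) (M6 (i + 2)) 8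

/-- `ρ_{i,j} = ρ_i - ρ_j`. -/
def rr (i j : ℕ) : K4 := rho i - rho j

/-- The projected cross-ratio `CR(ab|cdef) = ⟨abce⟩⟨abdf⟩ / (⟨abcf⟩⟨abde⟩)`. -/
def CR (a b c d e f : ℕ) : K4 :=
  (d4 a b c e * d4 a b d f) / (d4 a b c f * d4 a b d e)

/-- The symbol `S(Gr₄) = 2·(4!)²·Alt₈ [⟨1234⟩ ⊗ ⟨2345⟩ ⊗ ⟨3456⟩ ⊗ ⟨4567⟩]`. -/
def SGr4 : TP K4 4 :=
  ((2 : ℚ) * ((Nat.factorial 4 : ℚ)) ^ 2) •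
    Alt (tprod ℚ ![cls (d4 1 2 3 4), cls (d4 2 3 4 5), cls (d4 3 4 5 6), cls (d4 4 5 6 7)])

/-- An elementary tensor in `V_F^{⊗4}`. -/
def tp4 (a b c d : VF K4) : TP K4 4 := tprod ℚ ![a, b, c, d]

end W4

end GrassPoly

open GrassPoly

namespace GrassPoly

section Classes

variable {F : Type} [Field F]

@[simp] theorem cls_zero : cls (0 : F) = 0 := by simp [cls]

theorem cls_of_ne {a : F} (h : a ≠ 0) :
    cls a = (1 : ℚ) ⊗ₜ[ℤ] (Additive.ofMul (Units.mk0 a h)) := by simp [cls, h]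

@[simp] theorem cls_one : cls (1 : F) = 0 := by
  rw [cls_of_ne one_ne_zero, Units.mk0_one, ofMul_one, TensorProduct.tmul_zero]

theorem cls_mul {a b : F} (ha : a ≠ 0) (hb : b ≠ 0) : cls (a * b) = cls a + cls b := by
  rw [cls_of_ne ha, cls_of_ne hb, cls_of_ne (mul_ne_zero ha hb), ← TensorProduct.tmul_add,
    ← ofMul_mul]
  congr 2
  ext
  rfl

theorem cls_inv (a : F) : cls a⁻¹ = - cls a := by
  by_cases h : a = 0
  · simp [h]
  · have := cls_mul h (inv_ne_zero h)
    rw [mul_inv_cancel₀ h, cls_one] at this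
    exact (neg_eq_of_add_eq_zero_right this.symm).symm

theorem cls_div {a b : F} (ha : a ≠ 0) (hb : b ≠ 0) : cls (a / b) = cls a - cls b := by
  rw [div_eq_mul_inv, cls_mul ha (inv_ne_zero hb), cls_inv, sub_eq_add_neg]

theorem cls_neg_one : cls (-1 : F) = 0 := by
  have h : cls (-1 : F) + cls (-1 : F) = 0 := by
    rw [← cls_mul (by simp) (by simp)]
    simp
  have h2 : (2 : ℚ) • cls (-1 : F) = 0 := by rw [two_smul, h]
  exact (smul_eq_zero.mp h2).resolve_left two_ne_zero

@[simp] theorem cls_neg (a : F) : cls (-a) = cls a := by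
  by_cases h : a = 0
  · simp [h]
  · rw [neg_eq_neg_one_mul, cls_mul (by simp) h, cls_neg_one, zero_add]

theorem cls_sub_comm (a b : F) : cls (a - b) = cls (b - a) := by
  rw [← neg_sub, cls_neg]

theorem tCoef_eq (p a q : F) : tCoef p a q = cls (q - a) - cls (p - a) := by
  unfold tCoef
  split_ifs with h1 h2 h2
  · simp [h1, h2]
  · simp [h1]
  · simp [h2]
  · exact cls_div (sub_ne_zero.mpr (Ne.symm h2)) (sub_ne_zero.mpr h1)

theorem vmap_cls (φ : F ≃+* F) (a : F) : vmap φ (cls a) = cls (φ a) := by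
  by_cases h : a = 0
  · simp [h]
  · rw [cls_of_ne h, cls_of_ne ((map_ne_zero φ).mpr h)]
    simp only [vmap, TensorProduct.AlgebraTensorModule.map_tmul, LinearMap.id_apply]
    congr 1
    simp only [AddMonoidHom.coe_toIntLinearMap, AddMonoidHom.coe_mk, ZeroHom.coe_mk]
    congr 1
    ext
    rfl

end Classes

section Words

variable {F : Type} [Field F]

/-- Elementary tensors of weight four. -/
def T4 (a b c d : VF F) : TP F 4 := tprod ℚ ![a, b, c, d]

theorem snoc_tprod {n : ℕ} (v : Fin n → VF F) (a : VF F) :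
    snoc (tprod ℚ v) a = (tprod ℚ (Fin.snoc v a : Fin (n + 1) → VF F) : TP F (n + 1)) := by
  simp [snoc, MultilinearMap.curryRight_apply]

theorem snoc_nil (v : Fin 0 → VF F) (a : VF F) :
    snoc (tprod ℚ v) a = (tprod ℚ ![a] : TP F 1) := by
  rw [snoc_tprod]; congr 1; ext i; fin_cases i; rfl

theorem snoc_one (a b : VF F) :
    snoc (tprod ℚ ![a] : TP F 1) b = (tprod ℚ ![a, b] : TP F 2) := by
  rw [snoc_tprod]; congr 1; ext i; fin_cases i <;> rfl

theorem snoc_two (a b c : VF F) :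
    snoc (tprod ℚ ![a, b] : TP F 2) c = (tprod ℚ ![a, b, c] : TP F 3) := by
  rw [snoc_tprod]; congr 1; ext i; fin_cases i <;> rfl

theorem snoc_three (a b c d : VF F) :
    snoc (tprod ℚ ![a, b, c] : TP F 3) d = T4 a b c d := by
  rw [T4, snoc_tprod]; congr 1; ext i; fin_cases i <;> rfl

/-- The fourfold tensor product as an iterated linear map. -/
def T4L : VF F →ₗ[ℚ] VF F →ₗ[ℚ] VF F →ₗ[ℚ] VF F →ₗ[ℚ] TP F 4 :=
  LinearMap.mk₂ ℚ (fun a b => snoc (n := 3) ∘ₗ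
    snoc (n := 2) (snoc (n := 1) (snoc (n := 0) (tprod ℚ ![]) a) b))
    (by intros; simp [LinearMap.comp_add]) (by intros; simp [LinearMap.comp_smul])
    (by intros; simp [LinearMap.comp_add]) (by intros; simp [LinearMap.comp_smul])

theorem T4L_apply (a b c d : VF F) : T4L a b c d = T4 a b c d := by
  refine (congrArg (fun t : TP F 1 => snoc (n := 3) (snoc (n := 2) (snoc (n := 1) t b) c) d)
    (snoc_nil _ a)).trans ?_
  rw [snoc_one, snoc_two, snoc_three]

theorem T4L_add (a a' b c d : VF F) : T4L (a + a') b c d = T4L a b c d + T4L a' b c d := by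
  rw [LinearMap.map_add]
  rfl

theorem T4L_sub (a a' b c d : VF F) : T4L (a - a') b c d = T4L a b c d - T4L a' b c d := by
  rw [eq_sub_iff_add_eq, ← T4L_add, sub_add_cancel]

theorem T4L_neg (a b c d : VF F) : T4L (-a) b c d = - T4L a b c d := by
  rw [eq_neg_iff_add_eq_zero, ← T4L_add, neg_add_cancel, LinearMap.map_zero]
  rfl

end Words

end GrassPoly

namespace GrassPoly

section Symbols

variable {F : Type} [Field F]

theorem SIaux_one (p a q : F) (h : [a].length = 1) :
    SIaux 1 p [a] q h = tprod ℚ ![cls (q - a) - cls (p - a)] := by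
  simp only [SIaux, tCoef_eq]
  exact snoc_nil _ _

theorem SIaux_two (p a b q : F) (h : [a, b].length = 2) :
    SIaux 2 p [a, b] q h =
      snoc (SIaux 1 p [b] q rfl) (cls (b - a) - cls (p - a))
        + snoc (SIaux 1 p [a] q rfl) (cls (q - b) - cls (a - b)) := by
  rw [SIaux, Fin.sum_univ_two]
  simp only [tCoef_eq]
  rfl

theorem SIaux_three (p a b c q : F) (h : [a, b, c].length = 3) :
    SIaux 3 p [a, b, c] q h =
      snoc (SIaux 2 p [b, c] q rfl) (cls (b - a) - cls (p - a))
        + snoc (SIaux 2 p [a, c] q rfl) (cls (c - b) - cls (a - b))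
        + snoc (SIaux 2 p [a, b] q rfl) (cls (q - c) - cls (b - c)) := by
  rw [SIaux, Fin.sum_univ_three]
  simp only [tCoef_eq]
  rfl

theorem SIaux_four (p a b c d q : F) (h : [a, b, c, d].length = 4) :
    SIaux 4 p [a, b, c, d] q h =
      snoc (SIaux 3 p [b, c, d] q rfl) (cls (b - a) - cls (p - a))
        + snoc (SIaux 3 p [a, c, d] q rfl) (cls (c - b) - cls (a - b))
        + snoc (SIaux 3 p [a, b, d] q rfl) (cls (d - c) - cls (b - c))
        + snoc (SIaux 3 p [a, b, c] q rfl) (cls (q - d) - cls (c - d)) := by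
  rw [SIaux, Fin.sum_univ_four]
  simp only [tCoef_eq]
  rfl

/-- The symbol of `I_{3,1}(x, y)` in terms of the classes `x`, `X`, `y`, `Y`, `D` of
`x`, `1 - x`, `y`, `1 - y` and `x - y`. -/
def word31 (x X y Y D : VF F) : TP F 4 :=
  T4L (X - x) (Y + x - D) (x - y) (x - y) - T4L (Y - y) (x - D) (x - y) (x - y)
    + T4L (X - x) x Y (x - y) + T4L (X - x) x x Y - T4L (X - x) x x x

theorem SI31_eq (x y : F) :
    SI31 x y = word31 (cls x) (cls (1 - x)) (cls y) (cls (1 - y)) (cls (x - y)) := by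
  rw [SI31, word31]
  simp only [SIaux_four, SIaux_three, SIaux_two, SIaux_one, map_add, LinearMap.add_apply,
    snoc_one, snoc_two, snoc_three, ← T4L_apply, sub_self, sub_zero, zero_sub, cls_zero, cls_one,
    cls_neg, map_zero, LinearMap.zero_apply, add_zero, zero_add, cls_sub_comm y x]
  simp only [T4L_sub, map_sub, LinearMap.sub_apply, map_neg, LinearMap.neg_apply, map_add,
    LinearMap.add_apply]
  abel

theorem SLi4_eq (x : F) : SLi4 x = - T4L (cls (1 - x)) (cls x) (cls x) (cls x) := by
  by_cases hx : x = 0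
  · subst hx
    rw [SLi4]
    simp only [SIaux_four, SIaux_three, SIaux_two, SIaux_one, sub_self, sub_zero, cls_zero, cls_one,
      map_zero, add_zero, inv_zero, neg_zero]
  · have h : cls (1 - x⁻¹) = cls (1 - x) - cls x := by
      by_cases h1 : x = 1
      · simp [h1]
      · rw [← cls_div (sub_ne_zero.mpr (Ne.symm h1)) hx, ← cls_neg]
        congr 1
        field_simp
        ring
    rw [SLi4]
    simp only [SIaux_four, SIaux_three, SIaux_two, SIaux_one, snoc_one, snoc_two, snoc_three,
      ← T4L_apply, sub_self, sub_zero, zero_sub, cls_zero, cls_one, cls_neg, map_zero, add_zero,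
      zero_add, h, cls_inv]
    simp only [T4L_sub, T4L_neg, map_neg, LinearMap.neg_apply]
    abel

theorem rotN_tprod {n : ℕ} (v : Fin n → VF F) :
    rotN n (tprod ℚ v) = (tprod ℚ (fun i => v (finRotate n i)) : TP F n) := by
  simp [rotN, PiTensorProduct.reindex_tprod]

theorem splitLast_tprod {n : ℕ} (v : Fin (n + 1) → VF F) :
    splitLast n (tprod ℚ v) = tprod ℚ (fun i => v i.castSucc) ⊗ₜ[ℚ] v (Fin.last n) := by
  simp only [splitLast, LinearEquiv.trans_apply, PiTensorProduct.reindex_tprod,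
    PiTensorProduct.tmulEquiv_symm_apply, TensorProduct.congr_tmul, LinearEquiv.refl_apply,
    PiTensorProduct.subsingletonEquiv_apply_tprod]
  rfl

theorem splitLast_symm_tprod {n : ℕ} (v : Fin n → VF F) (a : VF F) :
    (splitLast n).symm (tprod ℚ v ⊗ₜ[ℚ] a) =
      (tprod ℚ (Fin.snoc v a : Fin (n + 1) → VF F) : TP F (n + 1)) := by
  rw [LinearEquiv.symm_apply_eq, splitLast_tprod]
  simp

theorem Pit_tprod {n : ℕ} (v : Fin (n + 2) → VF F) :
    Pit (n + 2) (tprod ℚ v) =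
      (splitLast (n + 1)).symm
          (Pit (n + 1) (tprod ℚ (fun i => v i.castSucc)) ⊗ₜ[ℚ] v (Fin.last _))
        - (splitLast (n + 1)).symm
          (Pit (n + 1) (tprod ℚ (fun i => v i.succ)) ⊗ₜ[ℚ] v 0) := by
  rw [Pit]
  simp only [LinearMap.comp_apply, LinearMap.sub_apply, LinearMap.id_apply, map_sub,
    LinearEquiv.coe_coe, rotN_tprod, splitLast_tprod, TensorProduct.map_tmul, finRotate_apply,
    Fin.coeSucc_eq_succ, Fin.last_add_one]

theorem Pit_two (a b : VF F) :
    Pit 2 (tprod ℚ ![a, b]) = (tprod ℚ ![a, b] - tprod ℚ ![b, a] : TP F 2) := by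
  rw [Pit_tprod]
  simp only [Pit, LinearMap.id_apply, splitLast_symm_tprod]
  congr 2 <;> (ext i; fin_cases i <;> rfl)

theorem Pit_three (a b c : VF F) :
    Pit 3 (tprod ℚ ![a, b, c]) =
      (tprod ℚ ![a, b, c] - tprod ℚ ![b, a, c]
        - (tprod ℚ ![b, c, a] - tprod ℚ ![c, b, a]) : TP F 3) := by
  have h1 : (fun i : Fin 2 => (![a, b, c] : Fin 3 → VF F) i.castSucc) = ![a, b] := by
    ext i; fin_cases i <;> rfl
  have h2 : (fun i : Fin 2 => (![a, b, c] : Fin 3 → VF F) i.succ) = ![b, c] := by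
    ext i; fin_cases i <;> rfl
  rw [Pit_tprod, h1, h2, Pit_two, Pit_two]
  simp only [TensorProduct.sub_tmul, map_sub, splitLast_symm_tprod]
  congr 3 <;> (ext i; fin_cases i <;> rfl)

theorem Pit_T4 (a b c d : VF F) :
    Pit 4 (T4 a b c d) =
      T4 a b c d - T4 b a c d - (T4 b c a d - T4 c b a d)
        - (T4 b c d a - T4 c b d a - (T4 c d b a - T4 d c b a)) := by
  have h1 : (fun i : Fin 3 => (![a, b, c, d] : Fin 4 → VF F) i.castSucc) = ![a, b, c] := by
    ext i; fin_cases i <;> rfl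
  have h2 : (fun i : Fin 3 => (![a, b, c, d] : Fin 4 → VF F) i.succ) = ![b, c, d] := by
    ext i; fin_cases i <;> rfl
  simp only [T4]
  rw [Pit_tprod, h1, h2, Pit_three, Pit_three]
  simp only [TensorProduct.sub_tmul, map_sub, splitLast_symm_tprod]
  congr 4 <;> (ext i; fin_cases i <;> rfl)

theorem Pit_T4L (a b c d : VF F) :
    Pit 4 (T4L a b c d) =
      T4L a b c d - T4L b a c d - T4L b c a d + T4L c b a d
        - T4L b c d a + T4L c b d a + T4L c d b a - T4L d c b a := by
  simp only [T4L_apply, Pit_T4]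
  abel

theorem Pit_word31_add_swap (x X y Y D : VF F) :
    Pit 4 (word31 x X y Y D + word31 y Y x X D) = 0 := by
  simp only [word31, T4L_sub, map_sub, map_add, LinearMap.sub_apply, LinearMap.add_apply]
  simp only [Pit_T4L]
  abel

theorem Pit_SI31_comm (x y : F) : Pit 4 (SI31 y x) = - Pit 4 (SI31 x y) := by
  rw [eq_neg_iff_add_eq_zero, ← map_add, SI31_eq, SI31_eq, cls_sub_comm x y]
  exact Pit_word31_add_swap _ _ _ _ _

end Symbols

end GrassPoly

namespace GrassPoly

section Functoriality

variable {F : Type} [Field F]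

theorem tp4_hom_ext {M : Type} [AddCommMonoid M] [Module ℚ M] {f g : TP F 4 →ₗ[ℚ] M}
    (h : ∀ a b c d, f (T4L a b c d) = g (T4L a b c d)) : f = g := by
  refine PiTensorProduct.ext (MultilinearMap.ext fun v => ?_)
  have hv : v = ![v 0, v 1, v 2, v 3] := by ext i; fin_cases i <;> rfl
  have := h (v 0) (v 1) (v 2) (v 3)
  rw [T4L_apply, T4, ← hv] at this
  exact this

theorem tpMap_T4L (φ : F ≃+* F) (a b c d : VF F) :
    tpMap φ (T4L a b c d) = T4L (vmap φ a) (vmap φ b) (vmap φ c) (vmap φ d) := by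
  rw [T4L_apply, T4L_apply, T4, T4, tpMap, PiTensorProduct.map_tprod]
  congr 1
  ext i
  fin_cases i <;> rfl

theorem Pit_tpMap (φ : F ≃+* F) (v : TP F 4) : Pit 4 (tpMap φ v) = tpMap φ (Pit 4 v) := by
  have : Pit 4 ∘ₗ tpMap φ = (tpMap φ : TP F 4 →ₗ[ℚ] TP F 4) ∘ₗ Pit 4 :=
    tp4_hom_ext fun a b c d => by
    simp only [LinearMap.comp_apply, tpMap_T4L, Pit_T4L, map_sub, map_add]
  exact LinearMap.congr_fun this v

theorem tpMap_SI31 (φ : F ≃+* F) (x y : F) : tpMap φ (SI31 x y) = SI31 (φ x) (φ y) := by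
  simp only [SI31_eq, word31, (tpMap φ : TP F 4 →ₗ[ℚ] TP F 4).map_sub,
    (tpMap φ : TP F 4 →ₗ[ℚ] TP F 4).map_add, tpMap_T4L, (vmap φ).map_sub, (vmap φ).map_add,
    vmap_cls, map_sub φ, map_one φ]

/-- Signed sums over the anharmonic orbit. -/
def anhSum {M : Type} [AddCommGroup M] [Module ℚ M] (f : F → M) (x : F) : M :=
  f x + f (1 - x)⁻¹ + f (1 - x⁻¹) - f x⁻¹ - f (1 - x) - f (x / (x - 1))

theorem anhList_sum {M : Type} [AddCommGroup M] [Module ℚ M] (f : F → M) (x : F) :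
    ((anhList x).map fun p => p.1 • f p.2).sum = anhSum f x := by
  simp only [anhList, List.map_cons, List.map_nil, List.sum_cons, List.sum_nil, anhSum, one_smul,
    neg_smul]
  abel

theorem anhSum_one_sub {M : Type} [AddCommGroup M] [Module ℚ M] (f : F → M) {x : F}
    (h0 : x ≠ 0) (h1 : 1 - x ≠ 0) : anhSum f (1 - x) = - anhSum f x := by
  have h2 : x - 1 ≠ 0 := by rw [← neg_sub]; exact neg_ne_zero.mpr h1
  have e1 : (1 - (1 - x)) = x := by ring
  have e2 : 1 - (1 - x)⁻¹ = x / (x - 1) := by field_simp; ring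
  have e3 : (1 - x) / (1 - x - 1) = 1 - x⁻¹ := by
    rw [show 1 - x - 1 = -x by ring]; field_simp; ring
  simp only [anhSum, e1, e2, e3]
  abel

theorem anhSum_inv {M : Type} [AddCommGroup M] [Module ℚ M] (f : F → M) {x : F}
    (h0 : x ≠ 0) (h1 : 1 - x ≠ 0) : anhSum f x⁻¹ = - anhSum f x := by
  have h2 : x - 1 ≠ 0 := by rw [← neg_sub]; exact neg_ne_zero.mpr h1
  have e2 : (1 - x⁻¹)⁻¹ = x / (x - 1) := by field_simp
  have e3 : x⁻¹ / (x⁻¹ - 1) = (1 - x)⁻¹ := by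
    rw [show x⁻¹ - 1 = (1 - x) / x by field_simp]; field_simp
  simp only [anhSum, inv_inv, e2, e3]
  abel

theorem tI31_eq (x y : F) :
    tI31 x y = (36 : ℚ)⁻¹ • anhSum (fun s => anhSum (fun t => SI31 s t) y) x := by
  rw [tI31, ← anhList_sum]
  simp only [← anhList_sum, List.smul_sum, List.map_map, Function.comp_def, mul_smul]

theorem map_anhSum {M N : Type} [AddCommGroup M] [Module ℚ M] [AddCommGroup N] [Module ℚ N]
    (g : M →ₗ[ℚ] N) (f : F → M) (x : F) : g (anhSum f x) = anhSum (fun s => g (f s)) x := by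
  simp only [anhSum, map_sub, map_add]

theorem anhSum_comm {M : Type} [AddCommGroup M] [Module ℚ M] (f : F → F → M) (x y : F) :
    anhSum (fun s => anhSum (fun t => f s t) y) x
      = anhSum (fun t => anhSum (fun s => f s t) x) y := by
  simp only [anhSum]
  abel

theorem neg_anhSum {M : Type} [AddCommGroup M] [Module ℚ M] (f : F → M) (x : F) :
    anhSum (fun s => - f s) x = - anhSum f x := by
  simp only [anhSum]
  abel

theorem tI31_one_sub_left {x y : F} (h0 : x ≠ 0) (h1 : 1 - x ≠ 0) :
    tI31 (1 - x) y = - tI31 x y := by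
  rw [tI31_eq, tI31_eq, anhSum_one_sub _ h0 h1, smul_neg]

theorem tI31_inv_left {x y : F} (h0 : x ≠ 0) (h1 : 1 - x ≠ 0) :
    tI31 x⁻¹ y = - tI31 x y := by
  rw [tI31_eq, tI31_eq, anhSum_inv _ h0 h1, smul_neg]

theorem Pit_tI31_comm (x y : F) : Pit 4 (tI31 y x) = - Pit 4 (tI31 x y) := by
  simp only [tI31_eq, map_smul, map_anhSum]
  rw [anhSum_comm, ← smul_neg, ← neg_anhSum]
  simp only [← neg_anhSum, ← Pit_SI31_comm]

theorem anhSum_map (φ : F ≃+* F) {M : Type} [AddCommGroup M] [Module ℚ M] (f : F → M) (x : F) :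
    anhSum (fun s => f (φ s)) x = anhSum f (φ x) := by
  simp only [anhSum, map_sub, map_one, map_inv₀, map_div₀]

theorem tpMap_tI31 (φ : F ≃+* F) (x y : F) : tpMap φ (tI31 x y) = tI31 (φ x) (φ y) := by
  simp only [tI31_eq, map_smul, map_anhSum, tpMap_SI31]
  rw [← anhSum_map φ (fun s => anhSum (fun t => SI31 s t) (φ y)) x]
  simp only [← anhSum_map φ (fun t => SI31 (φ _) t) y]

end Functoriality

section Alternation

variable {N m : ℕ}

theorem permAut_gen (σ : Equiv.Perm (Fin N)) (i : Fin N) (j : Fin m) :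
    permAut N m σ (gen N m i j) = gen N m (σ i) j := by
  simp [permAut, gen]

theorem permAut_mul (σ τ : Equiv.Perm (Fin N)) (a : FF N m) :
    permAut N m (σ * τ) a = permAut N m σ (permAut N m τ a) := by
  have : (permAut N m (σ * τ) : FF N m →+* FF N m)
      = (permAut N m σ : FF N m →+* FF N m).comp (permAut N m τ : FF N m →+* FF N m) := by
    apply IsLocalization.ringHom_ext (nonZeroDivisors (Pol N m))
    apply MvPolynomial.ringHom_ext
    · intro r
      simp [permAut]
    · rintro ⟨i, j⟩
      simpa [gen] using (permAut_gen (σ * τ) i j).trans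
        (by rw [permAut_gen, permAut_gen, Equiv.Perm.mul_apply] :
          _ = permAut N m σ (permAut N m τ (gen N m i j)))
  exact RingHom.congr_fun this a

theorem VF_hom_ext {F : Type} [Field F] {M : Type} [AddCommGroup M] [Module ℚ M]
    {f g : VF F →ₗ[ℚ] M} (h : ∀ a : F, f (cls a) = g (cls a)) : f = g := by
  apply TensorProduct.AlgebraTensorModule.ext
  intro r u
  have hu : r ⊗ₜ[ℤ] u = r • cls ((Additive.toMul u : Fˣ) : F) := by
    rw [cls_of_ne (Units.ne_zero _), TensorProduct.smul_tmul', smul_eq_mul, mul_one,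
      Units.mk0_val]
    rfl
  rw [hu, map_smul, map_smul, h]

theorem vmap_permAut_mul (σ τ : Equiv.Perm (Fin N)) (v : VF (FF N m)) :
    vmap (permAut N m (σ * τ)) v = vmap (permAut N m σ) (vmap (permAut N m τ) v) := by
  have : vmap (permAut N m (σ * τ)) = vmap (permAut N m σ) ∘ₗ vmap (permAut N m τ) :=
    VF_hom_ext fun a => by
      rw [LinearMap.comp_apply, vmap_cls, vmap_cls, vmap_cls, permAut_mul]
  exact LinearMap.congr_fun this v

theorem tpMap_permAut_mul (σ τ : Equiv.Perm (Fin N)) (v : TP (FF N m) 4) :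
    tpMap (permAut N m (σ * τ)) v = tpMap (permAut N m σ) (tpMap (permAut N m τ) v) := by
  have : (tpMap (permAut N m (σ * τ)) : TP (FF N m) 4 →ₗ[ℚ] _)
      = tpMap (permAut N m σ) ∘ₗ tpMap (permAut N m τ) := tp4_hom_ext fun a b c d => by
    simp only [LinearMap.comp_apply, tpMap_T4L, vmap_permAut_mul]
  exact LinearMap.congr_fun this v

variable (N m) in
/-- Skew-symmetrization as a linear map. -/
noncomputable def AltL : TP (FF N m) 4 →ₗ[ℚ] TP (FF N m) 4 :=
  ∑ σ : Equiv.Perm (Fin N), (((Equiv.Perm.sign σ : ℤˣ) : ℤ) : ℚ) • tpMap (permAut N m σ)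

theorem AltL_apply (v : TP (FF N m) 4) : AltL N m v = Alt v := by
  simp [AltL, Alt]

theorem AltL_tpMap (τ : Equiv.Perm (Fin N)) (v : TP (FF N m) 4) :
    AltL N m (tpMap (permAut N m τ) v) =
      (((Equiv.Perm.sign τ : ℤˣ) : ℤ) : ℚ) • AltL N m v := by
  rw [AltL_apply, AltL_apply, Alt, Alt, Finset.smul_sum,
    ← Equiv.sum_comp (Equiv.mulRight τ)
      (fun σ => (((Equiv.Perm.sign τ : ℤˣ) : ℤ) : ℚ) •
        (((Equiv.Perm.sign σ : ℤˣ) : ℤ) : ℚ) • tpMap (permAut N m σ) v)]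
  refine Finset.sum_congr rfl fun σ _ => ?_
  rw [Equiv.coe_mulRight, tpMap_permAut_mul, smul_smul]
  congr 1
  rcases Int.units_eq_one_or (Equiv.Perm.sign τ) with h | h <;> simp [h]

variable (N m) in
/-- The skew-symmetrized mod-products projection in weight four. -/
noncomputable def AP : TP (FF N m) 4 →ₗ[ℚ] TP (FF N m) 4 := AltL N m ∘ₗ Pit 4

theorem AP_apply (v : TP (FF N m) 4) : AP N m v = Alt (Pit 4 v) := by
  rw [AP, LinearMap.comp_apply, AltL_apply]

theorem AP_tpMap (τ : Equiv.Perm (Fin N)) (v : TP (FF N m) 4) :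
    AP N m (tpMap (permAut N m τ) v) =
      (((Equiv.Perm.sign τ : ℤˣ) : ℤ) : ℚ) • AP N m v := by
  rw [AP, LinearMap.comp_apply, Pit_tpMap, AltL_tpMap, LinearMap.comp_apply]

theorem Pit_Alt (v : TP (FF N m) 4) : Pit 4 (Alt v) = AP N m v := by
  simp only [AP_apply, Alt, map_sum, map_smul, Pit_tpMap]

/-- The skew-symmetrized symbol of `Ĩ_{3,1}` modulo products. -/
noncomputable def AG (x y : FF N m) : TP (FF N m) 4 := AP N m (tI31 x y)

theorem AG_comm (x y : FF N m) : AG y x = - AG x y := by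
  rw [AG, AG, AP_apply, Pit_tI31_comm, ← AltL_apply, map_neg, AltL_apply, ← AP_apply]

theorem AG_perm (σ : Equiv.Perm (Fin N)) (x y : FF N m) :
    AG (permAut N m σ x) (permAut N m σ y) =
      (((Equiv.Perm.sign σ : ℤˣ) : ℤ) : ℚ) • AG x y := by
  rw [AG, ← tpMap_tI31, AP_tpMap, AG]

/-- `Anh ε x y` states that `y` is in the anharmonic orbit of `x`, by a permutation of
sign `ε`. -/
inductive Anh {F : Type} [Field F] : ℚ → F → F → Prop
  | refl (x : F) : Anh 1 x x
  | one_sub {ε : ℚ} {x y : F} (h : Anh ε x y) (h0 : y ≠ 0) (h1 : 1 - y ≠ 0) : Anh (-ε) x (1 - y)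
  | inv {ε : ℚ} {x y : F} (h : Anh ε x y) (h0 : y ≠ 0) (h1 : 1 - y ≠ 0) : Anh (-ε) x y⁻¹

theorem AG_left {ε : ℚ} {x x' : FF N m} (h : Anh ε x x') (y : FF N m) :
    AG x' y = ε • AG x y := by
  induction h with
  | refl => simp
  | one_sub h h0 h1 ih => rw [AG, tI31_one_sub_left h0 h1, map_neg, ← AG, ih, neg_smul]
  | inv h h0 h1 ih => rw [AG, tI31_inv_left h0 h1, map_neg, ← AG, ih, neg_smul]

theorem AG_right {ε : ℚ} {y y' : FF N m} (h : Anh ε y y') (x : FF N m) :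
    AG x y' = ε • AG x y := by
  rw [AG_comm, AG_left h, AG_comm y x, smul_neg]

end Alternation

end GrassPoly

namespace GrassPoly

section Brackets

/-- The determinant of a `4 × 4` matrix given by its columns. -/
def det4 {R : Type} [CommRing R] (u v w x : Fin 4 → R) : R :=
  (Matrix.of fun r c => (![u, v, w, x] : Fin 4 → Fin 4 → R) c r).det

theorem det4_eq {R : Type} [CommRing R] (u v w x : Fin 4 → R) : det4 u v w x =
    u 0 * (v 1 * (w 2 * x 3 - w 3 * x 2) - v 2 * (w 1 * x 3 - w 3 * x 1)
      + v 3 * (w 1 * x 2 - w 2 * x 1))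
    - u 1 * (v 0 * (w 2 * x 3 - w 3 * x 2) - v 2 * (w 0 * x 3 - w 3 * x 0)
      + v 3 * (w 0 * x 2 - w 2 * x 0))
    + u 2 * (v 0 * (w 1 * x 3 - w 3 * x 1) - v 1 * (w 0 * x 3 - w 3 * x 0)
      + v 3 * (w 0 * x 1 - w 1 * x 0))
    - u 3 * (v 0 * (w 1 * x 2 - w 2 * x 1) - v 1 * (w 0 * x 2 - w 2 * x 0)
      + v 2 * (w 0 * x 1 - w 1 * x 0)) := by
  rw [det4, Matrix.det_succ_row_zero]
  simp [Fin.sum_univ_succ, Matrix.det_fin_three, Fin.succAbove]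
  ring

theorem det4_pluecker {R : Type} [CommRing R] (a b c d e f : Fin 4 → R) :
    det4 a b c d * det4 a b e f - det4 a b c e * det4 a b d f
      + det4 a b c f * det4 a b d e = 0 := by
  simp only [det4_eq]
  ring

theorem d4_eq (a b c d : ℕ) :
    d4 a b c d = det4 (gen 8 4 (L8 a)) (gen 8 4 (L8 b)) (gen 8 4 (L8 c)) (gen 8 4 (L8 d)) := by
  rw [d4, dets, det4]
  congr 2
  ext r c
  fin_cases c <;> rfl

theorem d4_pluecker (a b c d e f : ℕ) :
    d4 a b c d * d4 a b e f - d4 a b c e * d4 a b d f + d4 a b c f * d4 a b d e = 0 := by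
  simp only [d4_eq]
  exact det4_pluecker _ _ _ _ _ _

theorem d4_swap12 (a b c d : ℕ) : d4 b a c d = - d4 a b c d := by
  simp only [d4_eq, det4_eq]; ring

theorem d4_swap23 (a b c d : ℕ) : d4 a c b d = - d4 a b c d := by
  simp only [d4_eq, det4_eq]; ring

theorem d4_swap34 (a b c d : ℕ) : d4 a b d c = - d4 a b c d := by
  simp only [d4_eq, det4_eq]; ring

theorem d4_sort12 {a b : ℕ} (_ : a < b) (c d : ℕ) : d4 b a c d = - d4 a b c d :=
  d4_swap12 a b c d

theorem d4_sort23 {b c : ℕ} (_ : b < c) (a d : ℕ) : d4 a c b d = - d4 a b c d :=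
  d4_swap23 a b c d

theorem d4_sort34 {c d : ℕ} (_ : c < d) (a b : ℕ) : d4 a b d c = - d4 a b c d :=
  d4_swap34 a b c d

/-- The action of a permutation on vector labels. -/
def lab (σ : Equiv.Perm (Fin 8)) (k : ℕ) : ℕ := (σ (L8 k)).val + 1

theorem L8_lab (σ : Equiv.Perm (Fin 8)) (k : ℕ) : L8 (lab σ k) = σ (L8 k) := by
  ext
  simp only [L8, lab, Nat.add_sub_cancel]
  exact Nat.mod_eq_of_lt (σ _).isLt

theorem permAut_d4 (σ : Equiv.Perm (Fin 8)) (a b c d : ℕ) :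
    permAut 8 4 σ (d4 a b c d) = d4 (lab σ a) (lab σ b) (lab σ c) (lab σ d) := by
  simp only [d4_eq, det4_eq, L8_lab, map_add, map_sub, map_mul, permAut_gen]

/-- Three lines through a common point `h`: the incidence bracket of the projected lines
`ab`, `cd`, `ef`. -/
noncomputable def Q4 (h a b c d e f : ℕ) : K4 := d4 h a b e * d4 h c d f - d4 h a b f * d4 h c d e

/-- The incidence bracket of the planes `abc`, `def` and the line `gh`. -/
noncomputable def A4 (a b c d e f g h : ℕ) : K4 := d4 a b c g * d4 d e f h - d4 a b c h * d4 d e f g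

theorem permAut_Q4 (σ : Equiv.Perm (Fin 8)) (h a b c d e f : ℕ) :
    permAut 8 4 σ (Q4 h a b c d e f) = Q4 (lab σ h) (lab σ a) (lab σ b) (lab σ c) (lab σ d)
      (lab σ e) (lab σ f) := by
  simp only [Q4, map_sub, map_mul, permAut_d4]

theorem permAut_A4 (σ : Equiv.Perm (Fin 8)) (a b c d e f g h : ℕ) :
    permAut 8 4 σ (A4 a b c d e f g h) = A4 (lab σ a) (lab σ b) (lab σ c) (lab σ d)
      (lab σ e) (lab σ f) (lab σ g) (lab σ h) := by
  simp only [A4, map_sub, map_mul, permAut_d4]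

theorem Q4_block12 (h a b c d e f : ℕ) : Q4 h c d a b e f = - Q4 h a b c d e f := by
  simp only [Q4]; ring

theorem Q4_block23 (h a b c d e f : ℕ) : Q4 h a b e f c d = - Q4 h a b c d e f := by
  simp only [Q4, d4_eq, det4_eq]
  ring

/-- Brackets as polynomials. -/
noncomputable def d4P (a b c d : ℕ) : Pol 8 4 :=
  det4 (fun j => MvPolynomial.X (L8 a, j)) (fun j => MvPolynomial.X (L8 b, j))
    (fun j => MvPolynomial.X (L8 c, j)) (fun j => MvPolynomial.X (L8 d, j))

theorem d4_eq_algebraMap (a b c d : ℕ) : d4 a b c d = algebraMap (Pol 8 4) K4 (d4P a b c d) := by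
  simp only [d4_eq, det4_eq, d4P, map_add, map_sub, map_mul, gen]

/-- Evaluation of a bracket at points of the twisted cubic. -/
def d4N (a b c d : ℕ) : ℚ :=
  ((b : ℚ) - a) * (c - a) * (d - a) * (c - b) * (d - b) * (d - c)

/-- Evaluation at eight points of the twisted cubic. -/
noncomputable def evalCubic : Pol 8 4 →+* ℚ :=
  MvPolynomial.eval fun p => ((p.1.val : ℚ) + 1) ^ p.2.val

theorem evalCubic_d4P {a b c d : ℕ} (ha : a - 1 < 8 ∧ 0 < a) (hb : b - 1 < 8 ∧ 0 < b)
    (hc : c - 1 < 8 ∧ 0 < c) (hd : d - 1 < 8 ∧ 0 < d) :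
    evalCubic (d4P a b c d) = d4N a b c d := by
  have key : ∀ k : ℕ, k - 1 < 8 ∧ 0 < k → (((L8 k).val : ℚ) + 1) = k := fun k hk => by
    have h : (L8 k).val + 1 = k := by
      simp only [L8, Nat.mod_eq_of_lt hk.1]
      omega
    exact_mod_cast h
  simp only [d4P, det4_eq, evalCubic, map_add, map_sub, map_mul, MvPolynomial.eval_X, key a ha,
    key b hb, key c hc, key d hd, d4N]
  norm_num
  ring

theorem ne_zero_of_evalCubic {p : Pol 8 4} (h : evalCubic p ≠ 0) :
    algebraMap (Pol 8 4) K4 p ≠ 0 := by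
  intro h0
  rw [map_eq_zero_iff _ (IsFractionRing.injective (Pol 8 4) K4)] at h0
  exact h (by rw [h0, map_zero])

theorem d4_ne_zero {a b c d : ℕ} (h : (0 < a ∧ a < b ∧ b < c ∧ c < d ∧ d < 9)) :
    d4 a b c d ≠ 0 := by
  obtain ⟨h0, hab, hbc, hcd, hd⟩ := h
  rw [d4_eq_algebraMap]
  apply ne_zero_of_evalCubic
  rw [evalCubic_d4P (by omega) (by omega) (by omega) (by omega), d4N]
  have e : ∀ {i j : ℕ}, i < j → (j : ℚ) - i ≠ 0 := fun h =>
    sub_ne_zero.mpr (by exact_mod_cast h.ne')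
  exact mul_ne_zero (mul_ne_zero (mul_ne_zero (mul_ne_zero (mul_ne_zero (e hab)
    (e (hab.trans hbc))) (e (hab.trans (hbc.trans hcd)))) (e hbc)) (e (hbc.trans hcd))) (e hcd)

theorem Q4_423_ne_zero : Q4 4 2 3 5 6 7 8 ≠ 0 := by
  rw [Q4]
  simp only [d4_eq_algebraMap, ← map_mul, ← map_sub]
  apply ne_zero_of_evalCubic
  simp only [map_sub, map_mul]
  repeat rw [evalCubic_d4P (by decide) (by decide) (by decide) (by decide)]
  norm_num [d4N]

theorem Q4_312_ne_zero : Q4 3 1 2 4 5 7 8 ≠ 0 := by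
  rw [Q4]
  simp only [d4_eq_algebraMap, ← map_mul, ← map_sub]
  apply ne_zero_of_evalCubic
  simp only [map_sub, map_mul]
  repeat rw [evalCubic_d4P (by decide) (by decide) (by decide) (by decide)]
  norm_num [d4N]

theorem A4_ne_zero : A4 1 2 3 4 5 6 7 8 ≠ 0 := by
  rw [A4]
  simp only [d4_eq_algebraMap, ← map_mul, ← map_sub]
  apply ne_zero_of_evalCubic
  simp only [map_sub, map_mul]
  repeat rw [evalCubic_d4P (by decide) (by decide) (by decide) (by decide)]
  norm_num [d4N]

end Brackets

end GrassPoly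

namespace GrassPoly

section Triples

variable {F : Type} [Field F]

/-- The presentation `x = p / r`, `1 - x = q / r` of a point of `ℙ¹ ∖ {0, 1, ∞}`. -/
structure Tri (x p q r : F) : Prop where
  p_ne : p ≠ 0
  q_ne : q ≠ 0
  r_ne : r ≠ 0
  val : x * r = p
  sum : p + q = r

namespace Tri

variable {x y p q r p' q' r' : F}

theorem compl (h : Tri x p q r) : (1 - x) * r = q := by
  linear_combination -h.val - h.sum

theorem ne_zero (h : Tri x p q r) : x ≠ 0 := fun h0 => h.p_ne (by rw [← h.val, h0, zero_mul])

theorem one_sub_ne_zero (h : Tri x p q r) : 1 - x ≠ 0 := fun h0 =>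
  h.q_ne (by rw [← h.compl, h0, zero_mul])

theorem eq_div (h : Tri x p q r) : x = p / r := (eq_div_iff h.r_ne).2 h.val

theorem one_sub_eq_div (h : Tri x p q r) : 1 - x = q / r := (eq_div_iff h.r_ne).2 h.compl

theorem map (φ : F ≃+* F) (h : Tri x p q r) : Tri (φ x) (φ p) (φ q) (φ r) where
  p_ne := by simpa using h.p_ne
  q_ne := by simpa using h.q_ne
  r_ne := by simpa using h.r_ne
  val := by rw [← map_mul, h.val]
  sum := by rw [← map_add, h.sum]

theorem one_sub (h : Tri x p q r) : Tri (1 - x) q p r where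
  p_ne := h.q_ne
  q_ne := h.p_ne
  r_ne := h.r_ne
  val := h.compl
  sum := by rw [add_comm, h.sum]

theorem inv (h : Tri x p q r) : Tri x⁻¹ r (-q) p where
  p_ne := h.r_ne
  q_ne := neg_ne_zero.2 h.q_ne
  r_ne := h.p_ne
  val := by rw [← h.val, inv_mul_cancel_left₀ h.ne_zero]
  sum := by linear_combination -h.sum

theorem unique (h : Tri x p q r) (h' : Tri y p' q' r') (e : p' * r = p * r') : y = x := by
  rw [h.eq_div, h'.eq_div, div_eq_div_iff h'.r_ne h.r_ne, e]

theorem anh_id (h : Tri x p q r) (h' : Tri y p' q' r') (e : p' * r = p * r') : Anh 1 x y := by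
  rw [h.unique h' e]
  exact .refl x

theorem anh_inv (h : Tri x p q r) (h' : Tri y p' q' r') (e : p' * p = r * r') : Anh (-1) x y := by
  rw [h.inv.unique h' e]
  exact .inv (.refl x) h.ne_zero h.one_sub_ne_zero

theorem anh_osub (h : Tri x p q r) (h' : Tri y p' q' r') (e : p' * r = q * r') :
    Anh (-1) x y := by
  rw [h.one_sub.unique h' e]
  exact .one_sub (.refl x) h.ne_zero h.one_sub_ne_zero

theorem anh_inv_osub (h : Tri x p q r) (h' : Tri y p' q' r') (e : p' * q = r * r') :
    Anh 1 x y := by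
  rw [h.one_sub.inv.unique h' e, ← neg_neg (1 : ℚ)]
  exact .inv (.one_sub (.refl x) h.ne_zero h.one_sub_ne_zero) h.one_sub.ne_zero
    h.one_sub.one_sub_ne_zero

theorem anh_osub_inv (h : Tri x p q r) (h' : Tri y p' q' r') (e : p' * p = -q * r') :
    Anh 1 x y := by
  rw [h.inv.one_sub.unique h' e, ← neg_neg (1 : ℚ)]
  exact .one_sub (.inv (.refl x) h.ne_zero h.one_sub_ne_zero) h.inv.ne_zero
    h.inv.one_sub_ne_zero

theorem anh_ngo (h : Tri x p q r) (h' : Tri y p' q' r') (e : p' * q = -p * r') :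
    Anh (-1) x y := by
  rw [h.one_sub.inv.one_sub.unique h' e, ← neg_neg (-1 : ℚ)]
  refine .one_sub (neg_neg (1 : ℚ) ▸ .inv (.one_sub (.refl x) h.ne_zero h.one_sub_ne_zero) ?_ ?_)
    h.one_sub.inv.ne_zero h.one_sub.inv.one_sub_ne_zero
  exacts [h.one_sub.ne_zero, h.one_sub.one_sub_ne_zero]

end Tri

end Triples

theorem AG_rel (σ : Equiv.Perm (Fin 8)) {ε δ c : ℚ} {z w z' w' : K4}
    (hz : Anh ε (permAut 8 4 σ z) z') (hw : Anh δ (permAut 8 4 σ w) w')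
    (hc : ε * δ * ((Equiv.Perm.sign σ : ℤˣ) : ℤ) = c) : AG z' w' = c • AG z w := by
  rw [AG_left hz, AG_right hw, AG_perm, smul_smul, smul_smul, hc]

theorem AG_rel_swap (σ : Equiv.Perm (Fin 8)) {ε δ c : ℚ} {z w z' w' : K4}
    (hz : Anh ε (permAut 8 4 σ z) w') (hw : Anh δ (permAut 8 4 σ w) z')
    (hc : -(ε * δ * ((Equiv.Perm.sign σ : ℤˣ) : ℤ)) = c) : AG z' w' = c • AG z w := by
  rw [AG_comm, AG_rel σ hz hw rfl, ← neg_smul, hc]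

theorem AG_eq_zero {z w : K4} (h : AG z w = (-1 : ℚ) • AG z w) : AG z w = 0 := by
  have h2 : (2 : ℚ) • AG z w = 0 := by
    rw [two_smul]
    nth_rewrite 1 [h]
    rw [neg_smul, one_smul, neg_add_cancel]
  rw [← one_smul ℚ (AG z w), ← inv_mul_cancel₀ (two_ne_zero (α := ℚ)), mul_smul, h2, smul_zero]

end GrassPoly

namespace GrassPoly

theorem rho_one : rho 1 = d4 1 2 3 7 / d4 1 2 3 8 := by simp [rho, M6]

theorem rho_two : rho 2 = d4 2 3 4 7 / d4 2 3 4 8 := by simp [rho, M6]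

theorem rho_three : rho 3 = d4 3 4 5 7 / d4 3 4 5 8 := by simp [rho, M6]

theorem rho_four : rho 4 = d4 4 5 6 7 / d4 4 5 6 8 := by simp [rho, M6]

theorem div_val {F : Type} [Field F] {n d p r : F} (hd : d ≠ 0) (h : n * r = p * d) :
    n / d * r = p := by
  rw [div_mul_eq_mul_div, h, mul_div_cancel_right₀ _ hd]

section ThreeTerm

variable {F : Type} [Field F] {x y p q r p' q' r' P Q R P' Q' R' : F}

theorem Tri.one_sub_mul (hx : Tri x p q r) (hy : Tri y p' q' r') (hP : P ≠ 0) (hQ : Q ≠ 0)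
    (hR : R ≠ 0) (hs : P + Q = R) (e : p * p' * R = Q * (r * r')) : Tri (1 - x * y) P Q R := by
  refine ⟨hP, hQ, hR, ?_, hs⟩
  have h : x * y * R = Q := by
    refine mul_right_cancel₀ (mul_ne_zero hx.r_ne hy.r_ne) ?_
    rw [← e, ← hx.val, ← hy.val]; ring
  rw [sub_mul, one_mul, h, ← hs, add_sub_cancel_right]

theorem Tri.one_sub_div_val (hx : Tri x p q r) (hy : Tri y P Q R)
    (e : q * R * R' = P' * (r * P)) : (1 - x) / y * R' = P' := by
  rw [hx.one_sub_eq_div, hy.eq_div, div_div_div_eq]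
  exact div_val (mul_ne_zero hx.r_ne hy.p_ne) e

end ThreeTerm

theorem rr_four_two : rr 4 2 * (d4 2 3 4 8 * d4 4 5 6 8) = -Q4 4 2 3 5 6 7 8 := by
  have h1 := d4_ne_zero (a := 2) (b := 3) (c := 4) (d := 8) (by norm_num)
  have h2 := d4_ne_zero (a := 4) (b := 5) (c := 6) (d := 8) (by norm_num)
  rw [rr, rho_four, rho_two]
  simp only [Q4, d4_sort12, d4_sort23, Nat.reduceLT]
  field_simp
  ring

theorem rr_four_one : rr 4 1 * (d4 1 2 3 8 * d4 4 5 6 8) = -A4 1 2 3 4 5 6 7 8 := by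
  have h1 := d4_ne_zero (a := 1) (b := 2) (c := 3) (d := 8) (by norm_num)
  have h2 := d4_ne_zero (a := 4) (b := 5) (c := 6) (d := 8) (by norm_num)
  rw [rr, rho_four, rho_one]
  simp only [A4]
  field_simp
  ring

theorem rr_one_three : rr 1 3 * (d4 1 2 3 8 * d4 3 4 5 8) = Q4 3 1 2 4 5 7 8 := by
  have h1 := d4_ne_zero (a := 1) (b := 2) (c := 3) (d := 8) (by norm_num)
  have h2 := d4_ne_zero (a := 3) (b := 4) (c := 5) (d := 8) (by norm_num)
  rw [rr, rho_one, rho_three]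
  simp only [Q4, d4_sort12, d4_sort23, Nat.reduceLT]
  field_simp

theorem rr_one_two : rr 1 2 * (d4 1 2 3 8 * d4 2 3 4 8) = d4 1 2 3 4 * d4 2 3 7 8 := by
  have h1 := d4_ne_zero (a := 1) (b := 2) (c := 3) (d := 8) (by norm_num)
  have h2 := d4_ne_zero (a := 2) (b := 3) (c := 4) (d := 8) (by norm_num)
  rw [rr, rho_one, rho_two]
  have h := d4_pluecker 2 3 1 4 7 8
  simp only [d4_sort12, d4_sort23, Nat.reduceLT] at h
  field_simp
  linear_combination -h

theorem rr_three_four : rr 3 4 * (d4 3 4 5 8 * d4 4 5 6 8) = d4 3 4 5 6 * d4 4 5 7 8 := by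
  have h1 := d4_ne_zero (a := 3) (b := 4) (c := 5) (d := 8) (by norm_num)
  have h2 := d4_ne_zero (a := 4) (b := 5) (c := 6) (d := 8) (by norm_num)
  rw [rr, rho_three, rho_four]
  have h := d4_pluecker 4 5 3 6 7 8
  simp only [d4_sort12, d4_sort23, Nat.reduceLT] at h
  field_simp
  linear_combination -h

theorem rr_three_two : rr 3 2 * (d4 2 3 4 8 * d4 3 4 5 8) = -(d4 2 3 4 5 * d4 3 4 7 8) := by
  have h1 := d4_ne_zero (a := 2) (b := 3) (c := 4) (d := 8) (by norm_num)
  have h2 := d4_ne_zero (a := 3) (b := 4) (c := 5) (d := 8) (by norm_num)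
  rw [rr, rho_three, rho_two]
  have h := d4_pluecker 3 4 2 5 7 8
  simp only [d4_sort12, d4_sort23, Nat.reduceLT] at h
  field_simp
  linear_combination h

theorem tri_rho41 : Tri (rho 4 / rho 1) (d4 1 2 3 8 * d4 4 5 6 7) (A4 1 2 3 4 5 6 7 8)
    (d4 1 2 3 7 * d4 4 5 6 8) where
  p_ne := by simp [d4_ne_zero]
  q_ne := by simp [A4_ne_zero]
  r_ne := by simp [d4_ne_zero]
  val := by
    have h1 := d4_ne_zero (a := 1) (b := 2) (c := 3) (d := 7) (by norm_num)
    have h2 := d4_ne_zero (a := 1) (b := 2) (c := 3) (d := 8) (by norm_num)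
    have h3 := d4_ne_zero (a := 4) (b := 5) (c := 6) (d := 8) (by norm_num)
    rw [rho_four, rho_one]
    field_simp
  sum := by simp only [A4]; ring

theorem tri_rho21 : Tri (rho 2 / rho 1) (d4 1 2 3 8 * d4 2 3 4 7) (d4 1 2 3 4 * d4 2 3 7 8)
    (d4 1 2 3 7 * d4 2 3 4 8) where
  p_ne := by simp [d4_ne_zero]
  q_ne := by simp [d4_ne_zero]
  r_ne := by simp [d4_ne_zero]
  val := by
    have h1 := d4_ne_zero (a := 1) (b := 2) (c := 3) (d := 7) (by norm_num)
    have h2 := d4_ne_zero (a := 1) (b := 2) (c := 3) (d := 8) (by norm_num)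
    have h3 := d4_ne_zero (a := 2) (b := 3) (c := 4) (d := 8) (by norm_num)
    rw [rho_two, rho_one]
    field_simp
  sum := by
    have h0 := d4_pluecker 2 3 1 4 7 8
    simp only [d4_sort12, d4_sort23, Nat.reduceLT] at h0
    linear_combination h0

theorem tri_cr34 : Tri (CR 3 4 2 5 6 7) (d4 2 3 4 6 * d4 3 4 5 7) (-(d4 2 3 4 5 * d4 3 4 6 7))
    (d4 2 3 4 7 * d4 3 4 5 6) where
  p_ne := by simp [d4_ne_zero]
  q_ne := by simp [d4_ne_zero]
  r_ne := by simp [d4_ne_zero]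
  val := div_val (by simp [d4_sort12, d4_sort23, Nat.reduceLT, d4_ne_zero])
    (by simp only [d4_sort12, d4_sort23, Nat.reduceLT]; ring)
  sum := by
    have h0 := d4_pluecker 3 4 2 5 6 7
    simp only [d4_sort12, d4_sort23, Nat.reduceLT] at h0
    linear_combination -h0

theorem tri_cr67 : Tri (CR 6 7 1 3 4 5) (d4 1 4 6 7 * d4 3 5 6 7) (-(d4 1 3 6 7 * d4 4 5 6 7))
    (d4 1 5 6 7 * d4 3 4 6 7) where
  p_ne := by simp [d4_ne_zero]
  q_ne := by simp [d4_ne_zero]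
  r_ne := by simp [d4_ne_zero]
  val := div_val (by simp [d4_sort12, d4_sort23, d4_sort34, Nat.reduceLT, d4_ne_zero])
    (by simp only [d4_sort12, d4_sort23, d4_sort34, Nat.reduceLT]; ring)
  sum := by
    have h0 := d4_pluecker 6 7 1 3 4 5
    simp only [d4_sort12, d4_sort23, d4_sort34, Nat.reduceLT] at h0
    linear_combination -h0

theorem rr_four_one_ne_zero : rr 4 1 ≠ 0 := fun h => by
  have h' := rr_four_one
  rw [h, zero_mul] at h'
  exact neg_ne_zero.2 A4_ne_zero h'.symm

theorem rr_four_three_ne_zero : rr 4 3 ≠ 0 := fun h => by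
  have h' := rr_three_four
  rw [rr, ← neg_sub, ← rr, h, neg_zero, zero_mul] at h'
  simp [d4_ne_zero] at h'

theorem rr_three_two_ne_zero : rr 3 2 ≠ 0 := fun h => by
  have h' := rr_three_two
  rw [h, zero_mul] at h'
  simp [d4_ne_zero] at h'

theorem rho_one_ne_zero : rho 1 ≠ 0 := by
  simp [rho_one, d4_ne_zero]

theorem rr_neg (i j : ℕ) : rr i j = -rr j i := by
  rw [rr, rr, neg_sub]

theorem tri_rr_fst : Tri (rr 4 2 / rr 4 1) (d4 1 2 3 8 * Q4 4 2 3 5 6 7 8)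
    (d4 1 2 3 4 * d4 2 3 7 8 * d4 4 5 6 8) (d4 2 3 4 8 * A4 1 2 3 4 5 6 7 8) where
  p_ne := by simp [d4_ne_zero, Q4_423_ne_zero]
  q_ne := by simp [d4_ne_zero]
  r_ne := by simp [d4_ne_zero, A4_ne_zero]
  val := div_val rr_four_one_ne_zero (by
    linear_combination rr 4 2 * d4 2 3 4 8 * rr_four_one - d4 1 2 3 8 * rr 4 1 * rr_four_two)
  sum := by
    have h42 := rr_four_two
    have h12 := rr_one_two
    have h41 := rr_four_one
    simp only [rr] at h42 h12 h41
    linear_combination d4 1 2 3 8 * h42 - d4 4 5 6 8 * h12 - d4 2 3 4 8 * h41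

theorem tri_rr_snd : Tri (rr 4 1 / rr 4 3) (d4 3 4 5 8 * A4 1 2 3 4 5 6 7 8)
    (-(d4 4 5 6 8 * Q4 3 1 2 4 5 7 8)) (d4 1 2 3 8 * d4 3 4 5 6 * d4 4 5 7 8) where
  p_ne := by simp [d4_ne_zero, A4_ne_zero]
  q_ne := by simp [d4_ne_zero, Q4_312_ne_zero]
  r_ne := by simp [d4_ne_zero]
  val := div_val rr_four_three_ne_zero (by
    rw [rr_neg 4 3]
    linear_combination d4 3 4 5 8 * rr 3 4 * rr_four_one - rr 4 1 * d4 1 2 3 8 * rr_three_four)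
  sum := by
    have h41 := rr_four_one
    have h13 := rr_one_three
    have h34 := rr_three_four
    simp only [rr] at h41 h13 h34
    linear_combination d4 3 4 5 8 * h41 + d4 4 5 6 8 * h13 + d4 1 2 3 8 * h34

theorem tri_rr_prod : Tri (1 - (rr 4 2 / rr 4 1) * (rr 4 1 / rr 4 3))
    (-(d4 2 3 4 5 * d4 3 4 7 8 * d4 4 5 6 8)) (d4 3 4 5 8 * Q4 4 2 3 5 6 7 8)
    (d4 2 3 4 8 * d4 3 4 5 6 * d4 4 5 7 8) :=
  tri_rr_fst.one_sub_mul tri_rr_snd (by simp [d4_ne_zero])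
    (by simp [d4_ne_zero, Q4_423_ne_zero])
    (by simp [d4_ne_zero])
    (by
      have h32 := rr_three_two
      have h42 := rr_four_two
      have h34 := rr_three_four
      simp only [rr] at h32 h42 h34
      linear_combination d4 3 4 5 8 * h42 - d4 4 5 6 8 * h32 + d4 2 3 4 8 * h34) (by ring)

theorem tri_rr_mid : Tri ((1 - rr 4 2 / rr 4 1) / (1 - (rr 4 2 / rr 4 1) * (rr 4 1 / rr 4 3)))
    (-(d4 1 2 3 4 * d4 2 3 7 8 * d4 3 4 5 6 * d4 4 5 7 8)) (Q4 4 2 3 5 6 7 8 * Q4 3 1 2 4 5 7 8)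
    (d4 2 3 4 5 * d4 3 4 7 8 * A4 1 2 3 4 5 6 7 8) where
  p_ne := by simp [d4_ne_zero]
  q_ne := by simp [Q4_423_ne_zero, Q4_312_ne_zero]
  r_ne := by simp [d4_ne_zero, A4_ne_zero]
  val := tri_rr_fst.one_sub_div_val tri_rr_prod (by ring)
  sum := by
    have h12 := rr_one_two
    have h34 := rr_three_four
    have h42 := rr_four_two
    have h13 := rr_one_three
    have h32 := rr_three_two
    have h41 := rr_four_one
    simp only [rr] at h12 h34 h42 h13 h32 h41
    linear_combination Q4 3 1 2 4 5 7 8 * h42 + ((rho 4 - rho 2) * (d4 2 3 4 8 * d4 4 5 6 8)) *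
      h13 + d4 3 4 5 6 * d4 4 5 7 8 * h12 + ((rho 1 - rho 2) * (d4 1 2 3 8 * d4 2 3 4 8)) *
      h34 - A4 1 2 3 4 5 6 7 8 * h32 + ((rho 3 - rho 2) * (d4 2 3 4 8 * d4 3 4 5 8)) * h41

theorem tri_rr_last : Tri ((1 - rr 4 1 / rr 4 3) / (1 - (rr 4 2 / rr 4 1) * (rr 4 1 / rr 4 3)))
    (d4 2 3 4 8 * Q4 3 1 2 4 5 7 8) (-(d4 1 2 3 4 * d4 2 3 7 8 * d4 3 4 5 8))
    (d4 1 2 3 8 * d4 2 3 4 5 * d4 3 4 7 8) where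
  p_ne := by simp [d4_ne_zero, Q4_312_ne_zero]
  q_ne := by simp [d4_ne_zero]
  r_ne := by simp [d4_ne_zero]
  val := tri_rr_snd.one_sub_div_val tri_rr_prod (by ring)
  sum := by
    have h13 := rr_one_three
    have h12 := rr_one_two
    have h32 := rr_three_two
    simp only [rr] at h13 h12 h32
    linear_combination d4 3 4 5 8 * h12 - d4 2 3 4 8 * h13 - d4 1 2 3 8 * h32

theorem tri_cr_a_fst : Tri (CR 4 3 2 6 8 5) (-(d4 2 3 4 8 * d4 3 4 5 6)) (d4 2 3 4 6 * d4 3 4 5 8)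
    (d4 2 3 4 5 * d4 3 4 6 8) where
  p_ne := by simp [d4_ne_zero]
  q_ne := by simp [d4_ne_zero]
  r_ne := by simp [d4_ne_zero]
  val := div_val (by simp [d4_sort12, d4_sort23, Nat.reduceLT, d4_ne_zero])
    (by simp only [d4_sort12, d4_sort23, d4_sort34, Nat.reduceLT]; ring)
  sum := by
    have h0 := d4_pluecker 3 4 2 5 6 8
    simp only [d4_sort12, d4_sort23, Nat.reduceLT] at h0
    linear_combination -h0

theorem tri_cr_a_snd : Tri (CR 4 8 7 6 5 3) (d4 3 4 6 8 * d4 4 5 7 8) (-(d4 3 4 5 8 * d4 4 6 7 8))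
    (d4 3 4 7 8 * d4 4 5 6 8) where
  p_ne := by simp [d4_ne_zero]
  q_ne := by simp [d4_ne_zero]
  r_ne := by simp [d4_ne_zero]
  val := div_val (by simp [d4_sort12, d4_sort23, d4_sort34, Nat.reduceLT, d4_ne_zero])
    (by simp only [d4_sort12, d4_sort23, d4_sort34, Nat.reduceLT]; ring)
  sum := by
    have h0 := d4_pluecker 4 8 3 5 6 7
    simp only [d4_sort12, d4_sort23, d4_sort34, Nat.reduceLT] at h0
    linear_combination h0

theorem tri_cr_a_prod : Tri (1 - CR 4 3 2 6 8 5 * CR 4 8 7 6 5 3) (d4 3 4 5 8 * Q4 4 2 3 5 6 7 8)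
    (-(d4 2 3 4 8 * d4 3 4 5 6 * d4 4 5 7 8)) (d4 2 3 4 5 * d4 3 4 7 8 * d4 4 5 6 8) :=
  tri_cr_a_fst.one_sub_mul tri_cr_a_snd (by simp [d4_ne_zero, Q4_423_ne_zero])
    (by simp [d4_ne_zero])
    (by simp [d4_ne_zero])
    (by
      have h0 := d4_pluecker 3 4 2 5 7 8
      have h1 := d4_pluecker 4 5 3 6 7 8
      simp only [d4_sort12, d4_sort23, Nat.reduceLT] at h0 h1
      simp only [Q4, d4_sort12, d4_sort23, Nat.reduceLT]
      linear_combination -d4 4 5 6 8 * h0 - d4 2 3 4 8 * h1) (by ring)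

theorem tri_cr_a_mid : Tri ((1 - CR 4 3 2 6 8 5) / (1 - CR 4 3 2 6 8 5 * CR 4 8 7 6 5 3))
    (d4 2 3 4 6 * d4 3 4 7 8 * d4 4 5 6 8) (d4 2 3 4 8 * d4 3 4 5 6 * d4 4 6 7 8)
    (d4 3 4 6 8 * Q4 4 2 3 5 6 7 8) where
  p_ne := by simp [d4_ne_zero]
  q_ne := by simp [d4_ne_zero]
  r_ne := by simp [d4_ne_zero, Q4_423_ne_zero]
  val := tri_cr_a_fst.one_sub_div_val tri_cr_a_prod (by ring)
  sum := by
    have h0 := d4_pluecker 3 4 2 6 7 8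
    have h1 := d4_pluecker 4 6 3 5 7 8
    simp only [d4_sort12, d4_sort23, d4_sort34, Nat.reduceLT] at h0 h1
    simp only [Q4, d4_sort12, d4_sort23, Nat.reduceLT]
    linear_combination d4 4 5 6 8 * h0 - d4 2 3 4 8 * h1

theorem tri_cr_a_last : Tri ((1 - CR 4 8 7 6 5 3) / (1 - CR 4 3 2 6 8 5 * CR 4 8 7 6 5 3))
    (-(d4 2 3 4 5 * d4 4 6 7 8)) (d4 2 3 4 6 * d4 4 5 7 8) (Q4 4 2 3 5 6 7 8) where
  p_ne := by simp [d4_ne_zero]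
  q_ne := by simp [d4_ne_zero]
  r_ne := by simp [Q4_423_ne_zero]
  val := tri_cr_a_snd.one_sub_div_val tri_cr_a_prod (by ring)
  sum := by
    have h := Q4_block23 4 2 3 5 6 7 8
    simp only [Q4, d4_sort12, d4_sort23, d4_sort34, Nat.reduceLT] at h ⊢
    linear_combination -h

theorem tri_cr_b_fst : Tri (CR 4 3 1 2 5 6) (d4 1 3 4 5 * d4 2 3 4 6) (-(d4 1 2 3 4 * d4 3 4 5 6))
    (d4 1 3 4 6 * d4 2 3 4 5) where
  p_ne := by simp [d4_ne_zero]
  q_ne := by simp [d4_ne_zero]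
  r_ne := by simp [d4_ne_zero]
  val := div_val (by simp [d4_sort12, d4_sort23, Nat.reduceLT, d4_ne_zero])
    (by simp only [d4_sort12, d4_sort23, Nat.reduceLT]; ring)
  sum := by
    have h0 := d4_pluecker 3 4 1 2 5 6
    simp only [d4_sort12, d4_sort23, d4_sort34, Nat.reduceLT] at h0
    linear_combination -h0

theorem tri_cr_b_snd : Tri (CR 4 3 1 2 6 8) (d4 1 3 4 6 * d4 2 3 4 8) (-(d4 1 2 3 4 * d4 3 4 6 8))
    (d4 1 3 4 8 * d4 2 3 4 6) where
  p_ne := by simp [d4_ne_zero]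
  q_ne := by simp [d4_ne_zero]
  r_ne := by simp [d4_ne_zero]
  val := div_val (by simp [d4_sort12, d4_sort23, Nat.reduceLT, d4_ne_zero])
    (by simp only [d4_sort12, d4_sort23, Nat.reduceLT]; ring)
  sum := by
    have h0 := d4_pluecker 3 4 1 2 6 8
    simp only [d4_sort12, d4_sort23, d4_sort34, Nat.reduceLT] at h0
    linear_combination -h0

theorem tri_cr_b_prod : Tri (1 - CR 4 3 1 2 5 6 * CR 4 3 1 2 6 8) (-(d4 1 2 3 4 * d4 3 4 5 8))
    (d4 1 3 4 5 * d4 2 3 4 8) (d4 1 3 4 8 * d4 2 3 4 5) :=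
  tri_cr_b_fst.one_sub_mul tri_cr_b_snd (by simp [d4_ne_zero])
    (by simp [d4_ne_zero])
    (by simp [d4_ne_zero])
    (by
      have h0 := d4_pluecker 3 4 1 2 5 8
      simp only [d4_sort12, d4_sort23, d4_sort34, Nat.reduceLT] at h0
      linear_combination -h0) (by ring)

theorem tri_cr_b_mid : Tri ((1 - CR 4 3 1 2 5 6) / (1 - CR 4 3 1 2 5 6 * CR 4 3 1 2 6 8))
    (d4 1 3 4 8 * d4 3 4 5 6) (d4 1 3 4 5 * d4 3 4 6 8) (d4 1 3 4 6 * d4 3 4 5 8) where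
  p_ne := by simp [d4_ne_zero]
  q_ne := by simp [d4_ne_zero]
  r_ne := by simp [d4_ne_zero]
  val := tri_cr_b_fst.one_sub_div_val tri_cr_b_prod (by ring)
  sum := by
    have h0 := d4_pluecker 3 4 1 5 6 8
    simp only [d4_sort12, d4_sort23, Nat.reduceLT] at h0
    linear_combination h0

theorem tri_cr_b_last : Tri ((1 - CR 4 3 1 2 6 8) / (1 - CR 4 3 1 2 5 6 * CR 4 3 1 2 6 8))
    (d4 2 3 4 5 * d4 3 4 6 8) (d4 2 3 4 8 * d4 3 4 5 6) (d4 2 3 4 6 * d4 3 4 5 8) where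
  p_ne := by simp [d4_ne_zero]
  q_ne := by simp [d4_ne_zero]
  r_ne := by simp [d4_ne_zero]
  val := tri_cr_b_snd.one_sub_div_val tri_cr_b_prod (by ring)
  sum := by
    have h0 := d4_pluecker 3 4 2 5 6 8
    simp only [d4_sort12, d4_sort23, Nat.reduceLT] at h0
    linear_combination h0

theorem tri_cr_c_fst : Tri (CR 4 3 1 2 5 6) (d4 1 3 4 5 * d4 2 3 4 6) (-(d4 1 2 3 4 * d4 3 4 5 6))
    (d4 1 3 4 6 * d4 2 3 4 5) where
  p_ne := by simp [d4_ne_zero]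
  q_ne := by simp [d4_ne_zero]
  r_ne := by simp [d4_ne_zero]
  val := div_val (by simp [d4_sort12, d4_sort23, Nat.reduceLT, d4_ne_zero])
    (by simp only [d4_sort12, d4_sort23, Nat.reduceLT]; ring)
  sum := by
    have h0 := d4_pluecker 3 4 1 2 5 6
    simp only [d4_sort12, d4_sort23, d4_sort34, Nat.reduceLT] at h0
    linear_combination -h0

theorem tri_cr_c_snd : Tri (CR 4 2 1 3 6 5) (d4 1 2 4 6 * d4 2 3 4 5) (d4 1 2 3 4 * d4 2 4 5 6)
    (d4 1 2 4 5 * d4 2 3 4 6) where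
  p_ne := by simp [d4_ne_zero]
  q_ne := by simp [d4_ne_zero]
  r_ne := by simp [d4_ne_zero]
  val := div_val (by simp [d4_sort12, d4_sort23, Nat.reduceLT, d4_ne_zero])
    (by simp only [d4_sort12, d4_sort23, Nat.reduceLT]; ring)
  sum := by
    have h0 := d4_pluecker 2 4 1 3 5 6
    simp only [d4_sort12, d4_sort23, d4_sort34, Nat.reduceLT] at h0
    linear_combination -h0

theorem tri_cr_c_prod : Tri (1 - CR 4 3 1 2 5 6 * CR 4 2 1 3 6 5) (d4 1 2 3 4 * d4 1 4 5 6)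
    (d4 1 2 4 6 * d4 1 3 4 5) (d4 1 2 4 5 * d4 1 3 4 6) :=
  tri_cr_c_fst.one_sub_mul tri_cr_c_snd (by simp [d4_ne_zero])
    (by simp [d4_ne_zero])
    (by simp [d4_ne_zero])
    (by
      have h0 := d4_pluecker 1 4 2 3 5 6
      simp only [d4_sort23, d4_sort34, Nat.reduceLT] at h0
      linear_combination h0) (by ring)

theorem tri_cr_c_mid : Tri ((1 - CR 4 3 1 2 5 6) / (1 - CR 4 3 1 2 5 6 * CR 4 2 1 3 6 5))
    (-(d4 1 2 4 5 * d4 3 4 5 6)) (d4 1 3 4 5 * d4 2 4 5 6) (d4 1 4 5 6 * d4 2 3 4 5) where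
  p_ne := by simp [d4_ne_zero]
  q_ne := by simp [d4_ne_zero]
  r_ne := by simp [d4_ne_zero]
  val := tri_cr_c_fst.one_sub_div_val tri_cr_c_prod (by ring)
  sum := by
    have h0 := d4_pluecker 4 5 1 2 3 6
    simp only [d4_sort12, d4_sort23, d4_sort34, Nat.reduceLT] at h0
    linear_combination -h0

theorem tri_cr_c_last : Tri ((1 - CR 4 2 1 3 6 5) / (1 - CR 4 3 1 2 5 6 * CR 4 2 1 3 6 5))
    (d4 1 3 4 6 * d4 2 4 5 6) (-(d4 1 2 4 6 * d4 3 4 5 6)) (d4 1 4 5 6 * d4 2 3 4 6) where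
  p_ne := by simp [d4_ne_zero]
  q_ne := by simp [d4_ne_zero]
  r_ne := by simp [d4_ne_zero]
  val := tri_cr_c_snd.one_sub_div_val tri_cr_c_prod (by ring)
  sum := by
    have h0 := d4_pluecker 4 6 1 2 3 5
    simp only [d4_sort12, d4_sort23, d4_sort34, Nat.reduceLT] at h0
    linear_combination h0

theorem tri_cr_d_fst : Tri (CR 4 8 7 2 3 5) (d4 2 4 5 8 * d4 3 4 7 8) (-(d4 2 4 7 8 * d4 3 4 5 8))
    (d4 2 3 4 8 * d4 4 5 7 8) where
  p_ne := by simp [d4_ne_zero]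
  q_ne := by simp [d4_ne_zero]
  r_ne := by simp [d4_ne_zero]
  val := div_val (by simp [d4_sort12, d4_sort23, d4_sort34, Nat.reduceLT, d4_ne_zero])
    (by simp only [d4_sort12, d4_sort23, d4_sort34, Nat.reduceLT]; ring)
  sum := by
    have h0 := d4_pluecker 4 8 2 3 5 7
    simp only [d4_sort12, d4_sort23, d4_sort34, Nat.reduceLT] at h0
    linear_combination -h0

theorem tri_cr_d_snd : Tri (CR 4 8 7 2 6 3) (d4 2 3 4 8 * d4 4 6 7 8) (d4 2 4 7 8 * d4 3 4 6 8)
    (d4 2 4 6 8 * d4 3 4 7 8) where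
  p_ne := by simp [d4_ne_zero]
  q_ne := by simp [d4_ne_zero]
  r_ne := by simp [d4_ne_zero]
  val := div_val (by simp [d4_sort12, d4_sort23, d4_sort34, Nat.reduceLT, d4_ne_zero])
    (by simp only [d4_sort12, d4_sort23, d4_sort34, Nat.reduceLT]; ring)
  sum := by
    have h0 := d4_pluecker 4 8 2 3 6 7
    simp only [d4_sort12, d4_sort23, d4_sort34, Nat.reduceLT] at h0
    linear_combination h0

theorem tri_cr_d_prod : Tri (1 - CR 4 8 7 2 3 5 * CR 4 8 7 2 6 3) (d4 2 4 7 8 * d4 4 5 6 8)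
    (d4 2 4 5 8 * d4 4 6 7 8) (d4 2 4 6 8 * d4 4 5 7 8) :=
  tri_cr_d_fst.one_sub_mul tri_cr_d_snd (by simp [d4_ne_zero])
    (by simp [d4_ne_zero])
    (by simp [d4_ne_zero])
    (by
      have h0 := d4_pluecker 4 8 2 5 6 7
      simp only [d4_sort12, d4_sort23, d4_sort34, Nat.reduceLT] at h0
      linear_combination -h0) (by ring)

theorem tri_cr_d_mid : Tri ((1 - CR 4 8 7 2 3 5) / (1 - CR 4 8 7 2 3 5 * CR 4 8 7 2 6 3))
    (-(d4 2 4 6 8 * d4 3 4 5 8)) (d4 2 4 5 8 * d4 3 4 6 8) (d4 2 3 4 8 * d4 4 5 6 8) where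
  p_ne := by simp [d4_ne_zero]
  q_ne := by simp [d4_ne_zero]
  r_ne := by simp [d4_ne_zero]
  val := tri_cr_d_fst.one_sub_div_val tri_cr_d_prod (by ring)
  sum := by
    have h0 := d4_pluecker 4 8 2 3 5 6
    simp only [d4_sort12, d4_sort23, d4_sort34, Nat.reduceLT] at h0
    linear_combination -h0

theorem tri_cr_d_last : Tri ((1 - CR 4 8 7 2 6 3) / (1 - CR 4 8 7 2 3 5 * CR 4 8 7 2 6 3))
    (d4 3 4 6 8 * d4 4 5 7 8) (-(d4 3 4 5 8 * d4 4 6 7 8)) (d4 3 4 7 8 * d4 4 5 6 8) where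
  p_ne := by simp [d4_ne_zero]
  q_ne := by simp [d4_ne_zero]
  r_ne := by simp [d4_ne_zero]
  val := tri_cr_d_snd.one_sub_div_val tri_cr_d_prod (by ring)
  sum := by
    have h0 := d4_pluecker 4 8 3 5 6 7
    simp only [d4_sort12, d4_sort23, d4_sort34, Nat.reduceLT] at h0
    linear_combination h0

theorem tri_cr_e_fst : Tri (CR 4 6 5 2 3 8) (-(d4 2 4 6 8 * d4 3 4 5 6)) (d4 2 4 5 6 * d4 3 4 6 8)
    (d4 2 3 4 6 * d4 4 5 6 8) where
  p_ne := by simp [d4_ne_zero]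
  q_ne := by simp [d4_ne_zero]
  r_ne := by simp [d4_ne_zero]
  val := div_val (by simp [d4_sort12, d4_sort23, d4_sort34, Nat.reduceLT, d4_ne_zero])
    (by simp only [d4_sort12, d4_sort23, d4_sort34, Nat.reduceLT]; ring)
  sum := by
    have h0 := d4_pluecker 4 6 2 3 5 8
    simp only [d4_sort12, d4_sort23, d4_sort34, Nat.reduceLT] at h0
    linear_combination h0

theorem tri_cr_e_snd : Tri (CR 4 3 2 5 6 8) (d4 2 3 4 6 * d4 3 4 5 8) (-(d4 2 3 4 5 * d4 3 4 6 8))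
    (d4 2 3 4 8 * d4 3 4 5 6) where
  p_ne := by simp [d4_ne_zero]
  q_ne := by simp [d4_ne_zero]
  r_ne := by simp [d4_ne_zero]
  val := div_val (by simp [d4_sort12, d4_sort23, Nat.reduceLT, d4_ne_zero])
    (by simp only [d4_sort12, d4_sort23, Nat.reduceLT]; ring)
  sum := by
    have h0 := d4_pluecker 3 4 2 5 6 8
    simp only [d4_sort12, d4_sort23, Nat.reduceLT] at h0
    linear_combination -h0

theorem tri_cr_e_prod : Tri (1 - CR 4 6 5 2 3 8 * CR 4 3 2 5 6 8) (d4 2 4 5 8 * d4 3 4 6 8)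
    (-(d4 2 4 6 8 * d4 3 4 5 8)) (d4 2 3 4 8 * d4 4 5 6 8) :=
  tri_cr_e_fst.one_sub_mul tri_cr_e_snd (by simp [d4_ne_zero])
    (by simp [d4_ne_zero])
    (by simp [d4_ne_zero])
    (by
      have h0 := d4_pluecker 4 8 2 3 5 6
      simp only [d4_sort12, d4_sort23, d4_sort34, Nat.reduceLT] at h0
      linear_combination -h0) (by ring)

theorem tri_cr_e_mid : Tri ((1 - CR 4 6 5 2 3 8) / (1 - CR 4 6 5 2 3 8 * CR 4 3 2 5 6 8))
    (d4 2 3 4 8 * d4 2 4 5 6) (d4 2 3 4 5 * d4 2 4 6 8) (d4 2 3 4 6 * d4 2 4 5 8) where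
  p_ne := by simp [d4_ne_zero]
  q_ne := by simp [d4_ne_zero]
  r_ne := by simp [d4_ne_zero]
  val := tri_cr_e_fst.one_sub_div_val tri_cr_e_prod (by ring)
  sum := by
    have h0 := d4_pluecker 2 4 3 5 6 8
    simp only [d4_sort23, Nat.reduceLT] at h0
    linear_combination -h0

theorem tri_cr_e_last : Tri ((1 - CR 4 3 2 5 6 8) / (1 - CR 4 6 5 2 3 8 * CR 4 3 2 5 6 8))
    (-(d4 2 3 4 5 * d4 4 5 6 8)) (d4 2 4 5 6 * d4 3 4 5 8) (d4 2 4 5 8 * d4 3 4 5 6) where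
  p_ne := by simp [d4_ne_zero]
  q_ne := by simp [d4_ne_zero]
  r_ne := by simp [d4_ne_zero]
  val := tri_cr_e_snd.one_sub_div_val tri_cr_e_prod (by ring)
  sum := by
    have h0 := d4_pluecker 4 5 2 3 6 8
    simp only [d4_sort12, d4_sort23, d4_sort34, Nat.reduceLT] at h0
    linear_combination -h0

theorem tri_rr_fst_arg : Tri (rr 1 2 * rr 3 4 / (rr 1 4 * rr 3 2))
    (-(d4 1 2 3 4 * d4 2 3 7 8 * d4 3 4 5 6 * d4 4 5 7 8)) (Q4 4 2 3 5 6 7 8 * Q4 3 1 2 4 5 7 8)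
    (d4 2 3 4 5 * d4 3 4 7 8 * A4 1 2 3 4 5 6 7 8) where
  p_ne := by simp [d4_ne_zero]
  q_ne := by simp [Q4_423_ne_zero, Q4_312_ne_zero]
  r_ne := by simp [d4_ne_zero, A4_ne_zero]
  val := div_val (mul_ne_zero (rr_neg 1 4 ▸ neg_ne_zero.2 rr_four_one_ne_zero) rr_three_two_ne_zero)
    (by
    rw [rr_neg 1 4]
    linear_combination rr 1 2 * rr 3 4 * (A4 1 2 3 4 5 6 7 8 * rr_three_two - (rr 3 2 * (d4 2 3 4
      8 * d4 3 4 5 8)) * rr_four_one) + rr 4 1 * rr 3 2 * (d4 3 4 5 6 * d4 4 5 7 8 * rr_one_two +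
      (rr 1 2 * (d4 1 2 3 8 * d4 2 3 4 8)) * rr_three_four))
  sum := tri_rr_mid.sum

theorem tri_rho_div_rr : Tri (rho 1 / rr 1 4) (d4 1 2 3 7 * d4 4 5 6 8) (-(d4 1 2 3 8 * d4 4 5 6 7))
    (A4 1 2 3 4 5 6 7 8) where
  p_ne := by simp [d4_ne_zero]
  q_ne := by simp [d4_ne_zero]
  r_ne := by simp [A4_ne_zero]
  val := div_val (rr_neg 1 4 ▸ neg_ne_zero.2 rr_four_one_ne_zero) (by
    rw [rr_neg 1 4]
    have g : rho 1 * d4 1 2 3 8 = d4 1 2 3 7 := by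
      rw [rho_one, div_mul_cancel₀ _ (d4_ne_zero (by norm_num))]
    linear_combination rho 1 * rr_four_one - d4 4 5 6 8 * rr 4 1 * g)
  sum := by simp only [A4]; ring

theorem tri_rr_div_rho : Tri (rr 1 2 / rho 1) (d4 1 2 3 4 * d4 2 3 7 8) (d4 1 2 3 8 * d4 2 3 4 7)
    (d4 1 2 3 7 * d4 2 3 4 8) where
  p_ne := by simp [d4_ne_zero]
  q_ne := by simp [d4_ne_zero]
  r_ne := by simp [d4_ne_zero]
  val := div_val rho_one_ne_zero (by
    have g : rho 1 * d4 1 2 3 8 = d4 1 2 3 7 := by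
      rw [rho_one, div_mul_cancel₀ _ (d4_ne_zero (by norm_num))]
    linear_combination rho 1 * rr_one_two - rr 1 2 * d4 2 3 4 8 * g)
  sum := by
    have h0 := d4_pluecker 2 3 1 4 7 8
    simp only [d4_sort12, d4_sort23, Nat.reduceLT] at h0
    linear_combination h0

theorem tri_rr_div_rr : Tri (rr 3 2 / rr 3 4) (-(d4 2 3 4 5 * d4 3 4 7 8 * d4 4 5 6 8))
    (d4 3 4 5 8 * Q4 4 2 3 5 6 7 8) (d4 2 3 4 8 * d4 3 4 5 6 * d4 4 5 7 8) where
  p_ne := by simp [d4_ne_zero]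
  q_ne := by simp [d4_ne_zero, Q4_423_ne_zero]
  r_ne := by simp [d4_ne_zero]
  val := div_val (rr_neg 3 4 ▸ neg_ne_zero.2 rr_four_three_ne_zero) (by
    linear_combination d4 4 5 6 8 * rr 3 4 * rr_three_two - rr 3 2 * d4 2 3 4 8 * rr_three_four)
  sum := tri_rr_prod.sum

end GrassPoly

namespace GrassPoly

theorem AG_rel_id {ε δ c : ℚ} {z w z' w' : K4} (hz : Anh ε z z') (hw : Anh δ w w')
    (hc : ε * δ = c) : AG z' w' = c • AG z w := by
  rw [AG_left hz, AG_right hw, smul_smul, hc]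

theorem AG_rel_swap_id {ε δ c : ℚ} {z w z' w' : K4} (hz : Anh ε z w') (hw : Anh δ w z')
    (hc : -(ε * δ) = c) : AG z' w' = c • AG z w := by
  rw [AG_comm, AG_rel_id hz hw rfl, ← neg_smul, hc]

theorem AG_rho41_rr_fst : AG (rho 4 / rho 1) (rr 4 2 / rr 4 1) = 0 := by
  obtain ⟨σ, hs, h1, h2, h3, h4, h5, h6, h7, h8⟩ : ∃ σ : Equiv.Perm (Fin 8),
      Equiv.Perm.sign σ = -1 ∧ lab σ 1 = 1 ∧ lab σ 2 = 2 ∧ lab σ 3 = 3 ∧ lab σ 4 = 4 ∧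
        lab σ 5 = 6 ∧ lab σ 6 = 5 ∧ lab σ 7 = 7 ∧ lab σ 8 = 8 :=
    ⟨Equiv.swap 4 5, by simp, by decide⟩
  refine AG_eq_zero (AG_rel σ ((tri_rho41.map (permAut 8 4 σ)).anh_id tri_rho41 ?_)
    ((tri_rr_fst.map (permAut 8 4 σ)).anh_id tri_rr_fst ?_) (by rw [hs]; norm_num)) <;>
  simp only [permAut_d4, map_mul, map_neg, map_sub, h1, h2, h3, h4, h5, h6, h7, h8, A4, Q4,
    d4_sort12, d4_sort23, Nat.reduceLT] <;>
  ring

theorem AG_rho41_rr_snd : AG (rho 4 / rho 1) (rr 4 1 / rr 4 3) = 0 := by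
  obtain ⟨σ, hs, h1, h2, h3, h4, h5, h6, h7, h8⟩ : ∃ σ : Equiv.Perm (Fin 8),
      Equiv.Perm.sign σ = -1 ∧ lab σ 1 = 1 ∧ lab σ 2 = 2 ∧ lab σ 3 = 3 ∧ lab σ 4 = 5 ∧
        lab σ 5 = 4 ∧ lab σ 6 = 6 ∧ lab σ 7 = 7 ∧ lab σ 8 = 8 :=
    ⟨Equiv.swap 3 4, by simp, by decide⟩
  refine AG_eq_zero (AG_rel σ ((tri_rho41.map (permAut 8 4 σ)).anh_id tri_rho41 ?_)
    ((tri_rr_snd.map (permAut 8 4 σ)).anh_id tri_rr_snd ?_) (by rw [hs]; norm_num)) <;>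
  simp only [permAut_d4, map_mul, map_sub, h1, h2, h3, h4, h5, h6, h7, h8, A4, d4_sort12, d4_sort23,
    Nat.reduceLT] <;>
  ring

theorem AG_rho41_cr_a_snd : AG (rho 4 / rho 1) (CR 4 8 7 6 5 3) = 0 := by
  obtain ⟨σ, hs, h1, h2, h3, h4, h5, h6, h7, h8⟩ : ∃ σ : Equiv.Perm (Fin 8),
      Equiv.Perm.sign σ = -1 ∧ lab σ 1 = 2 ∧ lab σ 2 = 1 ∧ lab σ 3 = 3 ∧ lab σ 4 = 4 ∧
        lab σ 5 = 5 ∧ lab σ 6 = 6 ∧ lab σ 7 = 7 ∧ lab σ 8 = 8 :=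
    ⟨Equiv.swap 0 1, by simp, by decide⟩
  refine AG_eq_zero (AG_rel σ ((tri_rho41.map (permAut 8 4 σ)).anh_id tri_rho41 ?_)
    ((tri_cr_a_snd.map (permAut 8 4 σ)).anh_id tri_cr_a_snd ?_) (by rw [hs]; norm_num)) <;>
  simp only [permAut_d4, map_mul, h1, h2, h3, h4, h5, h6, h7, h8, d4_sort12, Nat.reduceLT]
  ring

theorem AG_rho41_cr_a_last :
    AG (rho 4 / rho 1) ((1 - CR 4 8 7 6 5 3) / (1 - CR 4 3 2 6 8 5 * CR 4 8 7 6 5 3)) = 0 := by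
  obtain ⟨σ, hs, h1, h2, h3, h4, h5, h6, h7, h8⟩ : ∃ σ : Equiv.Perm (Fin 8),
      Equiv.Perm.sign σ = -1 ∧ lab σ 1 = 1 ∧ lab σ 2 = 3 ∧ lab σ 3 = 2 ∧ lab σ 4 = 4 ∧
        lab σ 5 = 5 ∧ lab σ 6 = 6 ∧ lab σ 7 = 7 ∧ lab σ 8 = 8 :=
    ⟨Equiv.swap 1 2, by simp, by decide⟩
  refine AG_eq_zero (AG_rel σ ((tri_rho41.map (permAut 8 4 σ)).anh_id tri_rho41 ?_)
    ((tri_cr_a_last.map (permAut 8 4 σ)).anh_id tri_cr_a_last ?_) (by rw [hs]; norm_num)) <;>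
  simp only [permAut_d4, map_mul, map_neg, map_sub, h1, h2, h3, h4, h5, h6, h7, h8, Q4, d4_sort12,
    d4_sort23, Nat.reduceLT] <;>
  ring

theorem AG_rho41_cr_c_mid :
    AG (rho 4 / rho 1) ((1 - CR 4 3 1 2 5 6) / (1 - CR 4 3 1 2 5 6 * CR 4 2 1 3 6 5)) = 0 := by
  obtain ⟨σ, hs, h1, h2, h3, h4, h5, h6, h7, h8⟩ : ∃ σ : Equiv.Perm (Fin 8),
      Equiv.Perm.sign σ = -1 ∧ lab σ 1 = 1 ∧ lab σ 2 = 2 ∧ lab σ 3 = 3 ∧ lab σ 4 = 5 ∧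
        lab σ 5 = 4 ∧ lab σ 6 = 6 ∧ lab σ 7 = 7 ∧ lab σ 8 = 8 :=
    ⟨Equiv.swap 3 4, by simp, by decide⟩
  refine AG_eq_zero (AG_rel σ ((tri_rho41.map (permAut 8 4 σ)).anh_id tri_rho41 ?_)
    ((tri_cr_c_mid.map (permAut 8 4 σ)).anh_id tri_cr_c_mid ?_) (by rw [hs]; norm_num)) <;>
  simp only [permAut_d4, map_mul, map_neg, h1, h2, h3, h4, h5, h6, h7, h8, d4_sort12, d4_sort23,
    d4_sort34, Nat.reduceLT] <;>
  ring

theorem AG_rho41_cr_c_last :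
    AG (rho 4 / rho 1) ((1 - CR 4 2 1 3 6 5) / (1 - CR 4 3 1 2 5 6 * CR 4 2 1 3 6 5)) = 0 := by
  obtain ⟨σ, hs, h1, h2, h3, h4, h5, h6, h7, h8⟩ : ∃ σ : Equiv.Perm (Fin 8),
      Equiv.Perm.sign σ = -1 ∧ lab σ 1 = 1 ∧ lab σ 2 = 2 ∧ lab σ 3 = 3 ∧ lab σ 4 = 6 ∧
        lab σ 5 = 5 ∧ lab σ 6 = 4 ∧ lab σ 7 = 7 ∧ lab σ 8 = 8 :=
    ⟨Equiv.swap 3 5, by simp, by decide⟩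
  refine AG_eq_zero (AG_rel σ ((tri_rho41.map (permAut 8 4 σ)).anh_id tri_rho41 ?_)
    ((tri_cr_c_last.map (permAut 8 4 σ)).anh_id tri_cr_c_last ?_) (by rw [hs]; norm_num)) <;>
  simp only [permAut_d4, map_mul, h1, h2, h3, h4, h5, h6, h7, h8, d4_sort12, d4_sort23, d4_sort34,
    Nat.reduceLT] <;>
  ring

theorem AG_rho21_cr_a_last :
    AG (rho 2 / rho 1) ((1 - CR 4 8 7 6 5 3) / (1 - CR 4 3 2 6 8 5 * CR 4 8 7 6 5 3)) = 0 := by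
  obtain ⟨σ, hs, h1, h2, h3, h4, h5, h6, h7, h8⟩ : ∃ σ : Equiv.Perm (Fin 8),
      Equiv.Perm.sign σ = -1 ∧ lab σ 1 = 1 ∧ lab σ 2 = 3 ∧ lab σ 3 = 2 ∧ lab σ 4 = 4 ∧
        lab σ 5 = 5 ∧ lab σ 6 = 6 ∧ lab σ 7 = 7 ∧ lab σ 8 = 8 :=
    ⟨Equiv.swap 1 2, by simp, by decide⟩
  refine AG_eq_zero (AG_rel σ ((tri_rho21.map (permAut 8 4 σ)).anh_id tri_rho21 ?_)
    ((tri_cr_a_last.map (permAut 8 4 σ)).anh_id tri_cr_a_last ?_) (by rw [hs]; norm_num)) <;>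
  simp only [permAut_d4, map_mul, map_neg, map_sub, h1, h2, h3, h4, h5, h6, h7, h8, Q4, d4_sort12,
    d4_sort23, Nat.reduceLT] <;>
  ring

theorem AG_rho21_cr_d_mid :
    AG (rho 2 / rho 1) ((1 - CR 4 8 7 2 3 5) / (1 - CR 4 8 7 2 3 5 * CR 4 8 7 2 6 3)) = 0 := by
  obtain ⟨σ, hs, h1, h2, h3, h4, h5, h6, h7, h8⟩ : ∃ σ : Equiv.Perm (Fin 8),
      Equiv.Perm.sign σ = 1 ∧ lab σ 1 = 5 ∧ lab σ 2 = 4 ∧ lab σ 3 = 8 ∧ lab σ 4 = 2 ∧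
        lab σ 5 = 1 ∧ lab σ 6 = 7 ∧ lab σ 7 = 6 ∧ lab σ 8 = 3 :=
    ⟨Equiv.swap 0 4 * Equiv.swap 1 3 * Equiv.swap 2 7 * Equiv.swap 5 6,
      by simp [Equiv.Perm.sign_mul], by decide⟩
  refine AG_eq_zero (AG_rel_swap σ ((tri_rho21.map (permAut 8 4 σ)).anh_id tri_cr_d_mid ?_)
    ((tri_cr_d_mid.map (permAut 8 4 σ)).anh_id tri_rho21 ?_) (by rw [hs]; norm_num)) <;>
  simp only [permAut_d4, map_mul, map_neg, h1, h2, h3, h4, h5, h6, h7, h8, d4_sort12, d4_sort23,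
    d4_sort34, Nat.reduceLT] <;>
  ring

theorem AG_rho21_cr_e_prod : AG (rho 2 / rho 1) (1 - CR 4 6 5 2 3 8 * CR 4 3 2 5 6 8) = 0 := by
  rw [AG_rel_id (tri_rho21.anh_id tri_rho21 rfl)
    (tri_cr_d_mid.anh_osub tri_cr_e_prod (by ring)) (by norm_num : (1 : ℚ) * -1 = -1),
    AG_rho21_cr_d_mid, smul_zero]

theorem AG_rho21_cr_d_fst : AG (rho 2 / rho 1) (CR 4 8 7 2 3 5) =
    (1 : ℚ) • AG (CR 3 4 2 5 6 7) (CR 6 7 1 3 4 5) := by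
  obtain ⟨σ, hs, h1, h2, h3, h4, h5, h6, h7, h8⟩ : ∃ σ : Equiv.Perm (Fin 8),
      Equiv.Perm.sign σ = 1 ∧ lab σ 1 = 1 ∧ lab σ 2 = 5 ∧ lab σ 3 = 4 ∧ lab σ 4 = 8 ∧
        lab σ 5 = 7 ∧ lab σ 6 = 2 ∧ lab σ 7 = 3 ∧ lab σ 8 = 6 :=
    ⟨Equiv.swap 1 4 * Equiv.swap 4 6 * Equiv.swap 6 2 * Equiv.swap 2 3 * Equiv.swap 3 7 *
      Equiv.swap 7 5,
      by simp [Equiv.Perm.sign_mul], by decide⟩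
  refine AG_rel_swap σ ((tri_cr34.map (permAut 8 4 σ)).anh_ngo tri_cr_d_fst ?_)
    ((tri_cr67.map (permAut 8 4 σ)).anh_id tri_rho21 ?_) (by rw [hs]; norm_num) <;>
  simp only [permAut_d4, map_mul, map_neg, h1, h2, h3, h4, h5, h6, h7, d4_sort12, d4_sort23,
    d4_sort34, Nat.reduceLT] <;>
  ring

theorem AG_rho21_cr_d_snd : AG (rho 2 / rho 1) (CR 4 8 7 2 6 3) =
    (1 : ℚ) • AG (CR 3 4 2 5 6 7) (CR 6 7 1 3 4 5) := by
  obtain ⟨σ, hs, h1, h2, h3, h4, h5, h6, h7, h8⟩ : ∃ σ : Equiv.Perm (Fin 8),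
      Equiv.Perm.sign σ = 1 ∧ lab σ 1 = 1 ∧ lab σ 2 = 6 ∧ lab σ 3 = 4 ∧ lab σ 4 = 8 ∧
        lab σ 5 = 7 ∧ lab σ 6 = 3 ∧ lab σ 7 = 2 ∧ lab σ 8 = 5 :=
    ⟨Equiv.swap 1 5 * Equiv.swap 5 2 * Equiv.swap 2 3 * Equiv.swap 3 7 * Equiv.swap 7 4 *
      Equiv.swap 4 6,
      by simp [Equiv.Perm.sign_mul], by decide⟩
  refine AG_rel_swap σ ((tri_cr34.map (permAut 8 4 σ)).anh_osub tri_cr_d_snd ?_)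
    ((tri_cr67.map (permAut 8 4 σ)).anh_id tri_rho21 ?_) (by rw [hs]; norm_num) <;>
  simp only [permAut_d4, map_mul, map_neg, h1, h2, h3, h4, h5, h6, h7, d4_sort12, d4_sort23,
    d4_sort34, Nat.reduceLT] <;>
  ring

theorem AG_s36_fst : AG (rr 1 2 * rr 3 4 / (rr 1 4 * rr 3 2)) (rho 1 / rr 1 4) =
    (-1 : ℚ) • AG (rho 4 / rho 1)
      ((1 - rr 4 2 / rr 4 1) / (1 - (rr 4 2 / rr 4 1) * (rr 4 1 / rr 4 3))) := by
  refine AG_rel_swap_id (tri_rho41.anh_inv_osub tri_rho_div_rr ?_)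
    (tri_rr_mid.anh_id tri_rr_fst_arg ?_) (by norm_num) <;>
  ring

theorem AG_rho41_rr_last :
    AG (rho 4 / rho 1) ((1 - rr 4 1 / rr 4 3) / (1 - (rr 4 2 / rr 4 1) * (rr 4 1 / rr 4 3))) =
      (1 : ℚ) • AG (rho 4 / rho 1) (1 - (rr 4 2 / rr 4 1) * (rr 4 1 / rr 4 3)) := by
  obtain ⟨σ, hs, h1, h2, h3, h4, h5, h6, h7, h8⟩ : ∃ σ : Equiv.Perm (Fin 8),
      Equiv.Perm.sign σ = -1 ∧ lab σ 1 = 6 ∧ lab σ 2 = 5 ∧ lab σ 3 = 4 ∧ lab σ 4 = 3 ∧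
        lab σ 5 = 2 ∧ lab σ 6 = 1 ∧ lab σ 7 = 7 ∧ lab σ 8 = 8 :=
    ⟨Equiv.swap 0 5 * Equiv.swap 1 4 * Equiv.swap 2 3,
      by simp [Equiv.Perm.sign_mul], by decide⟩
  refine AG_rel σ ((tri_rho41.map (permAut 8 4 σ)).anh_inv tri_rho41 ?_)
    ((tri_rr_prod.map (permAut 8 4 σ)).anh_osub_inv tri_rr_last ?_) (by rw [hs]; norm_num) <;>
  simp only [permAut_d4, map_mul, map_neg, map_sub, h1, h2, h3, h4, h5, h6, h7, h8, Q4, d4_sort12,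
    d4_sort23, d4_sort34, Nat.reduceLT] <;>
  ring

theorem AG_rho41_cr_a_mid :
    AG (rho 4 / rho 1) ((1 - CR 4 3 2 6 8 5) / (1 - CR 4 3 2 6 8 5 * CR 4 8 7 6 5 3)) =
      (1 : ℚ) • AG (rho 4 / rho 1) (1 - (rr 4 2 / rr 4 1) * (rr 4 1 / rr 4 3)) := by
  obtain ⟨σ, hs, h1, h2, h3, h4, h5, h6, h7, h8⟩ : ∃ σ : Equiv.Perm (Fin 8),
      Equiv.Perm.sign σ = -1 ∧ lab σ 1 = 1 ∧ lab σ 2 = 2 ∧ lab σ 3 = 3 ∧ lab σ 4 = 4 ∧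
        lab σ 5 = 6 ∧ lab σ 6 = 5 ∧ lab σ 7 = 7 ∧ lab σ 8 = 8 :=
    ⟨Equiv.swap 4 5, by simp, by decide⟩
  refine AG_rel σ ((tri_rho41.map (permAut 8 4 σ)).anh_id tri_rho41 ?_)
    ((tri_rr_prod.map (permAut 8 4 σ)).anh_ngo tri_cr_a_mid ?_) (by rw [hs]; norm_num) <;>
  simp only [permAut_d4, map_mul, map_neg, map_sub, h1, h2, h3, h4, h5, h6, h7, h8, Q4, d4_sort12,
    d4_sort23, Nat.reduceLT] <;>
  ring

theorem AG_rho41_cr_a_prod : AG (rho 4 / rho 1) (1 - CR 4 3 2 6 8 5 * CR 4 8 7 6 5 3) =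
    (1 : ℚ) • AG (rho 4 / rho 1) (1 - (rr 4 2 / rr 4 1) * (rr 4 1 / rr 4 3)) := by
  refine AG_rel_id (tri_rho41.anh_id tri_rho41 ?_)
    (tri_rr_prod.anh_osub_inv tri_cr_a_prod ?_) (by norm_num) <;>
  ring

theorem AG_rho41_cr_b_snd : AG (rho 4 / rho 1) (CR 4 3 1 2 6 8) =
    (1 : ℚ) • AG (rho 4 / rho 1) (CR 4 3 2 6 8 5) := by
  obtain ⟨σ, hs, h1, h2, h3, h4, h5, h6, h7, h8⟩ : ∃ σ : Equiv.Perm (Fin 8),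
      Equiv.Perm.sign σ = -1 ∧ lab σ 1 = 5 ∧ lab σ 2 = 6 ∧ lab σ 3 = 4 ∧ lab σ 4 = 3 ∧
        lab σ 5 = 1 ∧ lab σ 6 = 2 ∧ lab σ 7 = 7 ∧ lab σ 8 = 8 :=
    ⟨Equiv.swap 0 4 * Equiv.swap 1 5 * Equiv.swap 2 3,
      by simp [Equiv.Perm.sign_mul], by decide⟩
  refine AG_rel σ ((tri_rho41.map (permAut 8 4 σ)).anh_inv tri_rho41 ?_)
    ((tri_cr_a_fst.map (permAut 8 4 σ)).anh_inv_osub tri_cr_b_snd ?_) (by rw [hs]; norm_num) <;>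
  simp only [permAut_d4, map_mul, h1, h2, h3, h4, h5, h6, h7, h8, d4_sort12, d4_sort23, d4_sort34,
    Nat.reduceLT] <;>
  ring

theorem AG_rho41_cr_b_mid :
    AG (rho 4 / rho 1) ((1 - CR 4 3 1 2 5 6) / (1 - CR 4 3 1 2 5 6 * CR 4 3 1 2 6 8)) =
      (1 : ℚ) • AG (rho 4 / rho 1) (CR 4 3 2 6 8 5) := by
  obtain ⟨σ, hs, h1, h2, h3, h4, h5, h6, h7, h8⟩ : ∃ σ : Equiv.Perm (Fin 8),
      Equiv.Perm.sign σ = -1 ∧ lab σ 1 = 2 ∧ lab σ 2 = 1 ∧ lab σ 3 = 3 ∧ lab σ 4 = 4 ∧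
        lab σ 5 = 5 ∧ lab σ 6 = 6 ∧ lab σ 7 = 7 ∧ lab σ 8 = 8 :=
    ⟨Equiv.swap 0 1, by simp, by decide⟩
  refine AG_rel σ ((tri_rho41.map (permAut 8 4 σ)).anh_id tri_rho41 ?_)
    ((tri_cr_a_fst.map (permAut 8 4 σ)).anh_ngo tri_cr_b_mid ?_) (by rw [hs]; norm_num) <;>
  simp only [permAut_d4, map_mul, map_neg, h1, h2, h3, h4, h5, h6, h7, h8, d4_sort12,
    Nat.reduceLT] <;>
  ring

theorem AG_rho41_cr_b_prod : AG (rho 4 / rho 1) (1 - CR 4 3 1 2 5 6 * CR 4 3 1 2 6 8) =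
    (1 : ℚ) • AG (rho 4 / rho 1) (CR 4 3 2 6 8 5) := by
  obtain ⟨σ, hs, h1, h2, h3, h4, h5, h6, h7, h8⟩ : ∃ σ : Equiv.Perm (Fin 8),
      Equiv.Perm.sign σ = 1 ∧ lab σ 1 = 6 ∧ lab σ 2 = 5 ∧ lab σ 3 = 4 ∧ lab σ 4 = 3 ∧
        lab σ 5 = 1 ∧ lab σ 6 = 2 ∧ lab σ 7 = 7 ∧ lab σ 8 = 8 :=
    ⟨Equiv.swap 0 5 * Equiv.swap 5 1 * Equiv.swap 1 4 * Equiv.swap 2 3,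
      by simp [Equiv.Perm.sign_mul], by decide⟩
  refine AG_rel σ ((tri_rho41.map (permAut 8 4 σ)).anh_inv tri_rho41 ?_)
    ((tri_cr_a_fst.map (permAut 8 4 σ)).anh_ngo tri_cr_b_prod ?_) (by rw [hs]; norm_num) <;>
  simp only [permAut_d4, map_mul, map_neg, h1, h2, h3, h4, h5, h6, h7, h8, d4_sort12, d4_sort23,
    d4_sort34, Nat.reduceLT] <;>
  ring

theorem AG_rho41_cr_b_last :
    AG (rho 4 / rho 1) ((1 - CR 4 3 1 2 6 8) / (1 - CR 4 3 1 2 5 6 * CR 4 3 1 2 6 8)) =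
      (1 : ℚ) • AG (rho 4 / rho 1) (CR 4 3 2 6 8 5) := by
  refine AG_rel_id (tri_rho41.anh_id tri_rho41 ?_)
    (tri_cr_a_fst.anh_inv_osub tri_cr_b_last ?_) (by norm_num) <;>
  ring

theorem AG_rho41_cr_c_snd : AG (rho 4 / rho 1) (CR 4 2 1 3 6 5) =
    (1 : ℚ) • AG (rho 4 / rho 1) (CR 4 3 1 2 5 6) := by
  obtain ⟨σ, hs, h1, h2, h3, h4, h5, h6, h7, h8⟩ : ∃ σ : Equiv.Perm (Fin 8),
      Equiv.Perm.sign σ = -1 ∧ lab σ 1 = 1 ∧ lab σ 2 = 3 ∧ lab σ 3 = 2 ∧ lab σ 4 = 4 ∧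
        lab σ 5 = 5 ∧ lab σ 6 = 6 ∧ lab σ 7 = 7 ∧ lab σ 8 = 8 :=
    ⟨Equiv.swap 1 2, by simp, by decide⟩
  refine AG_rel σ ((tri_rho41.map (permAut 8 4 σ)).anh_id tri_rho41 ?_)
    ((tri_cr_b_fst.map (permAut 8 4 σ)).anh_inv tri_cr_c_snd ?_) (by rw [hs]; norm_num) <;>
  simp only [permAut_d4, map_mul, h1, h2, h3, h4, h5, h6, h7, h8, d4_sort12, d4_sort23,
    Nat.reduceLT] <;>
  ring

theorem AG_rho41_cr_c_prod : AG (rho 4 / rho 1) (1 - CR 4 3 1 2 5 6 * CR 4 2 1 3 6 5) =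
    (1 : ℚ) • AG (rho 4 / rho 1) (CR 4 3 1 2 5 6) := by
  obtain ⟨σ, hs, h1, h2, h3, h4, h5, h6, h7, h8⟩ : ∃ σ : Equiv.Perm (Fin 8),
      Equiv.Perm.sign σ = 1 ∧ lab σ 1 = 2 ∧ lab σ 2 = 3 ∧ lab σ 3 = 1 ∧ lab σ 4 = 4 ∧
        lab σ 5 = 5 ∧ lab σ 6 = 6 ∧ lab σ 7 = 7 ∧ lab σ 8 = 8 :=
    ⟨Equiv.swap 0 1 * Equiv.swap 1 2,
      by simp [Equiv.Perm.sign_mul], by decide⟩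
  refine AG_rel σ ((tri_rho41.map (permAut 8 4 σ)).anh_id tri_rho41 ?_)
    ((tri_cr_b_fst.map (permAut 8 4 σ)).anh_osub_inv tri_cr_c_prod ?_) (by rw [hs]; norm_num) <;>
  simp only [permAut_d4, map_mul, map_neg, h1, h2, h3, h4, h5, h6, h7, h8, d4_sort12, d4_sort23,
    Nat.reduceLT] <;>
  ring

theorem AG_rho21_cr_e_snd : AG (rho 2 / rho 1) (CR 4 3 2 5 6 8) =
    (1 : ℚ) • AG (rho 2 / rho 1) (CR 4 3 2 6 8 5) := by
  obtain ⟨σ, hs, h1, h2, h3, h4, h5, h6, h7, h8⟩ : ∃ σ : Equiv.Perm (Fin 8),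
      Equiv.Perm.sign σ = -1 ∧ lab σ 1 = 5 ∧ lab σ 2 = 4 ∧ lab σ 3 = 3 ∧ lab σ 4 = 2 ∧
        lab σ 5 = 1 ∧ lab σ 6 = 7 ∧ lab σ 7 = 6 ∧ lab σ 8 = 8 :=
    ⟨Equiv.swap 0 4 * Equiv.swap 1 3 * Equiv.swap 5 6,
      by simp [Equiv.Perm.sign_mul], by decide⟩
  refine AG_rel_swap σ ((tri_rho21.map (permAut 8 4 σ)).anh_id tri_cr_e_snd ?_)
    ((tri_cr_a_fst.map (permAut 8 4 σ)).anh_osub_inv tri_rho21 ?_) (by rw [hs]; norm_num) <;>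
  simp only [permAut_d4, map_mul, map_neg, h1, h2, h3, h4, h5, h6, h7, h8, d4_sort12, d4_sort23,
    Nat.reduceLT] <;>
  ring

theorem AG_rho21_cr_e_mid :
    AG (rho 2 / rho 1) ((1 - CR 4 6 5 2 3 8) / (1 - CR 4 6 5 2 3 8 * CR 4 3 2 5 6 8)) =
      (1 : ℚ) • AG (rho 2 / rho 1) (CR 4 3 2 6 8 5) := by
  obtain ⟨σ, hs, h1, h2, h3, h4, h5, h6, h7, h8⟩ : ∃ σ : Equiv.Perm (Fin 8),
      Equiv.Perm.sign σ = 1 ∧ lab σ 1 = 5 ∧ lab σ 2 = 4 ∧ lab σ 3 = 2 ∧ lab σ 4 = 3 ∧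
        lab σ 5 = 1 ∧ lab σ 6 = 7 ∧ lab σ 7 = 6 ∧ lab σ 8 = 8 :=
    ⟨Equiv.swap 0 4 * Equiv.swap 1 3 * Equiv.swap 3 2 * Equiv.swap 5 6,
      by simp [Equiv.Perm.sign_mul], by decide⟩
  refine AG_rel_swap σ ((tri_rho21.map (permAut 8 4 σ)).anh_inv tri_cr_e_mid ?_)
    ((tri_cr_a_fst.map (permAut 8 4 σ)).anh_osub_inv tri_rho21 ?_) (by rw [hs]; norm_num) <;>
  simp only [permAut_d4, map_mul, map_neg, h1, h2, h3, h4, h5, h6, h7, h8, d4_sort12, d4_sort23,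
    Nat.reduceLT] <;>
  ring

theorem AG_rho21_cr_d_prod : AG (rho 2 / rho 1) (1 - CR 4 8 7 2 3 5 * CR 4 8 7 2 6 3) =
    (1 : ℚ) • AG (rho 2 / rho 1) (CR 4 8 7 6 5 3) := by
  obtain ⟨σ, hs, h1, h2, h3, h4, h5, h6, h7, h8⟩ : ∃ σ : Equiv.Perm (Fin 8),
      Equiv.Perm.sign σ = -1 ∧ lab σ 1 = 1 ∧ lab σ 2 = 3 ∧ lab σ 3 = 2 ∧ lab σ 4 = 4 ∧
        lab σ 5 = 5 ∧ lab σ 6 = 6 ∧ lab σ 7 = 7 ∧ lab σ 8 = 8 :=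
    ⟨Equiv.swap 1 2, by simp, by decide⟩
  refine AG_rel σ ((tri_rho21.map (permAut 8 4 σ)).anh_id tri_rho21 ?_)
    ((tri_cr_a_snd.map (permAut 8 4 σ)).anh_inv tri_cr_d_prod ?_) (by rw [hs]; norm_num) <;>
  simp only [permAut_d4, map_mul, h1, h2, h3, h4, h5, h6, h7, h8, d4_sort12, d4_sort23,
    Nat.reduceLT]
  ring

theorem AG_rho21_cr_d_last :
    AG (rho 2 / rho 1) ((1 - CR 4 8 7 2 6 3) / (1 - CR 4 8 7 2 3 5 * CR 4 8 7 2 6 3)) =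
      (1 : ℚ) • AG (rho 2 / rho 1) (CR 4 8 7 6 5 3) := by
  refine AG_rel_id (tri_rho21.anh_id tri_rho21 ?_)
    (tri_cr_a_snd.anh_id tri_cr_d_last ?_) (by norm_num) <;>
  ring

theorem AG_rho21_cr_e_fst : AG (rho 2 / rho 1) (CR 4 6 5 2 3 8) =
    (-1 : ℚ) • AG (rho 2 / rho 1) (CR 4 8 7 6 5 3) := by
  obtain ⟨σ, hs, h1, h2, h3, h4, h5, h6, h7, h8⟩ : ∃ σ : Equiv.Perm (Fin 8),
      Equiv.Perm.sign σ = 1 ∧ lab σ 1 = 5 ∧ lab σ 2 = 6 ∧ lab σ 3 = 4 ∧ lab σ 4 = 2 ∧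
        lab σ 5 = 1 ∧ lab σ 6 = 7 ∧ lab σ 7 = 8 ∧ lab σ 8 = 3 :=
    ⟨Equiv.swap 0 4 * Equiv.swap 1 5 * Equiv.swap 5 6 * Equiv.swap 6 7 * Equiv.swap 7 2 *
      Equiv.swap 2 3,
      by simp [Equiv.Perm.sign_mul], by decide⟩
  refine AG_rel_swap σ ((tri_rho21.map (permAut 8 4 σ)).anh_id tri_cr_e_fst ?_)
    ((tri_cr_a_snd.map (permAut 8 4 σ)).anh_id tri_rho21 ?_) (by rw [hs]; norm_num) <;>
  simp only [permAut_d4, map_mul, h1, h2, h3, h4, h5, h6, h7, h8, d4_sort12, d4_sort23, d4_sort34,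
    Nat.reduceLT] <;>
  ring

theorem AG_rho21_cr_e_last :
    AG (rho 2 / rho 1) ((1 - CR 4 3 2 5 6 8) / (1 - CR 4 6 5 2 3 8 * CR 4 3 2 5 6 8)) =
      (-1 : ℚ) • AG (rho 2 / rho 1) (CR 4 8 7 6 5 3) := by
  obtain ⟨σ, hs, h1, h2, h3, h4, h5, h6, h7, h8⟩ : ∃ σ : Equiv.Perm (Fin 8),
      Equiv.Perm.sign σ = -1 ∧ lab σ 1 = 6 ∧ lab σ 2 = 5 ∧ lab σ 3 = 4 ∧ lab σ 4 = 2 ∧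
        lab σ 5 = 1 ∧ lab σ 6 = 7 ∧ lab σ 7 = 8 ∧ lab σ 8 = 3 :=
    ⟨Equiv.swap 0 5 * Equiv.swap 5 6 * Equiv.swap 6 7 * Equiv.swap 7 2 * Equiv.swap 2 3 *
      Equiv.swap 3 1 * Equiv.swap 1 4,
      by simp [Equiv.Perm.sign_mul], by decide⟩
  refine AG_rel_swap σ ((tri_rho21.map (permAut 8 4 σ)).anh_inv tri_cr_e_last ?_)
    ((tri_cr_a_snd.map (permAut 8 4 σ)).anh_id tri_rho21 ?_) (by rw [hs]; norm_num) <;>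
  simp only [permAut_d4, map_mul, h1, h2, h3, h4, h5, h6, h7, h8, d4_sort12, d4_sort23, d4_sort34,
    Nat.reduceLT] <;>
  ring

theorem AG_rho21_cr_a_prod :
    AG (rho 2 / rho 1) (1 - CR 4 3 2 6 8 5 * CR 4 8 7 6 5 3) =
      (1 : ℚ) •
        AG (rho 2 / rho 1) ((1 - CR 4 3 2 6 8 5) / (1 - CR 4 3 2 6 8 5 * CR 4 8 7 6 5 3)) := by
  obtain ⟨σ, hs, h1, h2, h3, h4, h5, h6, h7, h8⟩ : ∃ σ : Equiv.Perm (Fin 8),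
      Equiv.Perm.sign σ = -1 ∧ lab σ 1 = 1 ∧ lab σ 2 = 2 ∧ lab σ 3 = 3 ∧ lab σ 4 = 4 ∧
        lab σ 5 = 6 ∧ lab σ 6 = 5 ∧ lab σ 7 = 7 ∧ lab σ 8 = 8 :=
    ⟨Equiv.swap 4 5, by simp, by decide⟩
  refine AG_rel σ ((tri_rho21.map (permAut 8 4 σ)).anh_id tri_rho21 ?_)
    ((tri_cr_a_mid.map (permAut 8 4 σ)).anh_inv tri_cr_a_prod ?_) (by rw [hs]; norm_num) <;>
  simp only [permAut_d4, map_mul, map_neg, map_sub, h1, h2, h3, h4, h5, h6, h7, h8, Q4, d4_sort12,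
    d4_sort23, Nat.reduceLT]
  ring

theorem AG_s36_snd :
    AG (rr 1 2 / rho 1) (rr 3 2 / rr 3 4) =
      (-1 : ℚ) •
        AG (rho 2 / rho 1) ((1 - CR 4 3 2 6 8 5) / (1 - CR 4 3 2 6 8 5 * CR 4 8 7 6 5 3)) := by
  obtain ⟨σ, hs, h1, h2, h3, h4, h5, h6, h7, h8⟩ : ∃ σ : Equiv.Perm (Fin 8),
      Equiv.Perm.sign σ = -1 ∧ lab σ 1 = 1 ∧ lab σ 2 = 2 ∧ lab σ 3 = 3 ∧ lab σ 4 = 4 ∧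
        lab σ 5 = 6 ∧ lab σ 6 = 5 ∧ lab σ 7 = 7 ∧ lab σ 8 = 8 :=
    ⟨Equiv.swap 4 5, by simp, by decide⟩
  refine AG_rel σ ((tri_rho21.map (permAut 8 4 σ)).anh_osub tri_rr_div_rho ?_)
    ((tri_cr_a_mid.map (permAut 8 4 σ)).anh_ngo tri_rr_div_rr ?_) (by rw [hs]; norm_num) <;>
  simp only [permAut_d4, map_mul, h1, h2, h3, h4, h5, h6, h7, h8, d4_sort23, d4_sort34,
    Nat.reduceLT]
  ring

end GrassPoly

namespace GrassPoly

theorem AP_Vc {N m : ℕ} (z x y : FF N m) :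
    AP N m (Vc z x y) = AG z x + AG z y + AG z ((1 - x) / (1 - x * y)) + AG z (1 - x * y)
      + AG z ((1 - y) / (1 - x * y)) := by
  rw [Vc, map_add, map_add, map_add, map_add]
  rfl

theorem AP_S36 {N m : ℕ} (a b : FF N m) :
    AP N m (S36 a b) = AP N m (SI31 a b) - AG a b := by
  rw [S36, map_sub]
  rfl

theorem AP_combination {N m : ℕ} (a b c d e g h i j k : TP (FF N m) 4) :
    AP N m (-(a - b + (4 : ℚ)⁻¹ • c - (12 : ℚ)⁻¹ • d) + (-e + g + (2 : ℚ)⁻¹ • h) + i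
        + (2 : ℚ) • j + (6 : ℚ) • k) =
      -(AP N m a - AP N m b + (4 : ℚ)⁻¹ • AP N m c - (12 : ℚ)⁻¹ • AP N m d)
        + (-AP N m e + AP N m g + (2 : ℚ)⁻¹ • AP N m h) + AP N m i
        + (2 : ℚ) • AP N m j + (6 : ℚ) • AP N m k := by
  simp only [map_add, map_sub, map_neg, map_smul]

/-- All the `Ĩ_{3,1}` terms of the formula cancel after skew-symmetrization. -/
theorem alt_tI31_cancel :
    AP 8 4 (
        -(Vc (rho 4 / rho 1) (rr 4 2 / rr 4 1) (rr 4 1 / rr 4 3)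
          - Vc (rho 4 / rho 1) (CR 4 3 2 6 8 5) (CR 4 8 7 6 5 3)
          + (4 : ℚ)⁻¹ • Vc (rho 4 / rho 1) (CR 4 3 1 2 5 6) (CR 4 3 1 2 6 8)
          - (12 : ℚ)⁻¹ • Vc (rho 4 / rho 1) (CR 4 3 1 2 5 6) (CR 4 2 1 3 6 5))
        + (- Vc (rho 2 / rho 1) (CR 4 3 2 6 8 5) (CR 4 8 7 6 5 3)
          + Vc (rho 2 / rho 1) (CR 4 8 7 2 3 5) (CR 4 8 7 2 6 3)
          + (2 : ℚ)⁻¹ • Vc (rho 2 / rho 1) (CR 4 6 5 2 3 8) (CR 4 3 2 5 6 8))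
        + S36 (rr 1 2 * rr 3 4 / (rr 1 4 * rr 3 2)) (rho 1 / rr 1 4)
        + (2 : ℚ) • S36 (rr 1 2 / rho 1) (rr 3 2 / rr 3 4)
        + (6 : ℚ) • SLi4 (rho 1 * rr 3 2 / (rr 1 2 * rr 3 4))) =
      AP 8 4 (SI31 (rr 1 2 * rr 3 4 / (rr 1 4 * rr 3 2)) (rho 1 / rr 1 4))
        + (2 : ℚ) • AP 8 4 (SI31 (rr 1 2 / rho 1) (rr 3 2 / rr 3 4))
        + (6 : ℚ) • AP 8 4 (SLi4 (rho 1 * rr 3 2 / (rr 1 2 * rr 3 4)))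
        + (2 : ℚ) • AG (CR 3 4 2 5 6 7) (CR 6 7 1 3 4 5) := by
  rw [AP_combination]
  simp only [AP_Vc, AP_S36]
  rw [AG_rho41_rr_fst, AG_rho41_rr_snd, AG_rho41_cr_a_snd, AG_rho41_cr_a_last,
    AG_rho41_cr_c_mid, AG_rho41_cr_c_last, AG_rho21_cr_a_last, AG_rho21_cr_d_mid,
    AG_rho21_cr_e_prod, AG_rho21_cr_d_fst, AG_rho21_cr_d_snd, AG_s36_fst, AG_rho41_rr_last,
    AG_rho41_cr_a_mid, AG_rho41_cr_a_prod, AG_rho41_cr_b_snd, AG_rho41_cr_b_mid,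
    AG_rho41_cr_b_prod, AG_rho41_cr_b_last, AG_rho41_cr_c_snd,
    AG_rho41_cr_c_prod, AG_rho21_cr_e_snd, AG_rho21_cr_e_mid, AG_rho21_cr_d_prod,
    AG_rho21_cr_d_last, AG_rho21_cr_e_fst, AG_rho21_cr_e_last, AG_s36_snd, AG_rho21_cr_a_prod]
  module

end GrassPoly

namespace GrassPoly

namespace Word

/-- Insertion of `a` into a list of numbers, in front of the first entry `≥ a`. -/
def ins (a : ℕ) : List ℕ → List ℕ
  | [] => [a]
  | b :: l => bif Nat.ble a b then a :: b :: l else b :: ins a l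

/-- The parity of the number of entries passed in `ins`. -/
def insOdd (a : ℕ) : List ℕ → Bool
  | [] => false
  | b :: l => bif Nat.ble a b then false else !insOdd a l

/-- Insertion sort. -/
def sort : List ℕ → List ℕ
  | [] => []
  | a :: l => ins a (sort l)

/-- The parity of the permutation performed by `sort`. -/
def sortOdd : List ℕ → Bool
  | [] => false
  | a :: l => bif insOdd a (sort l) then !sortOdd l else sortOdd l

/-- Whether two neighbouring entries agree. -/
def hasDup : List ℕ → Bool
  | [] => false
  | a :: l => match l with
    | [] => false
    | b :: _ => Nat.beq a b || hasDup l

/-- Lexicographic comparison. -/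
def compare : List ℕ → List ℕ → Ordering
  | [], [] => .eq
  | [], _ :: _ => .lt
  | _ :: _, [] => .gt
  | a :: l, b :: k => bif Nat.beq a b then compare l k else bif Nat.ble a b then .lt else .gt

/-- Formal combinations of words with integer coefficients. -/
abbrev Comb := List (List ℕ × ℤ)

/-- Put a term in front of a combination, unless its coefficient vanishes. -/
def cons (w : List ℕ) (v : ℤ) (c : Comb) : Comb :=
  bif Nat.beq v.natAbs 0 then c else (w, v) :: c

/-- Auxiliary step of `merge`: the head `a` of the first list and the function merging its tail. -/
def mergeStep (a : List ℕ × ℤ) (tail : Comb → Comb) : Comb → Comb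
  | [] => a :: tail []
  | b :: l => match compare a.1 b.1 with
    | .lt => a :: tail (b :: l)
    | .gt => b :: mergeStep a tail l
    | .eq => cons a.1 (a.2 + b.2) (tail l)

/-- The sum of two combinations. -/
def merge : Comb → Comb → Comb
  | [] => id
  | a :: l => mergeStep a (merge l)

/-- The normal form of `v` times an alternating word. -/
def single (w : List ℕ) (v : ℤ) : Comb :=
  bif hasDup (sort w) then [] else [(sort w, bif sortOdd w then -v else v)]

/-- Prefix the letters of the columns `p` to those of `q`. -/
def pack (p q : List ℕ) : List ℕ := List.zipWith (fun a b => 16 * a + b) p q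

/-- The normal form of `v • p ⊗ L₁ ⊗ ⋯ ⊗ Lₖ`. -/
def expand : List Comb → List ℕ → ℤ → Comb
  | [], p, v => single p v
  | L :: Ls, p, v => L.foldr (fun q c => merge (expand Ls (pack p q.1) (v * q.2)) c) []

/-- Merge neighbouring combinations. -/
def pairUp : List Comb → List Comb
  | a :: b :: l => merge a b :: pairUp l
  | l => l

/-- The sum of a list of combinations, after `n` rounds of pairwise merging. -/
def mergeAll : ℕ → List Comb → Comb
  | 0, l => l.foldr merge []
  | n + 1, l => mergeAll n (pairUp l)

/-- The `j`-th hexadecimal digit. -/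
def dig (j x : ℕ) : ℕ := x / 16 ^ j % 16

/-- The column with the digits of `x` at the places `a`, `b`, `c`, `d`. -/
def permute (a b c d x : ℕ) : ℕ := 16 * (16 * (16 * dig a x + dig b x) + dig c x) + dig d x

/-- The normal forms of the terms of `Π̃₄` applied to `v` times the word `w`. -/
def pit (w : List ℕ) (v : ℤ) : List Comb :=
  [single w v, single (w.map (permute 2 3 1 0)) (-v), single (w.map (permute 2 1 3 0)) (-v),
    single (w.map (permute 1 2 3 0)) v, single (w.map (permute 2 1 0 3)) (-v),
    single (w.map (permute 1 2 0 3)) v, single (w.map (permute 1 0 2 3)) v,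
    single (w.map (permute 0 1 2 3)) (-v)]

section Eval

variable {W : Type*} [AddCommGroup W] [Module ℚ W]

/-- Functions on words that change sign when two neighbouring columns are exchanged. -/
def IsAlternating (f : List ℕ → W) : Prop :=
  ∀ pre a b suf, f (pre ++ a :: b :: suf) = -f (pre ++ b :: a :: suf)

/-- The linear extension of `f` to combinations of words. -/
def eval (f : List ℕ → W) (c : Comb) : W := (c.map fun p => (p.2 : ℚ) • f p.1).sum

/-- The sign attached to a parity. -/
def sg (b : Bool) : ℚ := bif b then -1 else 1

variable {f : List ℕ → W}

theorem IsAlternating.ins (hf : IsAlternating f) (pre : List ℕ) (a : ℕ) (l : List ℕ) :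
    f (pre ++ a :: l) = sg (insOdd a l) • f (pre ++ Word.ins a l) := by
  induction l generalizing pre with
  | nil => simp [Word.ins, insOdd, sg]
  | cons b l ih =>
    cases h : Nat.ble a b with
    | true => simp [Word.ins, insOdd, h, sg]
    | false =>
      have e := ih (pre ++ [b])
      rw [List.append_assoc, List.append_assoc, List.singleton_append, List.singleton_append] at e
      rw [hf, e]
      cases h' : insOdd a l <;> simp [Word.ins, insOdd, h, h', sg]

theorem IsAlternating.sort (hf : IsAlternating f) (pre l : List ℕ) :
    f (pre ++ l) = sg (sortOdd l) • f (pre ++ Word.sort l) := by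
  induction l generalizing pre with
  | nil => simp [Word.sort, sortOdd, sg]
  | cons a l ih =>
    have e := ih (pre ++ [a])
    rw [List.append_assoc, List.append_assoc, List.singleton_append, List.singleton_append] at e
    rw [e, hf.ins pre a (Word.sort l), smul_smul]
    cases h : sortOdd l <;> cases h' : insOdd a (Word.sort l) <;>
      simp [Word.sort, sortOdd, h, h', sg]

theorem IsAlternating.eq_zero (hf : IsAlternating f) (pre l : List ℕ) (h : hasDup l = true) :
    f (pre ++ l) = 0 := by
  induction l generalizing pre with
  | nil => simp [hasDup] at h
  | cons a l ih =>
    cases l with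
    | nil => simp [hasDup] at h
    | cons b l =>
      have h2 : Nat.beq a b = true ∨ hasDup (b :: l) = true := by
        simpa only [hasDup, Bool.or_eq_true] using h
      rcases h2 with h2 | h2
      · obtain rfl := Nat.eq_of_beq_eq_true h2
        have e := hf pre a a l
        have e2 : (2 : ℚ) • f (pre ++ a :: a :: l) = 0 := by
          rw [two_smul]
          nth_rewrite 1 [e]
          exact neg_add_cancel _
        exact (smul_eq_zero.mp e2).resolve_left two_ne_zero
      · simpa using ih (pre ++ [a]) h2

theorem eval_single (hf : IsAlternating f) (w : List ℕ) (v : ℤ) :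
    eval f (single w v) = (v : ℚ) • f w := by
  have e := hf.sort [] w
  rw [List.nil_append, List.nil_append] at e
  rw [e]
  cases h : hasDup (Word.sort w) with
  | true =>
    have := hf.eq_zero [] _ h
    rw [List.nil_append] at this
    simp [single, h, eval, this]
  | false => cases h' : sortOdd w <;> simp [single, h, h', eval, sg]

theorem eval_nil : eval f [] = 0 := rfl

theorem eval_list_cons (a : List ℕ × ℤ) (c : Comb) :
    eval f (a :: c) = (a.2 : ℚ) • f a.1 + eval f c := by
  simp [eval]

theorem eval_cons (w : List ℕ) (v : ℤ) (c : Comb) :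
    eval f (cons w v c) = (v : ℚ) • f w + eval f c := by
  cases h : Nat.beq v.natAbs 0 with
  | true =>
    have : v = 0 := by simpa using Nat.eq_of_beq_eq_true h
    simp [cons, this]
  | false => simp [cons, h, eval]

theorem eq_of_compare_eq {l k : List ℕ} (h : compare l k = .eq) : l = k := by
  induction l generalizing k with
  | nil => cases k <;> simp_all [compare]
  | cons a l ih =>
    cases k with
    | nil => simp [compare] at h
    | cons b k =>
      cases hab : Nat.beq a b with
      | true =>
        rw [compare, hab] at h
        rw [Nat.eq_of_beq_eq_true hab, ih h]
      | false =>
        rw [compare, hab] at h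
        cases h' : Nat.ble a b <;> simp [h'] at h

theorem eval_mergeStep (a : List ℕ × ℤ) (s : W) (tail : Comb → Comb)
    (h : ∀ c, eval f (tail c) = s + eval f c) (c : Comb) :
    eval f (mergeStep a tail c) = (a.2 : ℚ) • f a.1 + s + eval f c := by
  induction c with
  | nil => rw [mergeStep, eval_list_cons, h, add_assoc]
  | cons b c ih =>
    rw [mergeStep]
    cases hc : compare a.1 b.1 with
    | lt => simp only [eval_list_cons, h, add_assoc]
    | gt =>
      simp only [eval_list_cons, ih]
      abel
    | eq =>
      simp only [eval_cons, h, eval_list_cons, ← eq_of_compare_eq hc, Int.cast_add, add_smul]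
      abel

theorem eval_merge (c d : Comb) : eval f (merge c d) = eval f c + eval f d := by
  induction c generalizing d with
  | nil => simp [merge, eval_nil]
  | cons a c ih => rw [merge, eval_mergeStep a (eval f c) _ ih, eval_list_cons]

theorem eval_foldr_merge (l : List Comb) :
    eval f (l.foldr merge []) = (l.map (eval f)).sum := by
  induction l with
  | nil => rfl
  | cons a l ih => rw [List.foldr_cons, eval_merge, ih, List.map_cons, List.sum_cons]

theorem sum_eval_pairUp (l : List Comb) :
    ((pairUp l).map (eval f)).sum = (l.map (eval f)).sum := by
  induction l using pairUp.induct with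
  | case1 a b l ih => simp [pairUp, ih, eval_merge, add_assoc]
  | case2 l h => rw [pairUp.eq_2 l h]

theorem eval_mergeAll (n : ℕ) (l : List Comb) :
    eval f (mergeAll n l) = (l.map (eval f)).sum := by
  induction n generalizing l with
  | zero => exact eval_foldr_merge l
  | succ n ih => rw [mergeAll, ih, sum_eval_pairUp]

/-- The value of `p ⊗ L₁ ⊗ ⋯ ⊗ Lₖ`. -/
def tens (f : List ℕ → W) : List Comb → List ℕ → W
  | [], p => f p
  | L :: Ls, p => (L.map fun q => (q.2 : ℚ) • tens f Ls (pack p q.1)).sum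

theorem eval_expand (hf : IsAlternating f) (Ls : List Comb) (p : List ℕ) (v : ℤ) :
    eval f (expand Ls p v) = (v : ℚ) • tens f Ls p := by
  induction Ls generalizing p v with
  | nil => exact eval_single hf p v
  | cons L Ls ih =>
    rw [expand, tens]
    induction L with
    | nil => simp [eval_nil]
    | cons q L ihL =>
      rw [List.foldr_cons, eval_merge, ih, ihL, List.map_cons, List.sum_cons, smul_add,
        smul_smul, Int.cast_mul]

end Eval

section Value

variable {V W : Type*} [AddCommGroup V] [Module ℚ V] [AddCommGroup W] [Module ℚ W]

/-- The value of a word, given the values of the letters. -/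
def value (M : V →ₗ[ℚ] V →ₗ[ℚ] V →ₗ[ℚ] V →ₗ[ℚ] W) (lc : List ℕ → V) (w : List ℕ) : W :=
  if w.length = 8 then
    M (lc (w.map (dig 3))) (lc (w.map (dig 2))) (lc (w.map (dig 1))) (lc (w.map (dig 0)))
  else 0

/-- Colourings of the eight vectors by hexadecimal digits. -/
def IsLetter (a : List ℕ) : Prop := a.length = 8 ∧ ∀ x ∈ a, x < 16

variable {M M' : V →ₗ[ℚ] V →ₗ[ℚ] V →ₗ[ℚ] V →ₗ[ℚ] W} {lc : List ℕ → V}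

theorem dig_three {p q r s : ℕ} (hp : p < 16) (hq : q < 16) (hr : r < 16) (hs : s < 16) :
    dig 3 (16 * (16 * (16 * p + q) + r) + s) = p := by
  simp only [dig]; omega

theorem dig_two {p q r s : ℕ} (hq : q < 16) (hr : r < 16) (hs : s < 16) :
    dig 2 (16 * (16 * (16 * p + q) + r) + s) = q := by
  simp only [dig]; omega

theorem dig_one {p q r s : ℕ} (hr : r < 16) (hs : s < 16) :
    dig 1 (16 * (16 * (16 * p + q) + r) + s) = r := by
  simp only [dig]; omega

theorem dig_zero {p q r s : ℕ} (hs : s < 16) :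
    dig 0 (16 * (16 * (16 * p + q) + r) + s) = s := by
  simp only [dig]; omega

theorem dig_lt (j x : ℕ) : dig j x < 16 := Nat.mod_lt _ (by norm_num)

theorem value_permute (a b c d : ℕ) (w : List ℕ) :
    value M lc (w.map (permute a b c d)) = if w.length = 8 then
      M (lc (w.map (dig a))) (lc (w.map (dig b))) (lc (w.map (dig c))) (lc (w.map (dig d)))
    else 0 := by
  simp only [value, List.length_map, List.map_map]
  congr! <;> funext x <;> simp only [Function.comp_apply, permute]
  · exact dig_three (dig_lt _ _) (dig_lt _ _) (dig_lt _ _) (dig_lt _ _)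
  · exact dig_two (dig_lt _ _) (dig_lt _ _) (dig_lt _ _)
  · exact dig_one (dig_lt _ _) (dig_lt _ _)
  · exact dig_zero (dig_lt _ _)

theorem sum_eval_pit (hf : IsAlternating (value M lc))
    (hM : ∀ a b c d, M' a b c d = M a b c d - M b a c d - M b c a d + M c b a d - M b c d a
      + M c b d a + M c d b a - M d c b a) (w : List ℕ) (v : ℤ) :
    ((pit w v).map (eval (value M lc))).sum = (v : ℚ) • value M' lc w := by
  simp only [pit, List.map_cons, List.map_nil, List.sum_cons, List.sum_nil, eval_single hf,
    value_permute]
  by_cases h : w.length = 8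
  · simp only [value, h, if_true, hM]
    module
  · simp [value, h]

theorem eval_flatMap_pit (hf : IsAlternating (value M lc))
    (hM : ∀ a b c d, M' a b c d = M a b c d - M b a c d - M b c a d + M c b a d - M b c d a
      + M c b d a + M c d b a - M d c b a) (c : Comb) :
    ((c.flatMap fun p => pit p.1 p.2).map (eval (value M lc))).sum = eval (value M' lc) c := by
  induction c with
  | nil => rfl
  | cons p c ih =>
    rw [List.flatMap_cons, List.map_append, List.sum_append, ih, sum_eval_pit hf hM,
      eval_list_cons]

/-- The blank word. -/
def blank : List ℕ := [0, 0, 0, 0, 0, 0, 0, 0]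

theorem value_pack {a b e d : List ℕ} (ha : IsLetter a) (hb : IsLetter b) (he : IsLetter e)
    (hd : IsLetter d) :
    value M lc (pack (pack (pack (pack blank a) b) e) d) = M (lc a) (lc b) (lc e) (lc d) := by
  obtain ⟨la, ha⟩ := ha
  obtain ⟨lb, hb⟩ := hb
  obtain ⟨le, he⟩ := he
  obtain ⟨ld, hd⟩ := hd
  have hz : ∀ (i : ℕ) (h : i < blank.length), blank[i] = 0 := by decide
  have l0 : blank.length = 8 := rfl
  have key : ∀ j (l : List ℕ), l.length = 8 → (∀ (i : ℕ) (h : i < 8) (h1 h2 h3 h4 h5),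
      dig j (16 * (16 * (16 * (a[i]'h1) + b[i]'h2) + e[i]'h3) + d[i]'h4) = l[i]'h5) →
      (pack (pack (pack (pack blank a) b) e) d).map (dig j) = l := by
    intro j l hl h
    apply List.ext_getElem
    · simp [pack, la, lb, le, ld, hl, l0]
    · intro i h1 h2
      simp only [pack, List.getElem_map, List.getElem_zipWith, hz, Nat.mul_zero, Nat.zero_add]
      exact h i (hl ▸ h2) _ _ _ _ _
  rw [value, if_pos (by simp [pack, la, lb, le, ld, l0]), key 3 a la, key 2 b lb, key 1 e le,
    key 0 d ld]
  · intro i _ _ _ _ _ _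
    exact dig_zero (hd _ (List.getElem_mem _))
  · intro i _ _ _ _ _ _
    exact dig_one (he _ (List.getElem_mem _)) (hd _ (List.getElem_mem _))
  · intro i _ _ _ _ _ _
    exact dig_two (hb _ (List.getElem_mem _)) (he _ (List.getElem_mem _))
      (hd _ (List.getElem_mem _))
  · intro i _ _ _ _ _ _
    exact dig_three (ha _ (List.getElem_mem _)) (hb _ (List.getElem_mem _))
      (he _ (List.getElem_mem _)) (hd _ (List.getElem_mem _))

/-- All the letters of a combination are colourings. -/
def Letters (L : Comb) : Prop := ∀ q ∈ L, IsLetter q.1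

theorem sum_smul_eq {U : Type*} [AddCommGroup U] [Module ℚ U] {L : Comb} (g : V →ₗ[ℚ] U)
    (F : List ℕ → U) (h : ∀ q ∈ L, F q.1 = g (lc q.1)) :
    (L.map fun q => (q.2 : ℚ) • F q.1).sum = g (eval lc L) := by
  rw [eval, map_list_sum, List.map_map]
  congr 1
  refine List.map_congr_left fun q hq => ?_
  rw [Function.comp_apply, map_smul, h q hq]

theorem tens_eq {L₁ L₂ L₃ L₄ : Comb} (h₁ : Letters L₁) (h₂ : Letters L₂) (h₃ : Letters L₃)
    (h₄ : Letters L₄) :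
    tens (value M lc) [L₁, L₂, L₃, L₄] blank =
      M (eval lc L₁) (eval lc L₂) (eval lc L₃) (eval lc L₄) := by
  refine sum_smul_eq (((M.flip (eval lc L₂)).flip (eval lc L₃)).flip (eval lc L₄))
    (fun a => tens (value M lc) [L₂, L₃, L₄] (pack blank a)) fun a ha => ?_
  refine sum_smul_eq (((M (lc a.1)).flip (eval lc L₃)).flip (eval lc L₄))
    (fun b => tens (value M lc) [L₃, L₄] (pack (pack blank a.1) b)) fun b hb => ?_
  refine sum_smul_eq ((M (lc a.1) (lc b.1)).flip (eval lc L₄))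
    (fun c => tens (value M lc) [L₄] (pack (pack (pack blank a.1) b.1) c)) fun c hc => ?_
  exact sum_smul_eq (M (lc a.1) (lc b.1) (lc c.1))
    (fun d => value M lc (pack (pack (pack (pack blank a.1) b.1) c.1) d)) fun d hd =>
       value_pack (h₁ a ha) (h₂ b hb) (h₃ c hc) (h₄ d hd)

end Value

end Word

end GrassPoly

namespace GrassPoly

namespace Word

/-- Twice the class of `(1 - a) / a` for the first pair of arguments `(a, b)`. -/
def skewFst : Comb :=
  [([9, 5, 5, 8, 6, 6, 7, 7], 1), ([9, 6, 6, 8, 5, 5, 7, 7], 1), ([5, 5, 8, 6, 6, 9, 7, 7], 1),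
    ([6, 6, 8, 5, 5, 9, 7, 7], 1), ([1, 1, 1, 1, 0, 0, 0, 0], -2), ([0, 1, 1, 0, 0, 0, 1, 1], -2),
    ([0, 0, 1, 1, 1, 1, 0, 0], -2), ([0, 0, 0, 1, 1, 0, 1, 1], -2)]

/-- The class of `a` for the first pair of arguments `(a, b)`. -/
def argFst : Comb :=
  [([1, 1, 1, 1, 0, 0, 0, 0], 1), ([0, 1, 1, 0, 0, 0, 1, 1], 1), ([0, 0, 1, 1, 1, 1, 0, 0], 1),
    ([0, 0, 0, 1, 1, 0, 1, 1], 1), ([0, 1, 1, 1, 1, 0, 0, 0], -1), ([0, 0, 1, 1, 0, 0, 1, 1], -1),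
    ([2, 2, 2, 3, 3, 3, 4, 4], -1)]

/-- The class of `1 - b` for the first pair of arguments `(a, b)`. -/
def complFst : Comb :=
  [([1, 1, 1, 0, 0, 0, 0, 1], 1), ([0, 0, 0, 1, 1, 1, 1, 0], 1), ([2, 2, 2, 3, 3, 3, 4, 4], -1)]

/-- The class of `(1 - a) / a` for the second pair of arguments `(a, b)`. -/
def skewSnd : Comb :=
  [([1, 1, 1, 0, 0, 0, 0, 1], 1), ([0, 1, 1, 1, 0, 0, 1, 0], 1), ([1, 1, 1, 1, 0, 0, 0, 0], -1),
    ([0, 1, 1, 0, 0, 0, 1, 1], -1)]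

/-- The class of `a` for the second pair of arguments `(a, b)`. -/
def argSnd : Comb :=
  [([1, 1, 1, 1, 0, 0, 0, 0], 1), ([0, 1, 1, 0, 0, 0, 1, 1], 1), ([1, 1, 1, 0, 0, 0, 1, 0], -1),
    ([0, 1, 1, 1, 0, 0, 0, 1], -1)]

/-- Twice the class of `1 - b` for the second pair of arguments `(a, b)`. -/
def complSnd : Comb :=
  [([0, 0, 1, 1, 1, 0, 0, 1], 2), ([9, 5, 5, 8, 6, 6, 7, 7], 1), ([9, 6, 6, 8, 5, 5, 7, 7], 1),
    ([0, 1, 1, 1, 0, 0, 0, 1], -2), ([0, 0, 1, 1, 1, 1, 0, 0], -2),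
    ([0, 0, 0, 1, 1, 0, 1, 1], -2)]

/-- The class of `a / b` for either pair of arguments `(a, b)`. -/
def ratio : Comb :=
  [([1, 1, 1, 1, 0, 0, 0, 0], 1), ([0, 1, 1, 0, 0, 0, 1, 1], 1), ([0, 0, 1, 1, 1, 1, 0, 0], 1),
    ([0, 0, 0, 1, 1, 0, 1, 1], 1), ([0, 1, 1, 1, 1, 0, 0, 0], -1), ([0, 0, 1, 1, 0, 0, 1, 1], -1),
    ([1, 1, 1, 0, 0, 0, 1, 0], -1), ([0, 0, 0, 1, 1, 1, 0, 1], -1)]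

/-- The four letters of the symbol of `Gr₄`. -/
def gr4Letters : List Comb :=
  [[([1, 1, 1, 1, 0, 0, 0, 0], 1)],
    [([0, 1, 1, 1, 1, 0, 0, 0], 1)],
    [([0, 0, 1, 1, 1, 1, 0, 0], 1)],
    [([0, 0, 0, 1, 1, 1, 1, 0], 1)]]

/-- The normal form of the `I_{3,1}` and `Gr₄` terms of the formula. -/
def total : Comb :=
  mergeAll 4 [expand [skewFst, complFst, ratio, ratio] blank 1,
    expand [skewFst, argFst, complFst, ratio] blank 1,
    expand [skewFst, argFst, argFst, complFst] blank 1,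
    expand [skewFst, argFst, argFst, argFst] blank (-1),
    expand [skewSnd, complSnd, ratio, ratio] blank 2,
    expand [skewSnd, argSnd, complSnd, ratio] blank 2,
    expand [skewSnd, argSnd, argSnd, complSnd] blank 2,
    expand [skewSnd, argSnd, argSnd, argSnd] blank (-4),
    expand gr4Letters blank (-112)]

theorem total_pit_isEmpty :
    (mergeAll 12 (total.flatMap fun p => pit p.1 p.2)).isEmpty = true := by
  decide +kernel

theorem letters_of_all {L : Comb}
    (h : (L.all fun q => q.1.length == 8 && q.1.all fun x => decide (x < 16)) = true) :
    Letters L := by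
  intro q hq
  have := List.all_eq_true.mp h q hq
  simpa [IsLetter] using this

variable {V W : Type*} [AddCommGroup V] [Module ℚ V] [AddCommGroup W] [Module ℚ W]
  {M M' : V →ₗ[ℚ] V →ₗ[ℚ] V →ₗ[ℚ] V →ₗ[ℚ] W} {lc : List ℕ → V}

theorem word_identity (hf : IsAlternating (value M lc)) (hf' : IsAlternating (value M' lc))
    (hM : ∀ a b c d, M' a b c d = M a b c d - M b a c d - M b c a d + M c b a d - M b c d a
      + M c b d a + M c d b a - M d c b a) {u₁ x₁ y₁ u₂ x₂ y₂ r : V}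
    (hu₁ : eval lc skewFst = (2 : ℚ) • u₁) (hx₁ : eval lc argFst = x₁)
    (hy₁ : eval lc complFst = y₁) (hu₂ : eval lc skewSnd = u₂) (hx₂ : eval lc argSnd = x₂)
    (hy₂ : eval lc complSnd = (2 : ℚ) • y₂) (hr : eval lc ratio = r) :
    (M' u₁ y₁ r r + M' u₁ x₁ y₁ r + M' u₁ x₁ x₁ y₁ - M' u₁ x₁ x₁ x₁)
      + (2 : ℚ) • (M' u₂ y₂ r r + M' u₂ x₂ y₂ r + M' u₂ x₂ x₂ y₂ - M' u₂ x₂ x₂ x₂) =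
    (56 : ℚ) • M' (lc [1, 1, 1, 1, 0, 0, 0, 0]) (lc [0, 1, 1, 1, 1, 0, 0, 0])
      (lc [0, 0, 1, 1, 1, 1, 0, 0]) (lc [0, 0, 0, 1, 1, 1, 1, 0]) := by
  have e : eval (value M' lc) total = 0 := by
    rw [← eval_flatMap_pit hf hM, ← eval_mergeAll 12, List.isEmpty_iff.mp total_pit_isEmpty,
      eval_nil]
  have L1 : Letters skewFst := letters_of_all (by decide)
  have L2 : Letters argFst := letters_of_all (by decide)
  have L3 : Letters complFst := letters_of_all (by decide)
  have L4 : Letters skewSnd := letters_of_all (by decide)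
  have L5 : Letters argSnd := letters_of_all (by decide)
  have L6 : Letters complSnd := letters_of_all (by decide)
  have L7 : Letters ratio := letters_of_all (by decide)
  rw [total, eval_mergeAll] at e
  simp only [List.map_cons, List.map_nil, List.sum_cons, List.sum_nil, eval_expand hf', gr4Letters,
    tens_eq L1 L3 L7 L7, tens_eq L1 L2 L3 L7, tens_eq L1 L2 L2 L3, tens_eq L1 L2 L2 L2,
    tens_eq L4 L6 L7 L7, tens_eq L4 L5 L6 L7, tens_eq L4 L5 L5 L6, tens_eq L4 L5 L5 L5,
    hu₁, hx₁, hy₁, hu₂, hx₂, hy₂, hr] at e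
  rw [tens_eq (letters_of_all (by decide)) (letters_of_all (by decide))
    (letters_of_all (by decide)) (letters_of_all (by decide))] at e
  simp only [eval, List.map_cons, List.map_nil, List.sum_cons, List.sum_nil, map_smul,
    LinearMap.smul_apply, Int.cast_one, one_smul, add_zero] at e
  have e' := congrArg ((2 : ℚ)⁻¹ • ·) e
  simp only [smul_zero] at e'
  rw [← sub_eq_zero, ← e']
  push_cast
  module

end Word

end GrassPoly

namespace GrassPoly

theorem vmap_permAut_cls_mul (σ τ : Equiv.Perm (Fin 8)) (x : K4) :
    cls (permAut 8 4 (σ * τ) x) = vmap (permAut 8 4 σ) (cls (permAut 8 4 τ x)) := by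
  rw [vmap_cls, permAut_mul]

/-- The colourings of the three types of letters `⟨1234⟩`, `A4` and `Q4`. -/
def baseColour : Fin 3 → Fin 8 → ℕ :=
  ![![1, 1, 1, 1, 0, 0, 0, 0], ![2, 2, 2, 3, 3, 3, 4, 4], ![9, 5, 5, 8, 6, 6, 7, 7]]

/-- The field elements with the symmetries of the colourings `baseColour`. -/
noncomputable def baseElt : Fin 3 → K4 :=
  ![d4 1 2 3 4, A4 1 2 3 4 5 6 7 8, Q4 4 2 3 5 6 7 8]

theorem cls_permAut_swap_baseElt (k : Fin 3) (x y : Fin 8) (hxy : x < y)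
    (h : baseColour k x = baseColour k y) :
    cls (permAut 8 4 (Equiv.swap x y) (baseElt k)) = cls (baseElt k) := by
  have key : (k, x, y) ∈ ([(0, 0, 1), (0, 0, 2), (0, 0, 3), (0, 1, 2), (0, 1, 3), (0, 2, 3),
      (0, 4, 5), (0, 4, 6), (0, 4, 7), (0, 5, 6), (0, 5, 7), (0, 6, 7), (1, 0, 1), (1, 0, 2),
      (1, 1, 2), (1, 3, 4), (1, 3, 5), (1, 4, 5), (1, 6, 7), (2, 1, 2), (2, 4, 5), (2, 6, 7)] :
      List (Fin 3 × Fin 8 × Fin 8)) := by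
    revert k x y
    decide
  have hl : ∀ a : ℕ, lab (Equiv.swap x y) a =
      if L8 a = x then y.val + 1 else if L8 a = y then x.val + 1 else (L8 a).val + 1 := by
    intro a
    simp only [lab, Equiv.swap_apply_def]
    split_ifs <;> rfl
  have hz : permAut 8 4 (Equiv.swap x y) (baseElt k) = baseElt k ∨
      permAut 8 4 (Equiv.swap x y) (baseElt k) = -baseElt k := by
    simp only [List.mem_cons, Prod.mk.injEq, List.not_mem_nil, or_false] at key
    rcases key with key | key | key | key | key | key | key | key | key | key | key | key | key |
      key | key | key | key | key | key | key | key | key <;>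
    · obtain ⟨rfl, rfl, rfl⟩ := key
      simp only [baseElt, Matrix.cons_val, permAut_d4, permAut_A4, permAut_Q4, hl]
      simp only [L8, Fin.ext_iff, Nat.reduceSub, Nat.reduceMod, Nat.reduceAdd, Fin.isValue,
        Fin.coe_ofNat_eq_mod, Nat.reduceEqDiff, OfNat.ofNat_ne_zero, OfNat.zero_ne_ofNat,
        OfNat.one_ne_ofNat, OfNat.ofNat_ne_one, one_ne_zero, zero_ne_one, if_true, if_false,
        Nat.zero_mod, zero_add, Nat.one_mod]
      try simp only [A4, Q4, d4_sort12, d4_sort23, d4_sort34, Nat.reduceLT]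
      first
      | exact Or.inl trivial
      | exact Or.inr trivial
      | right; ring1
  rcases hz with hz | hz <;> simp [hz]

theorem cls_permAut_baseElt (k : Fin 3) (σ : Equiv.Perm (Fin 8))
    (h : ∀ i, baseColour k (σ i) = baseColour k i) :
    cls (permAut 8 4 σ (baseElt k)) = cls (baseElt k) := by
  induction hn : σ.support.card using Nat.strong_induction_on generalizing σ with
  | _ n ih =>
    by_cases hσ : σ = 1
    · subst hσ
      congr 1
      exact (permAut 8 4 1).injective (permAut_mul 1 1 (baseElt k)).symm
    · obtain ⟨x, hx⟩ : ∃ x, σ x ≠ x := by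
        by_contra! hc
        exact hσ (Equiv.ext hc)
      have e : σ = Equiv.swap x (σ x) * (Equiv.swap x (σ x) * σ) := by
        rw [← mul_assoc, Equiv.swap_mul_self, one_mul]
      have hs : ∀ i, baseColour k (Equiv.swap x (σ x) i) = baseColour k i := by
        intro i
        rw [Equiv.swap_apply_def]
        split_ifs with h1 h2
        · rw [h1, h]
        · rw [h2, h]
        · rfl
      have e2 := ih _ (hn ▸ Equiv.Perm.card_support_swap_mul hx) (Equiv.swap x (σ x) * σ)
        (fun i => by rw [Equiv.Perm.mul_apply, hs, h]) rfl
      rw [e, vmap_permAut_cls_mul, e2, vmap_cls]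
      rcases lt_or_gt_of_ne hx with h1 | h1
      · rw [Equiv.swap_comm]
        exact cls_permAut_swap_baseElt k _ _ h1 (h x)
      · exact cls_permAut_swap_baseElt k _ _ h1 (h x).symm

/-- The class of the letter with a given colouring. -/
noncomputable def colourCls (c : Fin 8 → ℕ) : VF K4 :=
  if h : ∃ p : Fin 3 × Equiv.Perm (Fin 8), ∀ i, c (p.2 i) = baseColour p.1 i then
    cls (permAut 8 4 h.choose.2 (baseElt h.choose.1))
  else 0

theorem colourCls_eq {c : Fin 8 → ℕ} {k : Fin 3} {σ : Equiv.Perm (Fin 8)}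
    (h : ∀ i, c (σ i) = baseColour k i) :
    colourCls c = cls (permAut 8 4 σ (baseElt k)) := by
  have hex : ∃ p : Fin 3 × Equiv.Perm (Fin 8), ∀ i, c (p.2 i) = baseColour p.1 i := ⟨(k, σ), h⟩
  rw [colourCls, dif_pos hex]
  have hp := hex.choose_spec
  generalize hex.choose = p at hp
  obtain ⟨l, τ⟩ := p
  have h2 : ∀ i, baseColour l (τ⁻¹ (σ i)) = baseColour k i := fun i => by
    rw [← hp, ← h]
    simp
  have hkl : l = k := by
    have key : ∀ (l k : Fin 3) (j : Fin 8), baseColour l j = baseColour k 0 → l = k := by decide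
    exact key _ _ _ (h2 0)
  subst hkl
  obtain ⟨υ, rfl⟩ : ∃ υ, σ = τ * υ := ⟨τ⁻¹ * σ, (mul_inv_cancel_left τ σ).symm⟩
  change cls (permAut 8 4 τ (baseElt l)) = cls (permAut 8 4 (τ * υ) (baseElt l))
  rw [vmap_permAut_cls_mul, cls_permAut_baseElt l υ (fun i => by simpa using h2 i), vmap_cls]

theorem colourCls_comp (τ : Equiv.Perm (Fin 8)) (c : Fin 8 → ℕ) :
    colourCls (c ∘ τ) = vmap (permAut 8 4 τ⁻¹) (colourCls c) := by
  by_cases h : ∃ p : Fin 3 × Equiv.Perm (Fin 8), ∀ i, c (p.2 i) = baseColour p.1 i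
  · obtain ⟨⟨k, σ⟩, h⟩ := h
    have h2 : ∀ i, (c ∘ τ) ((τ⁻¹ * σ) i) = baseColour k i := fun i => by
      simp [← h]
    rw [colourCls_eq h, colourCls_eq h2, vmap_permAut_cls_mul]
  · rw [colourCls, colourCls, dif_neg h, dif_neg, map_zero]
    rintro ⟨⟨k, σ⟩, h2⟩
    exact h ⟨(k, τ * σ), h2⟩

/-- The class of the letter with a given list of colours. -/
noncomputable def letterCls (l : List ℕ) : VF K4 := colourCls fun i => l.getD i.val 0

theorem letterCls_swap {pre suf : List ℕ} (a b : ℕ) (h : pre.length + 1 < 8) :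
    letterCls (pre ++ a :: b :: suf) =
      vmap (permAut 8 4 (Equiv.swap ⟨pre.length, by omega⟩ ⟨pre.length + 1, h⟩))
        (letterCls (pre ++ b :: a :: suf)) := by
  have e := colourCls_comp (Equiv.swap ⟨pre.length, by omega⟩ ⟨pre.length + 1, h⟩)
    (fun i => (pre ++ b :: a :: suf).getD i.val 0)
  rw [Equiv.swap_inv] at e
  rw [letterCls, letterCls, ← e]
  congr 1
  funext i
  obtain ⟨i, hi⟩ := i
  rw [Function.comp_apply, Equiv.swap_apply_def]
  simp only [Fin.mk.injEq]
  split_ifs with h1 h2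
  · subst h1
    simp
  · subst h2
    simp
  · rcases lt_or_gt_of_ne h1 with h3 | h3
    · rw [List.getD_append _ _ _ _ h3, List.getD_append _ _ _ _ h3]
    · obtain ⟨j, rfl⟩ : ∃ j, i = pre.length + (j + 2) := ⟨i - pre.length - 2, by omega⟩
      rw [List.getD_append_right _ _ _ _ h3.le, List.getD_append_right _ _ _ _ h3.le]
      simp

end GrassPoly

namespace GrassPoly

section Quadrilinear

variable {F : Type} [Field F] {W : Type} [AddCommGroup W] [Module ℚ W]

/-- The quadrilinear map given by a linear map on `V_F^{⊗4}`. -/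
noncomputable def quad (Φ : TP F 4 →ₗ[ℚ] W) :
    VF F →ₗ[ℚ] VF F →ₗ[ℚ] VF F →ₗ[ℚ] VF F →ₗ[ℚ] W :=
  LinearMap.compRight ℚ (LinearMap.compRight ℚ (LinearMap.compRight ℚ Φ)) ∘ₗ T4L

theorem quad_apply (Φ : TP F 4 →ₗ[ℚ] W) (a b c d : VF F) : quad Φ a b c d = Φ (T4L a b c d) := rfl

end Quadrilinear

theorem quad_AP {N m : ℕ} (a b c d : VF (FF N m)) :
    quad (AP N m) a b c d = quad (AltL N m) a b c d - quad (AltL N m) b a c d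
      - quad (AltL N m) b c a d + quad (AltL N m) c b a d - quad (AltL N m) b c d a
      + quad (AltL N m) c b d a + quad (AltL N m) c d b a - quad (AltL N m) d c b a := by
  simp only [quad_apply, AP, LinearMap.comp_apply, Pit_T4L, map_add, map_sub]

theorem isAlternating_value {N m : ℕ} {lc : List ℕ → VF (FF N m)}
    {Φ : TP (FF N m) 4 →ₗ[ℚ] TP (FF N m) 4}
    (hlc : ∀ n, n + 1 < 8 → ∃ τ : Equiv.Perm (Fin N), Equiv.Perm.sign τ = -1 ∧
      ∀ (pre suf : List ℕ) (a b : ℕ), pre.length = n →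
        lc (pre ++ a :: b :: suf) = vmap (permAut N m τ) (lc (pre ++ b :: a :: suf)))
    (h : ∀ (τ : Equiv.Perm (Fin N)) v, Φ (tpMap (permAut N m τ) v) =
      (((Equiv.Perm.sign τ : ℤˣ) : ℤ) : ℚ) • Φ v) :
    Word.IsAlternating (Word.value (quad Φ) lc) := by
  intro pre a b suf
  have hlen : (pre ++ a :: b :: suf).length = (pre ++ b :: a :: suf).length := by simp
  unfold Word.value
  by_cases h8 : (pre ++ b :: a :: suf).length = 8
  · rw [if_pos h8, if_pos (hlen.trans h8)]
    obtain ⟨τ, hτ, hswap⟩ := hlc pre.length (by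
      simp only [List.length_append, List.length_cons] at h8
      omega)
    have key : ∀ k, lc ((pre ++ a :: b :: suf).map (Word.dig k)) =
        vmap (permAut N m τ) (lc ((pre ++ b :: a :: suf).map (Word.dig k))) := by
      intro k
      simpa only [List.map_append, List.map_cons] using
        hswap (pre.map (Word.dig k)) (suf.map (Word.dig k)) (Word.dig k a) (Word.dig k b)
          (List.length_map _)
    rw [key, key, key, key, quad_apply, ← tpMap_T4L, h, quad_apply, hτ]
    simp
  · rw [if_neg h8, if_neg (fun h' => h8 (hlen.symm.trans h')), neg_zero]

theorem exists_perm_letterCls (n : ℕ) (hn : n + 1 < 8) :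
    ∃ τ : Equiv.Perm (Fin 8), Equiv.Perm.sign τ = -1 ∧
      ∀ (pre suf : List ℕ) (a b : ℕ), pre.length = n →
        letterCls (pre ++ a :: b :: suf) =
          vmap (permAut 8 4 τ) (letterCls (pre ++ b :: a :: suf)) := by
  refine ⟨Equiv.swap ⟨n, by omega⟩ ⟨n + 1, hn⟩, Equiv.Perm.sign_swap (by simp), ?_⟩
  rintro pre suf a b rfl
  exact letterCls_swap a b hn

theorem letterCls_eq_of_injective {l : List ℕ} (k : Fin 3) {f : Fin 8 → Fin 8}
    (hf : Function.Injective f) (h : ∀ i, l.getD (f i).val 0 = baseColour k i) :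
    letterCls l =
      cls (permAut 8 4 (Equiv.ofBijective f (Finite.injective_iff_bijective.mp hf)) (baseElt k)) :=
  colourCls_eq h

theorem letterCls_minor {l : List ℕ} {f : Fin 8 → Fin 8} (hf : Function.Injective f)
    (h : ∀ i, l.getD (f i).val 0 = baseColour 0 i) :
    letterCls l = cls (d4 ((f 0).val + 1) ((f 1).val + 1) ((f 2).val + 1) ((f 3).val + 1)) := by
  rw [letterCls_eq_of_injective 0 hf h]
  exact congrArg cls (permAut_d4 _ _ _ _ _)

theorem letterCls_plane {l : List ℕ} {f : Fin 8 → Fin 8} (hf : Function.Injective f)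
    (h : ∀ i, l.getD (f i).val 0 = baseColour 1 i) :
    letterCls l = cls (A4 ((f 0).val + 1) ((f 1).val + 1) ((f 2).val + 1) ((f 3).val + 1)
      ((f 4).val + 1) ((f 5).val + 1) ((f 6).val + 1) ((f 7).val + 1)) := by
  rw [letterCls_eq_of_injective 1 hf h]
  exact congrArg cls (permAut_A4 _ _ _ _ _ _ _ _ _)

theorem letterCls_line {l : List ℕ} {f : Fin 8 → Fin 8} (hf : Function.Injective f)
    (h : ∀ i, l.getD (f i).val 0 = baseColour 2 i) :
    letterCls l = cls (Q4 ((f 3).val + 1) ((f 1).val + 1) ((f 2).val + 1) ((f 4).val + 1)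
      ((f 5).val + 1) ((f 6).val + 1) ((f 7).val + 1)) := by
  rw [letterCls_eq_of_injective 2 hf h]
  exact congrArg cls (permAut_Q4 _ _ _ _ _ _ _ _)

theorem letterCls_1234 : letterCls [1, 1, 1, 1, 0, 0, 0, 0] = cls (d4 1 2 3 4) :=
  letterCls_minor (f := ![0, 1, 2, 3, 4, 5, 6, 7]) (by decide) (by decide)

theorem letterCls_1237 : letterCls [1, 1, 1, 0, 0, 0, 1, 0] = cls (d4 1 2 3 7) :=
  letterCls_minor (f := ![0, 1, 2, 6, 3, 4, 5, 7]) (by decide) (by decide)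

theorem letterCls_1238 : letterCls [1, 1, 1, 0, 0, 0, 0, 1] = cls (d4 1 2 3 8) :=
  letterCls_minor (f := ![0, 1, 2, 7, 3, 4, 5, 6]) (by decide) (by decide)

theorem letterCls_2345 : letterCls [0, 1, 1, 1, 1, 0, 0, 0] = cls (d4 2 3 4 5) :=
  letterCls_minor (f := ![1, 2, 3, 4, 0, 5, 6, 7]) (by decide) (by decide)

theorem letterCls_2347 : letterCls [0, 1, 1, 1, 0, 0, 1, 0] = cls (d4 2 3 4 7) :=
  letterCls_minor (f := ![1, 2, 3, 6, 0, 4, 5, 7]) (by decide) (by decide)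

theorem letterCls_2348 : letterCls [0, 1, 1, 1, 0, 0, 0, 1] = cls (d4 2 3 4 8) :=
  letterCls_minor (f := ![1, 2, 3, 7, 0, 4, 5, 6]) (by decide) (by decide)

theorem letterCls_2378 : letterCls [0, 1, 1, 0, 0, 0, 1, 1] = cls (d4 2 3 7 8) :=
  letterCls_minor (f := ![1, 2, 6, 7, 0, 3, 4, 5]) (by decide) (by decide)

theorem letterCls_3456 : letterCls [0, 0, 1, 1, 1, 1, 0, 0] = cls (d4 3 4 5 6) :=
  letterCls_minor (f := ![2, 3, 4, 5, 0, 1, 6, 7]) (by decide) (by decide)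

theorem letterCls_3458 : letterCls [0, 0, 1, 1, 1, 0, 0, 1] = cls (d4 3 4 5 8) :=
  letterCls_minor (f := ![2, 3, 4, 7, 0, 1, 5, 6]) (by decide) (by decide)

theorem letterCls_3478 : letterCls [0, 0, 1, 1, 0, 0, 1, 1] = cls (d4 3 4 7 8) :=
  letterCls_minor (f := ![2, 3, 6, 7, 0, 1, 4, 5]) (by decide) (by decide)

theorem letterCls_4567 : letterCls [0, 0, 0, 1, 1, 1, 1, 0] = cls (d4 4 5 6 7) :=
  letterCls_minor (f := ![3, 4, 5, 6, 0, 1, 2, 7]) (by decide) (by decide)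

theorem letterCls_4568 : letterCls [0, 0, 0, 1, 1, 1, 0, 1] = cls (d4 4 5 6 8) :=
  letterCls_minor (f := ![3, 4, 5, 7, 0, 1, 2, 6]) (by decide) (by decide)

theorem letterCls_4578 : letterCls [0, 0, 0, 1, 1, 0, 1, 1] = cls (d4 4 5 7 8) :=
  letterCls_minor (f := ![3, 4, 6, 7, 0, 1, 2, 5]) (by decide) (by decide)

theorem letterCls_A4 : letterCls [2, 2, 2, 3, 3, 3, 4, 4] = cls (A4 1 2 3 4 5 6 7 8) :=
  letterCls_plane (f := id) (by decide) (by decide)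

theorem letterCls_Q4_423 : letterCls [9, 5, 5, 8, 6, 6, 7, 7] = cls (Q4 4 2 3 5 6 7 8) :=
  letterCls_line (f := ![0, 1, 2, 3, 4, 5, 6, 7]) (by decide) (by decide)

theorem letterCls_Q4_423_swap : letterCls [9, 6, 6, 8, 5, 5, 7, 7] = cls (Q4 4 2 3 5 6 7 8) := by
  rw [Q4_block12 4 5 6 2 3 7 8, cls_neg]
  exact letterCls_line (f := ![0, 4, 5, 3, 1, 2, 6, 7]) (by decide) (by decide)

theorem letterCls_Q4_312 : letterCls [5, 5, 8, 6, 6, 9, 7, 7] = cls (Q4 3 1 2 4 5 7 8) :=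
  letterCls_line (f := ![5, 0, 1, 2, 3, 4, 6, 7]) (by decide) (by decide)

theorem letterCls_Q4_312_swap : letterCls [6, 6, 8, 5, 5, 9, 7, 7] = cls (Q4 3 1 2 4 5 7 8) := by
  rw [Q4_block12 3 4 5 1 2 7 8, cls_neg]
  exact letterCls_line (f := ![5, 3, 4, 2, 0, 1, 6, 7]) (by decide) (by decide)

end GrassPoly

namespace GrassPoly

section Words

variable {V W : Type*} [AddCommGroup V] [Module ℚ V] [AddCommGroup W] [Module ℚ W]

/-- The symbol of `I_{3,1}(x, y)` under a quadrilinear map, in terms of the classes of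
`x`, `1 - x`, `y`, `1 - y` and `x - y`. -/
def quadWord31 (M : V →ₗ[ℚ] V →ₗ[ℚ] V →ₗ[ℚ] V →ₗ[ℚ] W) (x X y Y D : V) : W :=
  M (X - x) (Y + x - D) (x - y) (x - y) - M (Y - y) (x - D) (x - y) (x - y)
    + M (X - x) x Y (x - y) + M (X - x) x x Y - M (X - x) x x x

variable {M M' : V →ₗ[ℚ] V →ₗ[ℚ] V →ₗ[ℚ] V →ₗ[ℚ] W}

theorem quadWord31_eq {x y r : V} (hr : x - y = r) (X Y L : V) :
    quadWord31 M x X y Y (x + L) =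
      (M (X - x) Y r r + M (X - x) x Y r + M (X - x) x x Y - M (X - x) x x x)
        + M ((Y - y) - (X - x)) L r r := by
  have h1 : Y + x - (x + L) = Y - L := by abel
  have h2 : x - (x + L) = -L := by abel
  rw [quadWord31, hr, h1, h2]
  generalize X - x = u
  generalize Y - y = v
  simp only [map_sub, map_neg, LinearMap.sub_apply, LinearMap.neg_apply]
  abel

theorem quadWord31_combination
    (hM : ∀ a b c d, M' a b c d = M a b c d - M b a c d - M b c a d + M c b a d - M b c d a
      + M c b d a + M c d b a - M d c b a)
    {x₁ X₁ y₁ Y₁ x₂ X₂ y₂ Y₂ r L s : V} (h₁ : x₁ - y₁ = r) (h₂ : x₂ - y₂ = r)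
    (hs : M' s L r r = M' ((Y₂ - y₂) - (X₂ - x₂)) L r r)
    (hsum : ((Y₁ - y₁) - (X₁ - x₁)) + ((Y₂ - y₂) - (X₂ - x₂)) + s = (2 : ℚ) • r) :
    quadWord31 M' x₁ X₁ y₁ Y₁ (x₁ + L) + (2 : ℚ) • quadWord31 M' x₂ X₂ y₂ Y₂ (x₂ + L)
        + (6 : ℚ) • M' L r r r =
      (M' (X₁ - x₁) Y₁ r r + M' (X₁ - x₁) x₁ Y₁ r + M' (X₁ - x₁) x₁ x₁ Y₁
          - M' (X₁ - x₁) x₁ x₁ x₁)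
        + (2 : ℚ) • (M' (X₂ - x₂) Y₂ r r + M' (X₂ - x₂) x₂ Y₂ r + M' (X₂ - x₂) x₂ x₂ Y₂
          - M' (X₂ - x₂) x₂ x₂ x₂) := by
  rw [quadWord31_eq h₁, quadWord31_eq h₂]
  have e := congrArg (fun v => M' v L r r) hsum
  simp only [map_add, map_smul, LinearMap.add_apply, LinearMap.smul_apply, hs] at e
  have e1 : M' r L r r = -(3 : ℚ) • M' L r r r := by
    rw [hM, hM]
    module
  rw [e1] at e
  rw [← sub_eq_zero] at e ⊢
  rw [← e]
  module

end Words

theorem map_word31 {F : Type} [Field F] {W : Type} [AddCommGroup W] [Module ℚ W]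
    (Φ : TP F 4 →ₗ[ℚ] W) (x X y Y D : VF F) :
    Φ (word31 x X y Y D) = quadWord31 (quad Φ) x X y Y D := by
  rw [word31, quadWord31, map_sub, map_add, map_add, map_sub]
  rfl

theorem map_SI31 {F : Type} [Field F] {W : Type} [AddCommGroup W] [Module ℚ W]
    (Φ : TP F 4 →ₗ[ℚ] W) {a b t : F} (ha : a ≠ 0) (ht : 1 - t ≠ 0) (h : a * t = b) :
    Φ (SI31 a b) = quadWord31 (quad Φ) (cls a) (cls (1 - a)) (cls b) (cls (1 - b))
      (cls a + cls (1 - t)) := by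
  rw [SI31_eq, map_word31, ← cls_mul ha ht, ← h, mul_sub, mul_one]

theorem map_SLi4 {F : Type} [Field F] {W : Type} [AddCommGroup W] [Module ℚ W]
    (Φ : TP F 4 →ₗ[ℚ] W) (t : F) :
    Φ (SLi4 t) = quad Φ (cls (1 - t)) (-cls t) (-cls t) (-cls t) := by
  rw [SLi4_eq]
  simp only [quad_apply, map_neg, LinearMap.neg_apply, neg_neg]

namespace Tri

variable {F : Type} [Field F] {x p q r : F}

theorem cls_eq (h : Tri x p q r) : cls x = cls p - cls r := by
  rw [h.eq_div, cls_div h.p_ne h.r_ne]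

theorem cls_one_sub (h : Tri x p q r) : cls (1 - x) = cls q - cls r := by
  rw [h.one_sub_eq_div, cls_div h.q_ne h.r_ne]

end Tri

theorem cls_mul_three {F : Type} [Field F] {a b c : F} (ha : a ≠ 0) (hb : b ≠ 0) (hc : c ≠ 0) :
    cls (a * b * c) = cls a + cls b + cls c := by
  rw [cls_mul (mul_ne_zero ha hb) hc, cls_mul ha hb]

theorem cls_mul_four {F : Type} [Field F] {a b c d : F} (ha : a ≠ 0) (hb : b ≠ 0) (hc : c ≠ 0)
    (hd : d ≠ 0) : cls (a * b * c * d) = cls a + cls b + cls c + cls d := by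
  rw [cls_mul (mul_ne_zero (mul_ne_zero ha hb) hc) hd, cls_mul_three ha hb hc]

/-- The quotient of the arguments of both `I_{3,1}` terms. -/
noncomputable def argRatio : K4 := rho 1 * rr 3 2 / (rr 1 2 * rr 3 4)

theorem rr_one_two_ne_zero : rr 1 2 ≠ 0 := (div_ne_zero_iff.1 tri_rr_div_rho.ne_zero).1

theorem rr_three_four_ne_zero : rr 3 4 ≠ 0 := (div_ne_zero_iff.1 tri_rr_div_rr.ne_zero).2

theorem rr_one_four_ne_zero : rr 1 4 ≠ 0 := (div_ne_zero_iff.1 tri_rho_div_rr.ne_zero).2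

theorem mul_argRatio_fst : rr 1 2 * rr 3 4 / (rr 1 4 * rr 3 2) * argRatio = rho 1 / rr 1 4 := by
  have h1 := rho_one_ne_zero
  have h2 := rr_one_two_ne_zero
  have h3 := rr_three_four_ne_zero
  have h4 := rr_one_four_ne_zero
  have h5 := rr_three_two_ne_zero
  rw [argRatio]
  field_simp

theorem mul_argRatio_snd : rr 1 2 / rho 1 * argRatio = rr 3 2 / rr 3 4 := by
  have h1 := rho_one_ne_zero
  have h2 := rr_one_two_ne_zero
  have h3 := rr_three_four_ne_zero
  rw [argRatio]
  field_simp

theorem argRatio_den_sub_num_ne_zero :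
    d4 1 2 3 4 * d4 2 3 7 8 * d4 3 4 5 6 * d4 4 5 7 8
      + d4 1 2 3 7 * d4 2 3 4 5 * d4 3 4 7 8 * d4 4 5 6 8 ≠ 0 := by
  simp only [d4_eq_algebraMap, ← map_mul, ← map_add]
  apply ne_zero_of_evalCubic
  simp only [map_add, map_mul]
  repeat rw [evalCubic_d4P (by decide) (by decide) (by decide) (by decide)]
  norm_num [d4N]

theorem tri_argRatio : Tri argRatio (-(d4 1 2 3 7 * d4 2 3 4 5 * d4 3 4 7 8 * d4 4 5 6 8))
    (d4 1 2 3 4 * d4 2 3 7 8 * d4 3 4 5 6 * d4 4 5 7 8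
      + d4 1 2 3 7 * d4 2 3 4 5 * d4 3 4 7 8 * d4 4 5 6 8)
    (d4 1 2 3 4 * d4 2 3 7 8 * d4 3 4 5 6 * d4 4 5 7 8) where
  p_ne := by simp [d4_ne_zero]
  q_ne := argRatio_den_sub_num_ne_zero
  r_ne := by simp [d4_ne_zero]
  val := by
    rw [mul_assoc, mul_assoc, ← mul_assoc (d4 1 2 3 4), ← rr_one_two, ← rr_three_four]
    have h := rr_three_two
    have h1 := rr_one_two_ne_zero
    have h2 := rr_three_four_ne_zero
    have h3 := d4_ne_zero (a := 1) (b := 2) (c := 3) (d := 8) (by norm_num)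
    rw [argRatio, rho_one]
    field_simp
    linear_combination d4 1 2 3 7 * d4 4 5 6 8 * h
  sum := by ring

/-- The symmetry `i ↔ 7 - i`, `7 ↔ 8` of the two arguments. -/
def flipPerm : Equiv.Perm (Fin 8) :=
  Equiv.swap 0 5 * Equiv.swap 1 4 * Equiv.swap 2 3 * Equiv.swap 6 7

theorem sign_flipPerm : Equiv.Perm.sign flipPerm = 1 := by
  simp [flipPerm, Equiv.Perm.sign_mul]

theorem lab_flipPerm : lab flipPerm 1 = 6 ∧ lab flipPerm 2 = 5 ∧ lab flipPerm 3 = 4 ∧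
    lab flipPerm 4 = 3 ∧ lab flipPerm 5 = 2 ∧ lab flipPerm 6 = 1 ∧ lab flipPerm 7 = 8 ∧
    lab flipPerm 8 = 7 := by
  decide

theorem permAut_flipPerm_argRatio : permAut 8 4 flipPerm argRatio = argRatio := by
  rw [tri_argRatio.eq_div]
  simp only [map_div₀, map_mul, map_neg, permAut_d4, lab_flipPerm]
  simp only [d4_sort12, d4_sort23, d4_sort34, Nat.reduceLT]
  congr 1 <;> ring

end GrassPoly

namespace GrassPoly

theorem cls_arg_fst : cls (rr 1 2 * rr 3 4 / (rr 1 4 * rr 3 2)) =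
    cls (d4 1 2 3 4) + cls (d4 2 3 7 8) + cls (d4 3 4 5 6) + cls (d4 4 5 7 8)
      - (cls (d4 2 3 4 5) + cls (d4 3 4 7 8) + cls (A4 1 2 3 4 5 6 7 8)) := by
  rw [tri_rr_fst_arg.cls_eq, cls_neg]
  rw [cls_mul_four, cls_mul_three] <;> simp [d4_ne_zero, A4_ne_zero]

theorem cls_one_sub_arg_fst : cls (1 - rr 1 2 * rr 3 4 / (rr 1 4 * rr 3 2)) =
    cls (Q4 4 2 3 5 6 7 8) + cls (Q4 3 1 2 4 5 7 8)
      - (cls (d4 2 3 4 5) + cls (d4 3 4 7 8) + cls (A4 1 2 3 4 5 6 7 8)) := by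
  rw [tri_rr_fst_arg.cls_one_sub]
  rw [cls_mul, cls_mul_three] <;> simp [d4_ne_zero, A4_ne_zero, Q4_423_ne_zero, Q4_312_ne_zero]

theorem cls_snd_fst : cls (rho 1 / rr 1 4) =
    cls (d4 1 2 3 7) + cls (d4 4 5 6 8) - cls (A4 1 2 3 4 5 6 7 8) := by
  rw [tri_rho_div_rr.cls_eq]
  rw [cls_mul] <;> simp [d4_ne_zero]

theorem cls_one_sub_snd_fst : cls (1 - rho 1 / rr 1 4) =
    cls (d4 1 2 3 8) + cls (d4 4 5 6 7) - cls (A4 1 2 3 4 5 6 7 8) := by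
  rw [tri_rho_div_rr.cls_one_sub, cls_neg]
  rw [cls_mul] <;> simp [d4_ne_zero]

theorem cls_arg_snd : cls (rr 1 2 / rho 1) =
    cls (d4 1 2 3 4) + cls (d4 2 3 7 8) - (cls (d4 1 2 3 7) + cls (d4 2 3 4 8)) := by
  rw [tri_rr_div_rho.cls_eq]
  rw [cls_mul, cls_mul] <;> simp [d4_ne_zero]

theorem cls_one_sub_arg_snd : cls (1 - rr 1 2 / rho 1) =
    cls (d4 1 2 3 8) + cls (d4 2 3 4 7) - (cls (d4 1 2 3 7) + cls (d4 2 3 4 8)) := by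
  rw [tri_rr_div_rho.cls_one_sub]
  rw [cls_mul, cls_mul] <;> simp [d4_ne_zero]

theorem cls_snd_snd : cls (rr 3 2 / rr 3 4) =
    cls (d4 2 3 4 5) + cls (d4 3 4 7 8) + cls (d4 4 5 6 8)
      - (cls (d4 2 3 4 8) + cls (d4 3 4 5 6) + cls (d4 4 5 7 8)) := by
  rw [tri_rr_div_rr.cls_eq, cls_neg]
  rw [cls_mul_three, cls_mul_three] <;> simp [d4_ne_zero]

theorem cls_one_sub_snd_snd : cls (1 - rr 3 2 / rr 3 4) =
    cls (d4 3 4 5 8) + cls (Q4 4 2 3 5 6 7 8)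
      - (cls (d4 2 3 4 8) + cls (d4 3 4 5 6) + cls (d4 4 5 7 8)) := by
  rw [tri_rr_div_rr.cls_one_sub]
  rw [cls_mul, cls_mul_three] <;> simp [d4_ne_zero, Q4_423_ne_zero]

theorem cls_argRatio : cls argRatio =
    cls (d4 1 2 3 7) + cls (d4 2 3 4 5) + cls (d4 3 4 7 8) + cls (d4 4 5 6 8)
      - (cls (d4 1 2 3 4) + cls (d4 2 3 7 8) + cls (d4 3 4 5 6) + cls (d4 4 5 7 8)) := by
  rw [tri_argRatio.cls_eq, cls_neg]
  rw [cls_mul_four, cls_mul_four] <;> simp [d4_ne_zero]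

theorem arg_sub_snd_fst : cls (rr 1 2 * rr 3 4 / (rr 1 4 * rr 3 2)) - cls (rho 1 / rr 1 4) =
    -cls argRatio := by
  rw [← mul_argRatio_fst, cls_mul tri_rr_fst_arg.ne_zero tri_argRatio.ne_zero]
  abel

theorem arg_sub_snd_snd : cls (rr 1 2 / rho 1) - cls (rr 3 2 / rr 3 4) = -cls argRatio := by
  rw [← mul_argRatio_snd, cls_mul tri_rr_div_rho.ne_zero tri_argRatio.ne_zero]
  abel

/-- The coefficient of `[1 - argRatio]` in the second `I_{3,1}` term. -/
noncomputable def coeffSnd : VF K4 :=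
  (cls (1 - rr 3 2 / rr 3 4) - cls (rr 3 2 / rr 3 4))
    - (cls (1 - rr 1 2 / rho 1) - cls (rr 1 2 / rho 1))

theorem coeffSnd_eq : coeffSnd =
    cls (d4 3 4 5 8) + cls (Q4 4 2 3 5 6 7 8) - cls (d4 2 3 4 5) - cls (d4 3 4 7 8)
      - cls (d4 4 5 6 8) - cls (d4 1 2 3 8) - cls (d4 2 3 4 7) + cls (d4 1 2 3 4)
      + cls (d4 2 3 7 8) := by
  rw [coeffSnd, cls_one_sub_snd_snd, cls_snd_snd, cls_one_sub_arg_snd, cls_arg_snd]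
  abel

theorem permAut_flipPerm_Q4 :
    cls (permAut 8 4 flipPerm (Q4 4 2 3 5 6 7 8)) = cls (Q4 3 1 2 4 5 7 8) := by
  simp only [permAut_Q4, lab_flipPerm]
  have h : Q4 3 5 4 2 1 8 7 = Q4 3 1 2 4 5 7 8 := by
    simp only [Q4, d4_sort12, d4_sort23, Nat.reduceLT]
    ring
  rw [h]

theorem vmap_flipPerm_coeffSnd : vmap (permAut 8 4 flipPerm) coeffSnd =
    cls (d4 2 3 4 7) + cls (Q4 3 1 2 4 5 7 8) - cls (d4 2 3 4 5) - cls (d4 3 4 7 8)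
      - cls (d4 1 2 3 7) - cls (d4 4 5 6 7) - cls (d4 3 4 5 8) + cls (d4 3 4 5 6)
      + cls (d4 4 5 7 8) := by
  rw [coeffSnd_eq]
  simp only [map_add, map_sub, vmap_cls, permAut_flipPerm_Q4, permAut_d4, lab_flipPerm]
  simp only [d4_sort12, d4_sort23, d4_sort34, Nat.reduceLT, cls_neg, neg_neg]

theorem coeff_sum :
    ((cls (1 - rho 1 / rr 1 4) - cls (rho 1 / rr 1 4))
        - (cls (1 - rr 1 2 * rr 3 4 / (rr 1 4 * rr 3 2))
          - cls (rr 1 2 * rr 3 4 / (rr 1 4 * rr 3 2))))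
      + coeffSnd + vmap (permAut 8 4 flipPerm) coeffSnd = (2 : ℚ) • (-cls argRatio) := by
  rw [vmap_flipPerm_coeffSnd, coeffSnd_eq, cls_one_sub_snd_fst, cls_snd_fst,
    cls_one_sub_arg_fst, cls_arg_fst, cls_argRatio]
  module

theorem quad_AP_of_fixed {N m : ℕ} {τ : Equiv.Perm (Fin N)} (hτ : Equiv.Perm.sign τ = 1)
    (a : VF (FF N m)) {b c d : VF (FF N m)} (hb : vmap (permAut N m τ) b = b)
    (hc : vmap (permAut N m τ) c = c) (hd : vmap (permAut N m τ) d = d) :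
    quad (AP N m) (vmap (permAut N m τ) a) b c d = quad (AP N m) a b c d := by
  have e : quad (AP N m) (vmap (permAut N m τ) a) (vmap (permAut N m τ) b)
      (vmap (permAut N m τ) c) (vmap (permAut N m τ) d) = quad (AP N m) a b c d := by
    rw [quad_apply, ← tpMap_T4L, AP_tpMap, hτ, quad_apply]
    simp
  rwa [hb, hc, hd] at e

theorem eval_skewFst : Word.eval letterCls Word.skewFst =
    (2 : ℚ) • (cls (1 - rr 1 2 * rr 3 4 / (rr 1 4 * rr 3 2))
      - cls (rr 1 2 * rr 3 4 / (rr 1 4 * rr 3 2))) := by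
  rw [cls_one_sub_arg_fst, cls_arg_fst]
  simp only [Word.eval, Word.skewFst, List.map_cons, List.map_nil, List.sum_cons, List.sum_nil,
    letterCls_Q4_423, letterCls_Q4_423_swap, letterCls_Q4_312, letterCls_Q4_312_swap,
    letterCls_1234, letterCls_2378, letterCls_3456, letterCls_4578, Int.cast_one, Int.cast_neg,
    Int.cast_ofNat]
  module

theorem eval_argFst : Word.eval letterCls Word.argFst =
    cls (rr 1 2 * rr 3 4 / (rr 1 4 * rr 3 2)) := by
  rw [cls_arg_fst]
  simp only [Word.eval, Word.argFst, List.map_cons, List.map_nil, List.sum_cons, List.sum_nil,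
    letterCls_1234, letterCls_2378, letterCls_3456, letterCls_4578, letterCls_2345, letterCls_3478,
    letterCls_A4, Int.cast_one, Int.cast_neg]
  module

theorem eval_complFst : Word.eval letterCls Word.complFst =
    cls (1 - rho 1 / rr 1 4) := by
  rw [cls_one_sub_snd_fst]
  simp only [Word.eval, Word.complFst, List.map_cons, List.map_nil, List.sum_cons, List.sum_nil,
    letterCls_1238, letterCls_4567, letterCls_A4, Int.cast_one, Int.cast_neg]
  module

theorem eval_skewSnd : Word.eval letterCls Word.skewSnd =
    cls (1 - rr 1 2 / rho 1) - cls (rr 1 2 / rho 1) := by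
  rw [cls_one_sub_arg_snd, cls_arg_snd]
  simp only [Word.eval, Word.skewSnd, List.map_cons, List.map_nil, List.sum_cons, List.sum_nil,
    letterCls_1238, letterCls_2347, letterCls_1234, letterCls_2378, Int.cast_one, Int.cast_neg]
  module

theorem eval_argSnd : Word.eval letterCls Word.argSnd =
    cls (rr 1 2 / rho 1) := by
  rw [cls_arg_snd]
  simp only [Word.eval, Word.argSnd, List.map_cons, List.map_nil, List.sum_cons, List.sum_nil,
    letterCls_1234, letterCls_2378, letterCls_1237, letterCls_2348, Int.cast_one, Int.cast_neg]
  module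

theorem eval_complSnd : Word.eval letterCls Word.complSnd =
    (2 : ℚ) • cls (1 - rr 3 2 / rr 3 4) := by
  rw [cls_one_sub_snd_snd]
  simp only [Word.eval, Word.complSnd, List.map_cons, List.map_nil, List.sum_cons, List.sum_nil,
    letterCls_3458, letterCls_Q4_423, letterCls_Q4_423_swap, letterCls_2348, letterCls_3456,
    letterCls_4578, Int.cast_one, Int.cast_neg, Int.cast_ofNat]
  module

theorem eval_ratio : Word.eval letterCls Word.ratio =
    -cls argRatio := by
  rw [cls_argRatio]
  simp only [Word.eval, Word.ratio, List.map_cons, List.map_nil, List.sum_cons, List.sum_nil,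
    letterCls_1234, letterCls_2378, letterCls_3456, letterCls_4578, letterCls_2345, letterCls_3478,
    letterCls_1237, letterCls_4568, Int.cast_one, Int.cast_neg]
  module

end GrassPoly

namespace GrassPoly

theorem AP_SI31_of_eval {N m : ℕ} {a₁ b₁ a₂ b₂ t t' l₁ l₂ l₃ l₄ : FF N m}
    {lc : List ℕ → VF (FF N m)} {τ : Equiv.Perm (Fin N)} (ha₁ : a₁ ≠ 0) (ha₂ : a₂ ≠ 0)
    (ht : 1 - t ≠ 0) (htt : t = t') (h₁ : a₁ * t = b₁) (h₂ : a₂ * t = b₂)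
    (hlc : ∀ n, n + 1 < 8 → ∃ τ : Equiv.Perm (Fin N), Equiv.Perm.sign τ = -1 ∧
      ∀ (pre suf : List ℕ) (a b : ℕ), pre.length = n →
        lc (pre ++ a :: b :: suf) = vmap (permAut N m τ) (lc (pre ++ b :: a :: suf)))
    (hr₁ : cls a₁ - cls b₁ = -cls t) (hr₂ : cls a₂ - cls b₂ = -cls t)
    (hτ : Equiv.Perm.sign τ = 1) (hτt : permAut N m τ t = t)
    (hsum : ((cls (1 - b₁) - cls b₁) - (cls (1 - a₁) - cls a₁))
      + ((cls (1 - b₂) - cls b₂) - (cls (1 - a₂) - cls a₂))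
      + vmap (permAut N m τ) ((cls (1 - b₂) - cls b₂) - (cls (1 - a₂) - cls a₂)) =
        (2 : ℚ) • (-cls t))
    (hu₁ : Word.eval lc Word.skewFst = (2 : ℚ) • (cls (1 - a₁) - cls a₁))
    (hx₁ : Word.eval lc Word.argFst = cls a₁)
    (hy₁ : Word.eval lc Word.complFst = cls (1 - b₁))
    (hu₂ : Word.eval lc Word.skewSnd = cls (1 - a₂) - cls a₂)
    (hx₂ : Word.eval lc Word.argSnd = cls a₂)
    (hy₂ : Word.eval lc Word.complSnd = (2 : ℚ) • cls (1 - b₂))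
    (hr : Word.eval lc Word.ratio = -cls t)
    (hl₁ : lc [1, 1, 1, 1, 0, 0, 0, 0] = cls l₁) (hl₂ : lc [0, 1, 1, 1, 1, 0, 0, 0] = cls l₂)
    (hl₃ : lc [0, 0, 1, 1, 1, 1, 0, 0] = cls l₃) (hl₄ : lc [0, 0, 0, 1, 1, 1, 1, 0] = cls l₄) :
    AP N m (SI31 a₁ b₁) + (2 : ℚ) • AP N m (SI31 a₂ b₂) + (6 : ℚ) • AP N m (SLi4 t') =
      (56 : ℚ) • AP N m (T4 (cls l₁) (cls l₂) (cls l₃) (cls l₄)) := by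
  have hs := quad_AP_of_fixed hτ ((cls (1 - b₂) - cls b₂) - (cls (1 - a₂) - cls a₂))
    (b := cls (1 - t)) (c := -cls t) (d := -cls t) (by rw [vmap_cls, map_sub, map_one, hτt])
    (by rw [map_neg, vmap_cls, hτt]) (by rw [map_neg, vmap_cls, hτt])
  rw [← htt, map_SI31 _ ha₁ ht h₁, map_SI31 _ ha₂ ht h₂, map_SLi4,
    quadWord31_combination quad_AP hr₁ hr₂ hs hsum,
    Word.word_identity (isAlternating_value hlc AltL_tpMap) (isAlternating_value hlc AP_tpMap)
      quad_AP hu₁ hx₁ hy₁ hu₂ hx₂ hy₂ hr, quad_apply, T4L_apply, hl₁, hl₂, hl₃, hl₄]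

theorem argRatio_eq : argRatio = rho 1 * rr 3 2 / (rr 1 2 * rr 3 4) := rfl

theorem AP_SI31_combination :
    AP 8 4 (SI31 (rr 1 2 * rr 3 4 / (rr 1 4 * rr 3 2)) (rho 1 / rr 1 4))
        + (2 : ℚ) • AP 8 4 (SI31 (rr 1 2 / rho 1) (rr 3 2 / rr 3 4))
        + (6 : ℚ) • AP 8 4 (SLi4 (rho 1 * rr 3 2 / (rr 1 2 * rr 3 4))) =
      (56 : ℚ) • AP 8 4 (T4 (cls (d4 1 2 3 4)) (cls (d4 2 3 4 5)) (cls (d4 3 4 5 6))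
        (cls (d4 4 5 6 7))) :=
  AP_SI31_of_eval tri_rr_fst_arg.ne_zero tri_rr_div_rho.ne_zero
    tri_argRatio.one_sub_ne_zero argRatio_eq mul_argRatio_fst mul_argRatio_snd
    exists_perm_letterCls arg_sub_snd_fst arg_sub_snd_snd sign_flipPerm
    permAut_flipPerm_argRatio coeff_sum eval_skewFst eval_argFst eval_complFst
    eval_skewSnd eval_argSnd eval_complSnd eval_ratio letterCls_1234 letterCls_2345
    letterCls_3456 letterCls_4567

theorem Alt_Pit_tI31 {N m : ℕ} (x y : FF N m) : Alt (Pit 4 (tI31 x y)) = AG x y := by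
  rw [AG, AP_apply]

theorem smul_Pit_Alt_tprod {N m : ℕ} (a b c d : VF (FF N m)) :
    ((7 : ℚ) / 144) • Pit 4 (((2 : ℚ) * ((Nat.factorial 4 : ℚ)) ^ 2) •
      Alt (tprod ℚ ![a, b, c, d])) = (56 : ℚ) • AP N m (T4 a b c d) := by
  rw [map_smul, smul_smul, Pit_Alt, T4]
  norm_num [Nat.factorial]

theorem smul_Pit_Alt_add_smul_Alt_Pit {N m : ℕ} {a b c d : VF (FF N m)} {x y : FF N m}
    {v w : TP (FF N m) 4} (hv : AP N m v = w + (2 : ℚ) • AG x y)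
    (hw : w = (56 : ℚ) • AP N m (T4 a b c d)) :
    ((7 : ℚ) / 144) • Pit 4 (((2 : ℚ) * ((Nat.factorial 4 : ℚ)) ^ 2) •
      Alt (tprod ℚ ![a, b, c, d])) + (2 : ℚ) • Alt (Pit 4 (tI31 x y)) = Alt (Pit 4 v) := by
  rw [smul_Pit_Alt_tprod, Alt_Pit_tI31, ← AP_apply, hv, hw]

end GrassPoly

/-- Theorem `gr4toli4`: explicit formula for `Gr₄` minus a coboundary in
terms of `Li₄` (via the combinations `V` and `Sym₃₆`). -/
theorem gr4_to_li4 :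
    ((7 : ℚ) / 144) • Pit 4 SGr4
        + (2 : ℚ) • Alt (Pit 4 (tI31 (CR 3 4 2 5 6 7) (CR 6 7 1 3 4 5))) =
      Alt (Pit 4 (
        -(Vc (rho 4 / rho 1) (rr 4 2 / rr 4 1) (rr 4 1 / rr 4 3)
          - Vc (rho 4 / rho 1) (CR 4 3 2 6 8 5) (CR 4 8 7 6 5 3)
          + (4 : ℚ)⁻¹ • Vc (rho 4 / rho 1) (CR 4 3 1 2 5 6) (CR 4 3 1 2 6 8)
          - (12 : ℚ)⁻¹ • Vc (rho 4 / rho 1) (CR 4 3 1 2 5 6) (CR 4 2 1 3 6 5))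
        + (- Vc (rho 2 / rho 1) (CR 4 3 2 6 8 5) (CR 4 8 7 6 5 3)
          + Vc (rho 2 / rho 1) (CR 4 8 7 2 3 5) (CR 4 8 7 2 6 3)
          + (2 : ℚ)⁻¹ • Vc (rho 2 / rho 1) (CR 4 6 5 2 3 8) (CR 4 3 2 5 6 8))
        + S36 (rr 1 2 * rr 3 4 / (rr 1 4 * rr 3 2)) (rho 1 / rr 1 4)
        + (2 : ℚ) • S36 (rr 1 2 / rho 1) (rr 3 2 / rr 3 4)
        + (6 : ℚ) • SLi4 (rho 1 * rr 3 2 / (rr 1 2 * rr 3 4)))) := by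
  have h := smul_Pit_Alt_add_smul_Alt_Pit alt_tI31_cancel AP_SI31_combination
  exact h
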